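/- For every fixed ε > 0 there exists δ = δ(ε) > 0 such that for all sufficiently large cubefree integers m and all positive integers N₁, N₂, N₃, N₄ with N₁N₂N₃N₄ > m^(1+ε), the number of residue classes modulo m of the form x₁x₂x₃x₄ with integers x_j ∈ [1, N_j] equals m + O(m^(1-δ)). -/

import Mathlib

/-! ### Points on `y ^ d = f x` over a finite field of square order -/

section Superelliptic

open Polynomial Polynomial.Bivariate

variable {F : Type*} [Field F]

/-- The reduction of `x ^ a * y ^ b` modulo `y ^ d = f x`, of degree less than `d` in `y`. -/
noncomputable def reducedMonomial (f : F[X]) (d a b : ℕ) : F[X][Y] :=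
  C (X ^ a * f ^ (b / d)) * X ^ (b % d)

lemma reducedMonomial_evalEval {f : F[X]} {d : ℕ} {x y : F} (h : y ^ d = f.eval x) (a b : ℕ) :
    (reducedMonomial f d a b).evalEval x y = x ^ a * y ^ b := by
  have : y ^ b = (f.eval x) ^ (b / d) * y ^ (b % d) := by
    rw [← h, ← pow_mul, ← pow_add, Nat.div_add_mod]
  simp [reducedMonomial, evalEval, this, mul_assoc]

lemma reducedMonomial_coeff (f : F[X]) (d a b i : ℕ) :
    (reducedMonomial f d a b).coeff i = if i = b % d then X ^ a * f ^ (b / d) else 0 := by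
  rw [reducedMonomial, coeff_C_mul, coeff_X_pow]
  split_ifs <;> simp

lemma le_of_reducedMonomial_coeff_coeff_ne_zero {f : F[X]} {d a b i k : ℕ}
    (h : ((reducedMonomial f d a b).coeff i).coeff k ≠ 0) :
    i = b % d ∧ d * k + f.natDegree * i ≤ d * a + f.natDegree * b := by
  rw [reducedMonomial_coeff] at h
  split_ifs at h with hi
  · refine ⟨hi, ?_⟩
    have hk : k ≤ a + (b / d) * f.natDegree := by
      have := le_natDegree_of_ne_zero h
      refine this.trans (natDegree_mul_le.trans ?_)
      gcongr
      · simp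
      · exact natDegree_pow_le
    calc d * k + f.natDegree * i ≤ d * (a + (b / d) * f.natDegree) + f.natDegree * i := by gcongr
      _ = d * a + f.natDegree * (d * (b / d) + b % d) := by rw [hi]; ring
      _ = _ := by rw [Nat.div_add_mod]
  · simp at h

lemma reducedMonomial_top_coeff {f : F[X]} (hf : f ≠ 0) (d a b : ℕ) :
    ((reducedMonomial f d a b).coeff (b % d)).coeff (a + (b / d) * f.natDegree) ≠ 0 := by
  have hne : (X ^ a * f ^ (b / d) : F[X]) ≠ 0 := mul_ne_zero (pow_ne_zero _ X_ne_zero) (pow_ne_zero _ hf)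
  have hdeg : (X ^ a * f ^ (b / d) : F[X]).natDegree = a + (b / d) * f.natDegree := by
    rw [natDegree_mul (pow_ne_zero _ X_ne_zero) (pow_ne_zero _ hf), natDegree_pow, natDegree_pow,
      natDegree_X, mul_one]
  rw [reducedMonomial_coeff, if_pos rfl, ← hdeg]
  exact leadingCoeff_ne_zero.mpr hne

/-- The exponents `(a, i)` with `i < d` of the monomials `x ^ a * y ^ i` of weight at most `k`,
where `x` has weight `d` and `y` has weight `D`. -/
def weightedExponents (d D k : ℕ) : Finset (ℕ × ℕ) :=
  (Finset.range (k + 1) ×ˢ Finset.range d).filter fun s => d * s.1 + D * s.2 ≤ k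

lemma mem_weightedExponents {d D k : ℕ} {s : ℕ × ℕ} :
    s ∈ weightedExponents d D k ↔ s.2 < d ∧ d * s.1 + D * s.2 ≤ k := by
  simp only [weightedExponents, Finset.mem_filter, Finset.mem_product, Finset.mem_range]
  refine ⟨fun h => ⟨h.1.2, h.2⟩, fun h => ⟨⟨?_, h.1⟩, h.2⟩⟩
  have : s.1 ≤ d * s.1 := Nat.le_mul_of_pos_left _ (by omega)
  omega

lemma weight_injOn {d D : ℕ} (hd : d.Coprime D) {s t : ℕ × ℕ} (hs : s.2 < d) (ht : t.2 < d)
    (h : d * s.1 + D * s.2 = d * t.1 + D * t.2) : s = t := by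
  have h2 : s.2 = t.2 := by
    have : D * s.2 ≡ D * t.2 [MOD d] := by
      have h' : (d * s.1 + D * s.2) % d = (d * t.1 + D * t.2) % d := by rw [h]
      simpa [Nat.ModEq, Nat.mul_add_mod] using h'
    have := Nat.ModEq.cancel_left_of_coprime hd this
    rwa [Nat.ModEq, Nat.mod_eq_of_lt hs, Nat.mod_eq_of_lt ht] at this
  have h1 : d * s.1 = d * t.1 := by rw [h2] at h; omega
  exact Prod.ext (Nat.eq_of_mul_eq_mul_left (by omega) h1) h2

lemma card_weightedExponents_le {d D : ℕ} (hd : d.Coprime D) (k : ℕ) :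
    (weightedExponents d D k).card ≤ k + 1 := by
  rw [← Finset.card_range (k + 1)]
  refine Finset.card_le_card_of_injOn (fun s => d * s.1 + D * s.2) (fun s hs => ?_) ?_
  · have := (mem_weightedExponents.mp hs).2
    simp only [Finset.coe_range, Set.mem_Iio]; omega
  · intro s hs t ht h
    exact weight_injOn hd (mem_weightedExponents.mp hs).1 (mem_weightedExponents.mp ht).1 h

lemma le_card_weightedExponents {d : ℕ} (hd : 0 < d) (D k : ℕ) :
    k + 1 ≤ (weightedExponents d D k).card + d * D := by
  have hsub : ((Finset.range d).sigma
      fun i => Finset.range ((k + 1 - D * i + d - 1) / d)).card ≤ (weightedExponents d D k).card := by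
    refine Finset.card_le_card_of_injOn (fun s => (s.2, s.1)) ?_ ?_
    · rintro ⟨i, a⟩ h
      simp only [Finset.coe_sigma, Set.mem_sigma_iff, Finset.mem_coe, Finset.mem_range] at h
      refine mem_weightedExponents.mpr ⟨h.1, ?_⟩
      have h2 : d * (a + 1) ≤ k + 1 - D * i + d - 1 :=
        (Nat.mul_le_mul_left d h.2).trans (Nat.mul_div_le _ _)
      dsimp only
      rw [mul_add, mul_one] at h2
      omega
    · rintro ⟨i, a⟩ _ ⟨j, b⟩ _ h
      simp only [Prod.mk.injEq] at h
      simp [h.1, h.2]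
  rw [Finset.card_sigma] at hsub
  have hterm : ∀ i ∈ Finset.range d,
      k + 1 ≤ d * (Finset.range ((k + 1 - D * i + d - 1) / d)).card + D * d := by
    intro i hi
    rw [Finset.card_range]
    have h1 := Nat.div_add_mod (k + 1 - D * i + d - 1) d
    have h2 := Nat.mod_lt (k + 1 - D * i + d - 1) hd
    have h3 : D * i ≤ D * d := Nat.mul_le_mul_left _ (Finset.mem_range.mp hi).le
    omega
  have := Finset.sum_le_sum hterm
  rw [Finset.sum_const, Finset.sum_add_distrib, ← Finset.mul_sum, Finset.sum_const,
    Finset.card_range, smul_eq_mul, smul_eq_mul] at this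
  have h4 : d * (k + 1) ≤ d * ((weightedExponents d D k).card + d * D) := by
    calc d * (k + 1) ≤ _ := this
      _ ≤ d * (weightedExponents d D k).card + d * (D * d) := by gcongr
      _ = _ := by ring
  exact Nat.le_of_mul_le_mul_left h4 hd

lemma exists_nonzero_combination [Fintype F] {p a : ℕ} [Fact p.Prime] [CharP F p]
    {ι κ : Type*} [Fintype ι] [Fintype κ] (hcard : Fintype.card κ < Fintype.card ι)
    (v : ι → κ → F) : ∃ c : ι → F, c ≠ 0 ∧ ∀ k, ∑ j, c j ^ p ^ a * v j k = 0 := by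
  classical
  obtain ⟨c, c', hne, h⟩ := Fintype.exists_ne_map_eq_of_card_lt
    (fun (c : ι → F) (k : κ) => ∑ j, c j ^ p ^ a * v j k) (by
      rw [Fintype.card_fun, Fintype.card_fun]
      exact Nat.pow_lt_pow_right Fintype.one_lt_card hcard)
  refine ⟨c - c', sub_ne_zero.mpr hne, fun k => ?_⟩
  have := congrFun h k
  simp only [Pi.sub_apply, sub_pow_char_pow, sub_mul, Finset.sum_sub_distrib]
  exact sub_eq_zero.mpr this

/-- If `#F = P ^ 2`, there is a nonzero polynomial of small weight vanishing at all points of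
`y ^ d = f x` with coordinates in `F`. -/
lemma exists_polynomial_vanishing_on_curve [Fintype F] {p e P : ℕ} [Fact p.Prime] [CharP F p]
    (hP : P = p ^ e) (hF : Fintype.card F = P ^ 2) {f : F[X]} {d g : ℕ} (hd : 0 < d)
    (hcop : d.Coprime f.natDegree) (hf : f ≠ 0) (hg : g = d * f.natDegree)
    (hlarge : g ^ 2 + 3 * g + 1 < P) :
    ∃ R : F[X][Y], (∀ x y, y ^ d = f.eval x → R.evalEval x y = 0) ∧ (∀ i, d ≤ i → R.coeff i = 0) ∧
      (∃ i, R.coeff i ≠ 0) ∧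
      ∀ i k, (R.coeff i).coeff k ≠ 0 → d * k ≤ P ^ 2 + (2 * g + 1) * P := by
  classical
  set D := f.natDegree with hD
  set l := P - 1 with hl
  set m := P + 2 * g with hm
  set I := weightedExponents d D m ×ˢ weightedExponents d D l with hI
  set K := weightedExponents d D (l * P + m) with hK
  have hlP : l * P + P = P ^ 2 := by
    obtain ⟨P', rfl⟩ : ∃ P', P = P' + 1 := ⟨P - 1, by omega⟩
    simp only [hl, Nat.add_sub_cancel]; ring
  have hcard : Fintype.card K < Fintype.card I := by
    rw [Fintype.card_coe, Fintype.card_coe, hI, Finset.card_product]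
    have h1 : K.card ≤ l * P + m + 1 := card_weightedExponents_le hcop (l * P + m)
    have h2 : P + g + 1 ≤ (weightedExponents d D m).card := by
      have := le_card_weightedExponents hd D m; omega
    have h3 : P - g ≤ (weightedExponents d D l).card := by
      have := le_card_weightedExponents hd D l; omega
    refine lt_of_lt_of_le ?_ (Nat.mul_le_mul h2 h3)
    have h4 : P ^ 2 + 2 * g + 1 < (P + g + 1) * (P - g) := by
      have hgP : g ≤ P := by nlinarith
      zify [hgP]
      have : (g : ℤ) ^ 2 + 3 * g + 1 < P := by exact_mod_cast hlarge
      nlinarith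
    omega
  obtain ⟨c, hc0, hc⟩ := exists_nonzero_combination (a := e) hcard
    (fun (j : I) (k : K) => ((reducedMonomial f d (P * j.1.2.1 + j.1.1.1)
      (P * j.1.2.2 + j.1.1.2)).coeff k.1.2).coeff k.1.1)
  rw [← hP] at hc
  set A : I → ℕ := fun j => j.1.2.1 + P * j.1.1.1 with hA
  set B : I → ℕ := fun j => j.1.2.2 + P * j.1.1.2 with hB
  have hmem : ∀ j : I, (j.1.1.2 < d ∧ d * j.1.1.1 + D * j.1.1.2 ≤ m) ∧
      (j.1.2.2 < d ∧ d * j.1.2.1 + D * j.1.2.2 ≤ l) := fun j => by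
    have := Finset.mem_product.mp j.2
    exact ⟨mem_weightedExponents.mp this.1, mem_weightedExponents.mp this.2⟩
  set G : F[X][Y] := ∑ j : I, C (C (c j ^ P)) *
    reducedMonomial f d (P * j.1.2.1 + j.1.1.1) (P * j.1.2.2 + j.1.1.2) with hG
  have hG0 : G = 0 := by
    ext i k
    simp only [hG, finsetSum_coeff, coeff_C_mul, coeff_zero]
    by_cases hk : (k, i) ∈ K
    · exact hc ⟨(k, i), hk⟩
    · refine Finset.sum_eq_zero fun j _ => ?_
      rw [mul_eq_zero]
      right
      by_contra hne
      obtain ⟨hi, hle⟩ := le_of_reducedMonomial_coeff_coeff_ne_zero hne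
      refine hk (mem_weightedExponents.mpr ⟨hi ▸ Nat.mod_lt _ hd, ?_⟩)
      have h1 := (hmem j).1.2
      have h2 := Nat.mul_le_mul_right P (hmem j).2.2
      calc d * k + D * i ≤ _ := hle
        _ = (d * j.1.2.1 + D * j.1.2.2) * P + (d * j.1.1.1 + D * j.1.1.2) := by ring
        _ ≤ _ := by gcongr
  set R : F[X][Y] := ∑ j : I, C (C (c j)) * reducedMonomial f d (A j) (B j) with hR
  have hRcoeff : ∀ i k, (R.coeff i).coeff k =
      ∑ j : I, c j * ((reducedMonomial f d (A j) (B j)).coeff i).coeff k := fun i k => by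
    simp only [hR, finsetSum_coeff, coeff_C_mul]
  refine ⟨R, fun x y hxy => ?_, fun i hi => ?_, ?_, fun i k hne => ?_⟩
  · have hGe : G.evalEval x y = 0 := by rw [hG0]; simp [evalEval]
    have hq : ∀ z : F, z ^ P ^ 2 = z := fun z => by rw [← hF]; exact FiniteField.pow_card z
    have : R.evalEval x y ^ P = G.evalEval x y := by
      simp only [hR, hG, evalEval_finsetSum, evalEval_mul, reducedMonomial_evalEval hxy]
      simp only [evalEval_CC] 
      rw [hP, sum_pow_char_pow, ← hP]
      refine Finset.sum_congr rfl fun j _ => ?_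
      simp only [hA, hB]
      calc _ = c j ^ P * ((x ^ P ^ 2) ^ j.1.1.1 * x ^ (P * j.1.2.1) *
              ((y ^ P ^ 2) ^ j.1.1.2 * y ^ (P * j.1.2.2))) := by ring
        _ = _ := by rw [hq, hq]; ring
    rw [hGe] at this
    exact pow_eq_zero_iff (by omega) |>.mp this
  · ext k
    rw [hRcoeff]
    simp only [coeff_zero]
    refine Finset.sum_eq_zero fun j _ => ?_
    rw [reducedMonomial_coeff, if_neg, coeff_zero, mul_zero]
    have := Nat.mod_lt (B j) hd
    omega
  · obtain ⟨j₀, hj₀⟩ := Function.ne_iff.mp hc0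
    obtain ⟨j, hj, hmax⟩ := Finset.exists_max_image (Finset.univ.filter fun j => c j ≠ 0)
      (fun j => d * A j + D * B j) ⟨j₀, by simpa using hj₀⟩
    refine ⟨B j % d, fun h0 => ?_⟩
    have h1 := hRcoeff (B j % d) (A j + (B j / d) * D)
    rw [h0, coeff_zero, Finset.sum_eq_single j] at h1
    · exact (mul_ne_zero (by simpa using hj) (reducedMonomial_top_coeff hf d (A j) (B j))) h1.symm
    · intro j' _ hne
      by_cases hc' : c j' = 0
      · rw [hc', zero_mul]
      rw [mul_eq_zero]
      right
      by_contra hne'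
      obtain ⟨-, hle⟩ := le_of_reducedMonomial_coeff_coeff_ne_zero hne'
      have hle2 := hmax j' (by simpa using hc')
      have hw : d * (A j + (B j / d) * D) + D * (B j % d) = d * A j + D * B j := by
        conv_rhs => rw [← Nat.div_add_mod (B j) d]
        ring
      rw [hw] at hle
      have heq : d * A j + D * B j = d * A j' + D * B j' := le_antisymm hle hle2
      have hsplit : ∀ j : I, d * A j + D * B j =
          (d * j.1.2.1 + D * j.1.2.2) + P * (d * j.1.1.1 + D * j.1.1.2) := fun j => by
        simp only [hA, hB]; ring
      rw [hsplit, hsplit] at heq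
      have hPpos : 0 < P := by omega
      have hlt : ∀ j : I, d * j.1.2.1 + D * j.1.2.2 < P := fun j => by
        have := (hmem j).2.2; omega
      have e1 : d * j.1.2.1 + D * j.1.2.2 = d * j'.1.2.1 + D * j'.1.2.2 := by
        have := congrArg (· % P) heq
        simpa [Nat.add_mul_mod_self_left, Nat.mod_eq_of_lt, hlt] using this
      have e2 : d * j.1.1.1 + D * j.1.1.2 = d * j'.1.1.1 + D * j'.1.1.2 := by
        rw [e1] at heq
        exact Nat.eq_of_mul_eq_mul_left hPpos (by omega)
      refine hne (Subtype.ext (Prod.ext ?_ ?_))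
      · exact (weight_injOn hcop (hmem j).1.1 (hmem j').1.1 e2).symm
      · exact (weight_injOn hcop (hmem j).2.1 (hmem j').2.1 e1).symm
    · intro h; exact absurd (Finset.mem_univ _) h
  · rw [hRcoeff] at hne
    obtain ⟨j, -, hj⟩ := Finset.exists_ne_zero_of_sum_ne_zero hne
    obtain ⟨-, hle⟩ := le_of_reducedMonomial_coeff_coeff_ne_zero (right_ne_zero_of_mul hj)
    have h1 := Nat.mul_le_mul_left P (hmem j).1.2
    have h2 := (hmem j).2.2
    calc d * k ≤ d * A j + D * B j := (Nat.le_add_right _ _).trans hle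
      _ = (d * j.1.2.1 + D * j.1.2.2) + P * (d * j.1.1.1 + D * j.1.1.2) := by
        simp only [hA, hB]; ring
      _ ≤ l + P * m := by gcongr
      _ ≤ P + P * m := by omega
      _ = _ := by rw [hm]; ring

/-- Bombieri's upper bound for the number of `x` above which `y ^ d = f x` has `d` points. -/
theorem card_le_of_forall_card_fiber [Fintype F] [DecidableEq F] {p e P : ℕ} [Fact p.Prime] [CharP F p]
    (hP : P = p ^ e) (hF : Fintype.card F = P ^ 2) {f : F[X]} {d g : ℕ} (hd : 0 < d)
    (hcop : d.Coprime f.natDegree) (hf : f ≠ 0) (hg : g = d * f.natDegree)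
    (hlarge : g ^ 2 + 3 * g + 1 < P) (T : Finset F)
    (hT : ∀ x ∈ T, d ≤ (Finset.univ.filter fun y => y ^ d = f.eval x).card) :
    d * T.card ≤ P ^ 2 + (2 * g + 1) * P := by
  obtain ⟨R, hvan, hdeg, ⟨i, hi⟩, hcoeff⟩ :=
    exists_polynomial_vanishing_on_curve hP hF hd hcop hf hg hlarge
  refine le_trans ?_ (hcoeff i (R.coeff i).natDegree (by simpa using hi))
  gcongr
  refine le_trans (Finset.card_le_card (t := (R.coeff i).roots.toFinset) fun x hx => ?_)
    ((Multiset.toFinset_card_le _).trans (card_roots' _))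
  rw [Multiset.mem_toFinset, mem_roots hi, IsRoot]
  set Q : F[X] := R.map (evalRingHom x) with hQ
  have hQ0 : Q = 0 := by
    refine eq_zero_of_degree_lt_of_eval_finset_eq_zero
      (Finset.univ.filter fun y => y ^ d = f.eval x) ?_ fun y hy => ?_
    · refine lt_of_lt_of_le ?_ (Nat.cast_le.mpr (hT x hx))
      rw [degree_lt_iff_coeff_zero]
      intro k hk
      rw [hQ, coeff_map, hdeg k hk, map_zero]
    · have := hvan x y (by simpa using hy)
      rw [← this, hQ, eval_map, evalEval, ← coe_evalRingHom x, ← eval₂_hom]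
      simp
  have := congrArg (fun q => q.coeff i) hQ0
  simpa [hQ] using this

end Superelliptic

/-! ### Power sums of complex numbers -/

section PowerSums

open Polynomial Filter Topology

/-- Complex numbers whose even power sums are `O(ρ ^ n)` have modulus at most `ρ`. -/
lemma norm_le_of_norm_sum_pow_le {σ : Type*} [Fintype σ] (α : σ → ℂ) {C ρ : ℝ} (hρ : 0 < ρ)
    {n₀ : ℕ} (h : ∀ n, n₀ ≤ n → ‖∑ i, α i ^ (2 * n)‖ ≤ C * ρ ^ (2 * n)) (j : σ) :
    ‖α j‖ ≤ ρ := by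
  by_contra! hj
  have hex : ∀ z : ℂ, ∃ u : Circle, z = ‖z‖ * u := fun z => by
    by_cases hz : z = 0
    · exact ⟨1, by simp [hz]⟩
    · refine ⟨⟨z / ‖z‖, ?_⟩, ?_⟩
      · have : ‖z‖ ≠ 0 := norm_ne_zero_iff.mpr hz
        simp [Submonoid.unitSphere, this]
      · have : (‖z‖ : ℂ) ≠ 0 := by exact_mod_cast norm_ne_zero_iff.mpr hz
        field_simp
  choose u hu using hex
  have hfreq : ∃ᶠ n in atTop, ∀ i, 1 / 2 ≤ (((u (α i)) ^ (2 * n) : Circle) : ℂ).re := by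
    have hcl := mapClusterPt_one_atTop_pow (fun i => u (α i) ^ 2 : σ → Circle)
    have hnhds : {w : σ → Circle | ∀ i, 1 / 2 ≤ ((w i : Circle) : ℂ).re} ∈ 𝓝 (1 : σ → Circle) := by
      rw [Set.ofPred_forall]
      refine (Filter.iInter_mem).mpr fun i => ?_
      have hc : Continuous (fun w : σ → Circle => ((w i : Circle) : ℂ).re) :=
        Complex.continuous_re.comp (continuous_subtype_val.comp (continuous_apply i))
      have h1 : (1 / 2 : ℝ) < (((1 : σ → Circle) i : Circle) : ℂ).re := by norm_num
      filter_upwards [hc.continuousAt.eventually (lt_mem_nhds h1)] with w hw using hw.le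
    have := hcl.frequently hnhds
    refine this.mono fun n hn i => ?_
    have := hn i
    simpa [pow_mul] using this
  have hgrow : Tendsto (fun n : ℕ => ((‖α j‖ / ρ) ^ 2) ^ n) atTop atTop :=
    tendsto_pow_atTop_atTop_of_one_lt (by
      have : 1 < ‖α j‖ / ρ := (one_lt_div hρ).mpr hj
      nlinarith)
  obtain ⟨n, hn, hn₀, hlt⟩ := (hfreq.and_eventually
    ((eventually_ge_atTop n₀).and (hgrow.eventually_gt_atTop (2 * C)))).exists
  have h1 := (Complex.re_le_norm _).trans (h n hn₀)
  have h2 : ‖α j‖ ^ (2 * n) / 2 ≤ (∑ i, α i ^ (2 * n)).re := by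
    have hterm : ∀ i, ‖α i‖ ^ (2 * n) / 2 ≤ (α i ^ (2 * n)).re := fun i => by
      have : α i ^ (2 * n) = ((‖α i‖ ^ (2 * n) : ℝ) : ℂ) * (u (α i) ^ (2 * n) : Circle) := by
        conv_lhs => rw [hu (α i)]
        rw [mul_pow]; push_cast; rfl
      rw [this, Complex.re_ofReal_mul]
      have h3 := hn i
      have : 0 ≤ ‖α i‖ ^ (2 * n) := by positivity
      nlinarith
    rw [Complex.re_sum]
    exact (hterm j).trans (Finset.single_le_sum (f := fun i => (α i ^ (2 * n)).re)
      (fun i _ => le_trans (by positivity) (hterm i)) (Finset.mem_univ j))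
  have h4 : ((‖α j‖ / ρ) ^ 2) ^ n ≤ 2 * C := by
    rw [← pow_mul, div_pow, div_le_iff₀ (by positivity)]
    linarith
  linarith

/-- If `L = ∑ c k T ^ k` is a polynomial of degree at most `N` with `T L' = L ∑ S k T ^ k`, then
`-S` is the sequence of power sums of `N` complex numbers. -/
lemma exists_power_sums {N : ℕ} {c S : ℕ → ℂ} (hc0 : c 0 = 1) (hcN : ∀ k, N < k → c k = 0)
    (hrec : ∀ n : ℕ, n * c n = ∑ a ∈ Finset.HasAntidiagonal.antidiagonal n with a.1 < n, c a.1 * S a.2) :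
    ∃ (σ : Type) (_ : Fintype σ) (α : σ → ℂ), Fintype.card σ = N ∧
      ∀ n, 0 < n → S n = -∑ i, α i ^ n := by
  set Q : ℂ[X] := ∑ k ∈ Finset.range (N + 1), monomial k (c (N - k)) with hQ
  have hcoeff : ∀ j, j ≤ N → Q.coeff j = c (N - j) := fun j hj => by
    rw [hQ, finsetSum_coeff, Finset.sum_eq_single j]
    · simp
    · intro b _ hb; rw [coeff_monomial, if_neg hb]
    · intro h; exact absurd (Finset.mem_range.mpr (by omega)) h
  have hdle : Q.natDegree ≤ N := natDegree_sum_le_of_forall_le _ _ fun k hk =>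
    (natDegree_monomial_le _).trans (by have := Finset.mem_range.mp hk; omega)
  have hmonic : Q.Monic := monic_of_natDegree_le_of_coeff_eq_one N hdle (by
    rw [hcoeff N le_rfl]; simpa using hc0)
  have hdeg : Q.natDegree = N := le_antisymm hdle (le_natDegree_of_ne_zero (by
    rw [hcoeff N le_rfl]; simp [hc0]))
  have hsplit : Q.Splits := IsAlgClosed.splits Q
  have hcard : Multiset.card Q.roots = N := by rw [← hdeg]; exact hsplit.natDegree_eq_card_roots.symm
  set α : Q.roots.ToType → ℂ := fun i => i.1 with hα
  have hmap : Finset.univ.val.map α = Q.roots := Multiset.map_univ_coe _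
  set e : ℕ → ℂ := fun k => MvPolynomial.aeval α (MvPolynomial.esymm Q.roots.ToType ℂ k) with he
  have hes : ∀ k, e k = Q.roots.esymm k := fun k => by
    simp only [he]
    rw [MvPolynomial.aeval_esymm_eq_multiset_esymm, hmap]
  have hce : ∀ k, c k = (-1) ^ k * e k := fun k => by
    rcases le_or_gt k N with hk | hk
    · have h1 := coeff_eq_esymm_roots_of_card (hcard.trans hdeg.symm) (k := N - k) (by omega)
      rw [hcoeff _ (Nat.sub_le _ _), hmonic.leadingCoeff, hdeg] at h1
      rw [hes, show N - (N - k) = k by omega] at *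
      simpa using h1
    · rw [hcN k hk, hes, Multiset.esymm, Multiset.powersetCard_eq_empty _ (by omega)]
      simp
  refine ⟨Q.roots.ToType, inferInstance, α, by rw [Multiset.card_coe, hcard], fun n => ?_⟩
  induction n using Nat.strong_induction_on with
  | _ n ih =>
    intro hn
    have hnewton := congrArg (MvPolynomial.aeval α)
      (MvPolynomial.mul_esymm_eq_sum Q.roots.ToType ℂ n)
    simp only [map_mul, map_natCast, map_pow, map_neg, map_one, map_sum, MvPolynomial.psum,
      MvPolynomial.aeval_X] at hnewton
    have h1 := hrec n
    have h2 : (n : ℂ) * c n = -∑ a ∈ Finset.HasAntidiagonal.antidiagonal n with a.1 < n,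
        c a.1 * ∑ i, α i ^ a.2 := by
      have hneg : (-1 : ℂ) ^ n * (-1) ^ (n + 1) = -1 := by
        rw [pow_succ, ← mul_assoc, ← mul_pow]; simp
      rw [hce n, mul_left_comm, hnewton, ← mul_assoc, hneg, neg_one_mul]
      congr 1
      exact Finset.sum_congr rfl fun a _ => by rw [hce]
    rw [h1, ← Finset.sum_neg_distrib] at h2
    have hmem : (0, n) ∈ (Finset.HasAntidiagonal.antidiagonal n).filter (fun a => a.1 < n) := by simp [hn]
    rw [← Finset.add_sum_erase _ _ hmem, ← Finset.add_sum_erase _ _ hmem] at h2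
    have h3 : ∑ a ∈ ((Finset.HasAntidiagonal.antidiagonal n).filter (fun a => a.1 < n)).erase (0, n),
        c a.1 * S a.2 = ∑ a ∈ ((Finset.HasAntidiagonal.antidiagonal n).filter (fun a => a.1 < n)).erase (0, n),
        -(c a.1 * ∑ i, α i ^ a.2) := by
      refine Finset.sum_congr rfl fun a ha => ?_
      simp only [Finset.mem_erase, Finset.mem_filter, Finset.HasAntidiagonal.mem_antidiagonal, ne_eq] at ha
      have ha2 : a.2 ≠ n := fun h => ha.1 (Prod.ext (by simp only; omega) h)
      rw [ih a.2 (by omega) (by omega), mul_neg]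
    rw [h3] at h2
    have := add_right_cancel h2
    simpa [hc0] using this

/-- A bound for the even terms of a sequence given by an `L`-polynomial of degree at most `N`
yields the bound expected from the Riemann hypothesis for its first term. -/
theorem norm_le_of_even_bound {N : ℕ} {c S : ℕ → ℂ} (hc0 : c 0 = 1) (hcN : ∀ k, N < k → c k = 0)
    (hrec : ∀ n : ℕ, n * c n = ∑ a ∈ Finset.HasAntidiagonal.antidiagonal n with a.1 < n, c a.1 * S a.2)
    {C ρ : ℝ} (hρ : 0 < ρ) {n₀ : ℕ} (h : ∀ n, n₀ ≤ n → ‖S (2 * n)‖ ≤ C * ρ ^ (2 * n)) :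
    ‖S 1‖ ≤ N * ρ := by
  obtain ⟨σ, _, α, hcard, hS⟩ := exists_power_sums hc0 hcN hrec
  have hα := norm_le_of_norm_sum_pow_le α hρ (n₀ := n₀ + 1) (C := C) fun n hn => by
    have := h n (by omega)
    rwa [hS _ (by omega), norm_neg] at this
  rw [hS 1 one_pos, norm_neg]
  calc ‖∑ i, α i ^ 1‖ ≤ ∑ i, ‖α i ^ 1‖ := norm_sum_le _ _
    _ ≤ ∑ _i : σ, ρ := Finset.sum_le_sum fun i _ => by simpa using hα i
    _ = N * ρ := by simp [hcard]

end PowerSums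

section FieldPolynomial

open Polynomial UniqueFactorizationMonoid

/-- The characteristic polynomial of an element of a field extension. -/
noncomputable def fieldPoly (K : Type*) {L : Type*} [Field K] [Field L] [Algebra K L] (x : L) :
    K[X] :=
  minpoly K x ^ (Module.finrank K L / (minpoly K x).natDegree)

variable {K L : Type*} [Field K] [Field L] [Algebra K L] [FiniteDimensional K L]

theorem fieldPoly_monic (x : L) : (fieldPoly K x).Monic :=
  (minpoly.monic (Algebra.IsIntegral.isIntegral x)).pow _

theorem natDegree_fieldPoly (x : L) : (fieldPoly K x).natDegree = Module.finrank K L := by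
  have hx : IsIntegral K x := Algebra.IsIntegral.isIntegral x
  rw [fieldPoly, (minpoly.monic hx).natDegree_pow, Nat.div_mul_cancel (minpoly.degree_dvd hx)]

open IntermediateField in
theorem eval_fieldPoly (x : L) (a : K) :
    (fieldPoly K x).eval a = Algebra.norm K (algebraMap K L a - x) := by
  have hx : IsIntegral K x := Algebra.IsIntegral.isIntegral x
  let g := AdjoinSimple.gen K x
  have hfr := Module.finrank_mul_finrank K K⟮x⟯ L
  rw [adjoin.finrank hx] at hfr
  have hdeg : Module.finrank K L / (minpoly K x).natDegree = Module.finrank K⟮x⟯ L := by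
    rw [← hfr, Nat.mul_div_cancel_left _ (minpoly.natDegree_pos hx)]
  have hmap : algebraMap K L a - x = algebraMap K⟮x⟯ L (algebraMap K K⟮x⟯ a - g) := by
    rw [map_sub, AdjoinSimple.algebraMap_gen, ← IsScalarTower.algebraMap_apply]
  rw [hmap, ← Algebra.norm_norm (R := K) (S := K⟮x⟯), Algebra.norm_algebraMap, map_pow, fieldPoly,
    hdeg, eval_pow]
  congr 1
  let pb := adjoin.powerBasis hx
  have hg : pb.gen = g := adjoin.powerBasis_gen hx
  rw [Algebra.norm_eq_matrix_det pb.basis, map_sub, ← minpoly_gen K x]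
  change eval a (minpoly K g) = (_ - Algebra.leftMulMatrix pb.basis g).det
  rw [← hg, ← charpoly_leftMulMatrix, Matrix.eval_charpoly, AlgHom.commutes, Matrix.algebraMap_eq_diagonal]
  rfl

theorem card_filter_aeval_eq_zero [Fintype K] [Fintype L] [DecidableEq L] {P : K[X]} (hP : Irreducible P)
    (hdvd : P.natDegree ∣ Module.finrank K L) :
    (Finset.univ.filter fun x : L => aeval x P = 0).card = P.natDegree := by
  classical
  have hcard : Nat.card K ^ Module.finrank K L = Fintype.card L := by
    rw [← Module.natCard_eq_pow_finrank, Nat.card_eq_fintype_card]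
  have h1 := hP.natDegree_dvd_iff_dvd_X_pow_card_pow_sub_X.1 hdvd
  rw [hcard] at h1
  have hs : ((X ^ Fintype.card L - X : K[X]).map (algebraMap K L)).Splits := by
    have := FiniteField.isSplittingField_sub L K
    exact IsSplittingField.splits L (X ^ Fintype.card L - X : K[X])
  have hne : (X ^ Fintype.card L - X : K[X]) ≠ 0 :=
    FiniteField.X_pow_card_sub_X_ne_zero K Fintype.one_lt_card
  have hPs : (P.map (algebraMap K L)).Splits :=
    hs.of_dvd (Polynomial.map_ne_zero hne) (Polynomial.map_dvd _ h1)
  rw [← card_rootSet_eq_natDegree (PerfectField.separable_of_irreducible hP) hPs,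
    ← Set.toFinset_card]
  congr 1
  ext x
  simp [mem_rootSet, hP.ne_zero]

open Classical in
theorem card_filter_fieldPoly_dvd [Fintype K] [Fintype L] {g : K[X]} (hg : g ≠ 0) :
    (Finset.univ.filter fun x : L => fieldPoly K x ∣ g).card =
      ∑ P ∈ (normalizedFactors g).toFinset,
        if P.natDegree ∣ Module.finrank K L ∧
          P ^ (Module.finrank K L / P.natDegree) ∣ g then P.natDegree else 0 := by
  have hmem : ∀ P ∈ (normalizedFactors g).toFinset, Irreducible P ∧ P.Monic := by
    intro P hP
    rw [Multiset.mem_toFinset] at hP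
    refine ⟨irreducible_of_normalized_factor P hP, ?_⟩
    rw [← normalize_normalized_factor P hP]
    exact monic_normalize (irreducible_of_normalized_factor P hP).ne_zero
  have hmap : ∀ x ∈ Finset.univ.filter fun x : L => fieldPoly K x ∣ g,
      minpoly K x ∈ (normalizedFactors g).toFinset := by
    intro x hx
    have hint : IsIntegral K x := Algebra.IsIntegral.isIntegral x
    rw [Finset.mem_filter] at hx
    rw [Multiset.mem_toFinset, mem_normalizedFactors_iff' hg]
    refine ⟨minpoly.irreducible hint, (minpoly.monic hint).normalize_eq_self, ?_⟩
    refine (dvd_pow_self _ ?_).trans hx.2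
    exact (Nat.div_pos (Nat.le_of_dvd Module.finrank_pos (minpoly.degree_dvd hint))
      (minpoly.natDegree_pos hint)).ne'
  rw [Finset.card_eq_sum_card_fiberwise hmap]
  refine Finset.sum_congr rfl fun P hP => ?_
  obtain ⟨hirr, hmon⟩ := hmem P hP
  have hiff : ∀ x : L, minpoly K x = P ↔ aeval x P = 0 := by
    intro x
    constructor
    · rintro rfl
      exact minpoly.aeval K x
    · intro h
      exact (minpoly.eq_of_irreducible_of_monic hirr h hmon).symm
  rw [Finset.filter_filter]
  split_ifs with h
  · rw [← card_filter_aeval_eq_zero (L := L) hirr h.1]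
    congr 1
    ext x
    simp only [Finset.mem_filter, Finset.mem_univ, true_and, hiff]
    constructor
    · exact fun hx => hx.2
    · intro hx
      refine ⟨?_, hx⟩
      rw [fieldPoly, (hiff x).2 hx]
      exact h.2
  · rw [Finset.card_eq_zero, Finset.filter_eq_empty_iff]
    rintro x - ⟨h1, h2⟩
    apply h
    have hint : IsIntegral K x := Algebra.IsIntegral.isIntegral x
    rw [fieldPoly, h2] at h1
    refine ⟨?_, h1⟩
    rw [← h2]
    exact minpoly.degree_dvd hint

open Classical in
theorem sum_card_filter_fieldPoly_dvd [Fintype K] {L : ℕ → Type*} [∀ k, Field (L k)]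
    [∀ k, Algebra K (L k)] [∀ k, Fintype (L k)] [∀ k, FiniteDimensional K (L k)]
    (hL : ∀ k, 1 ≤ k → Module.finrank K (L k) = k) {g : K[X]} (hg : g.Monic) :
    ∑ k ∈ Finset.Icc 1 g.natDegree,
      (Finset.univ.filter fun x : L k => fieldPoly K x ∣ g).card = g.natDegree := by
  have h0 : g ≠ 0 := hg.ne_zero
  have h1 : g.natDegree = ∑ P ∈ (normalizedFactors g).toFinset,
      (normalizedFactors g).count P • P.natDegree := by
    conv_lhs => rw [← hg.normalize_eq_self, ← prod_normalizedFactors_eq h0]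
    rw [natDegree_multiset_prod _ (zero_notMem_normalizedFactors _),
      Finset.sum_multiset_map_count]
  rw [Finset.sum_congr rfl fun k _ => card_filter_fieldPoly_dvd (L := L k) h0, Finset.sum_comm]
  conv_rhs => rw [h1]
  refine Finset.sum_congr rfl fun P hP => ?_
  rw [Multiset.mem_toFinset] at hP
  have hirr := irreducible_of_normalized_factor P hP
  have hpos : 0 < P.natDegree := hirr.natDegree_pos
  have hdvd : ∀ j, P ^ j ∣ g ↔ j ≤ (normalizedFactors g).count P := by
    intro j
    rw [pow_dvd_iff_le_emultiplicity, emultiplicity_eq_count_normalizedFactors hirr h0,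
      normalize_normalized_factor P hP]
    exact Nat.cast_le
  rw [← Finset.sum_filter, Finset.sum_const]
  congr 1
  rw [← Nat.add_sub_cancel ((normalizedFactors g).count P) 1, ← Nat.card_Icc]
  symm
  refine Finset.card_bij (fun j _ => j * P.natDegree) ?_ ?_ ?_
  · intro j hj
    rw [Finset.mem_Icc] at hj
    have hle : j * P.natDegree ≤ g.natDegree := by
      rw [← natDegree_pow]
      exact natDegree_le_of_dvd ((hdvd j).2 hj.2) h0
    have h2 : 1 ≤ j * P.natDegree := Nat.mul_pos hj.1 hpos
    rw [Finset.mem_filter, Finset.mem_Icc, hL _ h2, Nat.mul_div_cancel _ hpos]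
    exact ⟨⟨h2, hle⟩, dvd_mul_left _ _, (hdvd j).2 hj.2⟩
  · intro i _ j _ hij
    exact Nat.eq_of_mul_eq_mul_right hpos hij
  · intro k hk
    rw [Finset.mem_filter, Finset.mem_Icc] at hk
    rw [hL k hk.1.1] at hk
    refine ⟨k / P.natDegree, ?_, Nat.div_mul_cancel hk.2.1⟩
    rw [Finset.mem_Icc]
    exact ⟨Nat.div_pos (Nat.le_of_dvd hk.1.1 hk.2.1) hpos, (hdvd _).1 hk.2.2⟩

end FieldPolynomial

section MonicSums

open Polynomial

theorem finite_monic_natDegree_eq (K : Type*) [Field K] [Finite K] (n : ℕ) :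
    {g : K[X] | g.Monic ∧ g.natDegree = n}.Finite := by
  have : Finite (degreeLT K (n + 1)) := Finite.of_equiv _ (degreeLTEquiv K (n + 1)).toEquiv.symm
  refine (Set.toFinite (degreeLT K (n + 1) : Set K[X])).subset ?_
  rintro g ⟨-, hg⟩
  rw [SetLike.mem_coe, mem_degreeLT]
  refine lt_of_le_of_lt degree_le_natDegree ?_
  rw [hg]
  exact_mod_cast Nat.lt_succ_self n

/-- The finite set of monic polynomials of degree `n` over a finite field. -/
noncomputable def monicsOfDegree (K : Type*) [Field K] [Finite K] (n : ℕ) : Finset K[X] :=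
  (finite_monic_natDegree_eq K n).toFinset

variable {K : Type*} [Field K] [Fintype K]

theorem mem_monicsOfDegree {n : ℕ} {g : K[X]} :
    g ∈ monicsOfDegree K n ↔ g.Monic ∧ g.natDegree = n := by
  rw [monicsOfDegree, Set.Finite.mem_toFinset]
  rfl

theorem sum_monicsOfDegree_zero (w : K[X] →* ℂ) : ∑ g ∈ monicsOfDegree K 0, w g = 1 := by
  have : monicsOfDegree K 0 = {1} := by
    ext g
    rw [mem_monicsOfDegree, Finset.mem_singleton]
    constructor
    · rintro ⟨h1, h2⟩
      exact h1.natDegree_eq_zero.1 h2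
    · rintro rfl
      exact ⟨monic_one, natDegree_one⟩
  rw [this, Finset.sum_singleton, map_one]

open Classical in
theorem sum_monicsOfDegree_dvd (w : K[X] →* ℂ) {D : K[X]} (hD : D.Monic) {n : ℕ}
    (hn : D.natDegree ≤ n) :
    ∑ g ∈ monicsOfDegree K n with D ∣ g, w g =
      w D * ∑ g ∈ monicsOfDegree K (n - D.natDegree), w g := by
  rw [Finset.mul_sum]
  symm
  refine Finset.sum_bij (fun h _ => D * h) ?_ ?_ ?_ ?_
  · intro h hh
    rw [mem_monicsOfDegree] at hh
    rw [Finset.mem_filter, mem_monicsOfDegree, hD.natDegree_mul hh.1, hh.2]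
    exact ⟨⟨hD.mul hh.1, by omega⟩, dvd_mul_right _ _⟩
  · intro a _ b _ hab
    exact mul_left_cancel₀ hD.ne_zero hab
  · intro g hg
    rw [Finset.mem_filter, mem_monicsOfDegree] at hg
    obtain ⟨⟨h1, h2⟩, h, rfl⟩ := hg
    have hm : h.Monic := hD.of_mul_monic_left h1
    refine ⟨h, ?_, rfl⟩
    rw [mem_monicsOfDegree]
    rw [hD.natDegree_mul hm] at h2
    exact ⟨hm, by omega⟩
  · intro h _
    rw [map_mul]

theorem natCast_mul_sum_monicsOfDegree {L : ℕ → Type*} [∀ k, Field (L k)]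
    [∀ k, Algebra K (L k)] [∀ k, Fintype (L k)] [∀ k, FiniteDimensional K (L k)]
    (hL : ∀ k, 1 ≤ k → Module.finrank K (L k) = k) (w : K[X] →* ℂ) (n : ℕ) :
    (n : ℂ) * ∑ g ∈ monicsOfDegree K n, w g =
      ∑ k ∈ Finset.Icc 1 n, (∑ g ∈ monicsOfDegree K (n - k), w g) *
        ∑ x : L k, w (fieldPoly K x) := by
  classical
  have h1 : ∀ k ∈ Finset.Icc 1 n, (∑ g ∈ monicsOfDegree K (n - k), w g) *
        ∑ x : L k, w (fieldPoly K x) =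
      ∑ g ∈ monicsOfDegree K n, ((Finset.univ.filter fun x : L k => fieldPoly K x ∣ g).card : ℂ)
        * w g := by
    intro k hk
    rw [Finset.mem_Icc] at hk
    rw [Finset.mul_sum]
    have h2 : ∀ x : L k, (∑ g ∈ monicsOfDegree K (n - k), w g) * w (fieldPoly K x) =
        ∑ g ∈ monicsOfDegree K n, if fieldPoly K x ∣ g then w g else 0 := by
      intro x
      have hd : (fieldPoly K x).natDegree = k := by rw [natDegree_fieldPoly, hL k hk.1]
      rw [← Finset.sum_filter, sum_monicsOfDegree_dvd w (fieldPoly_monic x) (by omega), hd,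
        mul_comm]
    rw [Finset.sum_congr rfl fun x _ => h2 x, Finset.sum_comm]
    refine Finset.sum_congr rfl fun g _ => ?_
    rw [← Finset.sum_filter, Finset.sum_const, nsmul_eq_mul]
  rw [Finset.sum_congr rfl h1, Finset.sum_comm, Finset.mul_sum]
  refine Finset.sum_congr rfl fun g hg => ?_
  rw [mem_monicsOfDegree] at hg
  rw [← Finset.sum_mul]
  congr 1
  have := sum_card_filter_fieldPoly_dvd (L := L) hL hg.1
  rw [hg.2] at this
  exact_mod_cast this.symm

variable {ι : Type*} [Fintype ι]

/-- The completely multiplicative function `g ↦ ∏ χ(g(aᵢ))^eᵢ` on polynomials. -/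
noncomputable def polyChar (χ : MulChar K ℂ) (a : ι → K) (e : ι → ℕ) : K[X] →* ℂ where
  toFun g := ∏ i, χ (g.eval (a i)) ^ e i
  map_one' := by simp
  map_mul' f g := by simp [mul_pow, Finset.prod_mul_distrib]

theorem polyChar_apply (χ : MulChar K ℂ) (a : ι → K) (e : ι → ℕ) (g : K[X]) :
    polyChar χ a e g = ∏ i, χ (g.eval (a i)) ^ e i := rfl

theorem sum_monicsOfDegree_polyChar_eq_zero {χ : MulChar K ℂ} (hχ : χ ≠ 1) (a : ι → K)
    {e : ι → ℕ} (he : (∑ i, e i).Coprime (Fintype.card K - 1)) {n : ℕ} (hn : Fintype.card ι ≤ n) :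
    ∑ g ∈ monicsOfDegree K n, polyChar χ a e g = 0 := by
  classical
  obtain ⟨i₀, u, hu⟩ : ∃ (i₀ : ι) (u : Kˣ), χ u ^ (∑ i with a i = a i₀, e i) ≠ 1 := by
    by_contra! hcon
    apply hχ
    rw [MulChar.eq_one_iff]
    intro u
    have h1 : χ u ^ (∑ i, e i) = 1 := by
      rw [← Finset.sum_fiberwise_of_maps_to (t := Finset.univ.image a) (g := a)
        (fun i _ => Finset.mem_image_of_mem _ (Finset.mem_univ i)), ← Finset.prod_pow_eq_pow_sum]
      refine Finset.prod_eq_one fun v hv => ?_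
      obtain ⟨i, -, rfl⟩ := Finset.mem_image.1 hv
      exact hcon i u
    have h2 : χ u ^ (Fintype.card K - 1) = 1 := by
      rw [← map_pow, ← Units.val_pow_eq_pow_val, ← Fintype.card_units, pow_card_eq_one,
        Units.val_one, map_one]
    have h3 := Nat.dvd_gcd (orderOf_dvd_of_pow_eq_one h1) (orderOf_dvd_of_pow_eq_one h2)
    rw [he, Nat.dvd_one, orderOf_eq_one_iff] at h3
    exact h3
  set v := a i₀
  set T := (Finset.univ.image a).erase v
  set Q : K[X] := ∏ t ∈ T, (X - C t)
  have hQv : Q.eval v ≠ 0 := by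
    rw [eval_prod, Finset.prod_ne_zero_iff]
    intro t ht
    rw [eval_sub, eval_X, eval_C, sub_ne_zero]
    exact (Finset.ne_of_mem_erase ht).symm
  set ℓ : K[X] := C (Q.eval v)⁻¹ * Q
  have hℓv : ℓ.eval v = 1 := by rw [eval_mul, eval_C, inv_mul_cancel₀ hQv]
  have hℓ0 : ∀ i, a i ≠ v → ℓ.eval (a i) = 0 := by
    intro i hi
    have hQ : Q.eval (a i) = 0 := by
      rw [eval_prod]
      refine Finset.prod_eq_zero (i := a i) ?_ (by simp)
      exact Finset.mem_erase.2 ⟨hi, Finset.mem_image_of_mem _ (Finset.mem_univ i)⟩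
    rw [eval_mul, hQ, mul_zero]
  have hdeg : ∀ c : K, (C c * ℓ).degree < (n : ℕ) := by
    intro c
    refine lt_of_le_of_lt degree_le_natDegree ?_
    rw [Nat.cast_lt]
    have h1 : Q.natDegree = T.card := natDegree_finsetProd_X_sub_C_eq_card _ _
    have h2 : T.card + 1 = (Finset.univ.image a).card :=
      Finset.card_erase_add_one (Finset.mem_image_of_mem _ (Finset.mem_univ i₀))
    have h3 : (Finset.univ.image a).card ≤ Fintype.card ι := Finset.card_image_le
    have h4 : (C c * ℓ).natDegree ≤ Q.natDegree :=
      (natDegree_C_mul_le _ _).trans (natDegree_C_mul_le _ _)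
    omega
  set φ : K → K[X] → K[X] := fun c g => g + C ((c - 1) * g.eval v) * ℓ
  have hmem : ∀ c, ∀ g ∈ monicsOfDegree K n, φ c g ∈ monicsOfDegree K n := by
    intro c g hg
    rw [mem_monicsOfDegree] at hg ⊢
    have hd : (C ((c - 1) * g.eval v) * ℓ).degree < g.degree := by
      rw [degree_eq_natDegree hg.1.ne_zero, hg.2]
      exact hdeg _
    exact ⟨hg.1.add_of_left hd, by rw [natDegree_add_eq_left_of_degree_lt hd, hg.2]⟩
  have hφv : ∀ c g, (φ c g).eval v = c * g.eval v := by
    intro c g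
    simp only [φ, eval_add, eval_mul, eval_C, hℓv]
    ring
  have hinv : ∀ c d g, c * d = 1 → φ c (φ d g) = g := by
    intro c d g hcd
    change φ d g + C ((c - 1) * (φ d g).eval v) * ℓ = g
    rw [hφv]
    simp only [φ]
    rw [add_assoc, ← add_mul, ← C_add]
    have : (d - 1) * eval v g + (c - 1) * (d * eval v g) = 0 := by
      linear_combination hcd * eval v g
    rw [this]
    simp
  have hw : ∀ g, polyChar χ a e (φ u g) = χ u ^ (∑ i with a i = v, e i) * polyChar χ a e g := by
    intro g
    rw [polyChar_apply, polyChar_apply, ← Finset.prod_pow_eq_pow_sum, Finset.prod_filter,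
      ← Finset.prod_mul_distrib]
    refine Finset.prod_congr rfl fun i _ => ?_
    split_ifs with h
    · rw [h, hφv, map_mul, mul_pow]
    · simp [φ, hℓ0 i h]
  have hsum : ∑ g ∈ monicsOfDegree K n, polyChar χ a e g =
      ∑ g ∈ monicsOfDegree K n, polyChar χ a e (φ u g) := by
    symm
    refine Finset.sum_nbij' (φ u) (φ (↑u⁻¹ : K)) (hmem _) (hmem _) ?_ ?_ fun _ _ => rfl
    · intro g _
      exact hinv _ _ g (by simp)
    · intro g _
      exact hinv _ _ g (by simp)
  rw [Finset.sum_congr rfl fun g _ => hw g, ← Finset.mul_sum] at hsum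
  by_contra hne
  exact hu (mul_right_cancel₀ hne (by rw [one_mul]; exact hsum.symm))

end MonicSums

section Weil

open Polynomial

theorem card_filter_pow_eq_of_norm_eq_one {K E : Type*} [Field K] [Field E] [Fintype K] [Fintype E]
    [DecidableEq E] [Algebra K E] {z : E} (hz : Algebra.norm K z = 1) :
    Fintype.card K - 1 ≤ (Finset.univ.filter fun y : E => y ^ (Fintype.card K - 1) = z).card := by
  classical
  set d := Fintype.card K - 1 with hd
  have hd0 : 0 < d := Nat.sub_pos_of_lt Fintype.one_lt_card
  have hz0 : z ≠ 0 := by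
    rintro rfl
    simp [Algebra.norm_zero] at hz
  obtain ⟨y, hy⟩ : ∃ y : Eˣ, (y : E) ^ d = z := by
    obtain ⟨g, hg⟩ := IsCyclic.exists_generator (α := Eˣ)
    obtain ⟨j, hj⟩ := (mem_powers_iff_mem_zpowers.2 (hg (Units.mk0 z hz0)))
    change g ^ j = Units.mk0 z hz0 at hj
    have hnorm := FiniteField.algebraMap_norm_eq_pow (K := K) (K' := E) (x := z)
    rw [hz, map_one, Nat.card_eq_fintype_card, Nat.card_eq_fintype_card, ← hd] at hnorm
    have hord : orderOf g = Fintype.card E - 1 := by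
      rw [orderOf_eq_card_of_forall_mem_zpowers hg, Nat.card_eq_fintype_card, Fintype.card_units]
    have hdvd : d ∣ Fintype.card E - 1 := by
      rw [Module.card_eq_pow_finrank (K := K) (V := E), hd]
      simpa using Nat.sub_dvd_pow_sub_pow (Fintype.card K) 1 (Module.finrank K E)
    obtain ⟨M, hM⟩ := hdvd
    rw [hM, Nat.mul_div_cancel_left _ hd0] at hnorm
    have h1 : g ^ (j * M) = 1 := by
      ext
      rw [pow_mul, hj, Units.val_pow_eq_pow_val, Units.val_mk0, ← hnorm, Units.val_one]
    have h2 := orderOf_dvd_of_pow_eq_one h1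
    have hM0 : 0 < M := by
      have : 0 < Fintype.card E - 1 := Nat.sub_pos_of_lt Fintype.one_lt_card
      rw [hM] at this
      exact Nat.pos_of_mul_pos_left this
    rw [hord, hM] at h2
    obtain ⟨i, rfl⟩ := Nat.dvd_of_mul_dvd_mul_right hM0 h2
    refine ⟨g ^ i, ?_⟩
    rw [← Units.val_pow_eq_pow_val, ← pow_mul, mul_comm, hj, Units.val_mk0]
  have hcard : (Finset.univ : Finset Kˣ).card = d := by rw [Finset.card_univ, Fintype.card_units]
  refine hcard.symm.le.trans ?_
  refine Finset.card_le_card_of_injOn (fun u : Kˣ => algebraMap K E u * y) ?_ ?_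
  · intro u _
    rw [Finset.mem_coe, Finset.mem_filter]
    refine ⟨Finset.mem_univ _, ?_⟩
    rw [mul_pow, hy, ← map_pow, hd,
      FiniteField.pow_card_sub_one_eq_one _ u.ne_zero, map_one, one_mul]
  · intro u _ v _ huv
    exact Units.ext ((algebraMap K E).injective (mul_right_cancel₀ y.ne_zero huv))

theorem norm_sum_mulChar_norm_le {p : ℕ} [Fact p.Prime] {E : Type*} [Field E] [Fintype E]
    [DecidableEq E] [Algebra (ZMod p) E] {m : ℕ} (hE : Fintype.card E = (p ^ m) ^ 2)
    {χ : MulChar (ZMod p) ℂ} (hχ : χ ≠ 1) {ι : Type*} [Fintype ι] (a : ι → ZMod p) {e : ι → ℕ}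
    (he : (∑ i, e i).Coprime (p - 1)) {g : ℕ} (hg : g = (p - 1) * ∑ i, e i)
    (hlarge : g ^ 2 + 3 * g + 1 < p ^ m) :
    ‖∑ x : E, χ (Algebra.norm (ZMod p) (∏ i, (algebraMap (ZMod p) E (a i) - x) ^ e i))‖ ≤
      (2 * g + 1 + Fintype.card ι) * (p : ℝ) ^ m := by
  classical
  have hp : p.Prime := Fact.out
  have hd : 0 < p - 1 := Nat.sub_pos_of_lt hp.one_lt
  have : CharP E p := charP_of_injective_algebraMap (algebraMap (ZMod p) E).injective p
  set F : E → E := fun x => ∏ i, (algebraMap (ZMod p) E (a i) - x) ^ e i with hF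
  set T : ZMod p → Finset E := fun ζ => Finset.univ.filter fun x => Algebra.norm (ZMod p) (F x) = ζ
    with hT
  have hub : ∀ ζ : ZMod p, ζ ≠ 0 → (p - 1) * (T ζ).card ≤ (p ^ m) ^ 2 + (2 * g + 1) * p ^ m := by
    intro ζ hζ
    obtain ⟨c, hc⟩ := FiniteField.norm_surjective (K := ZMod p) (K' := E) ζ⁻¹
    have hc0 : c ≠ 0 := by
      rintro rfl
      rw [Algebra.norm_zero] at hc
      exact inv_ne_zero hζ hc.symm
    set f : E[X] := C c * ∏ i, (C (algebraMap (ZMod p) E (a i)) - X) ^ e i with hf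
    have hne : ∀ i, (C (algebraMap (ZMod p) E (a i)) - X : E[X]) ≠ 0 := by
      intro i h
      have := congrArg (fun q : E[X] => q.coeff 1) h
      simp at this
    have hnd : ∀ i, (C (algebraMap (ZMod p) E (a i)) - X : E[X]).natDegree = 1 := by
      intro i
      rw [← neg_sub, natDegree_neg, natDegree_X_sub_C]
    have hfd : f.natDegree = ∑ i, e i := by
      rw [hf, natDegree_C_mul hc0, natDegree_prod _ _ fun i _ => pow_ne_zero _ (hne i)]
      refine Finset.sum_congr rfl fun i _ => ?_
      rw [natDegree_pow, hnd, mul_one]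
    have hf0 : f ≠ 0 := mul_ne_zero (C_ne_zero.2 hc0)
      (Finset.prod_ne_zero_iff.2 fun i _ => pow_ne_zero _ (hne i))
    have hfe : ∀ x, f.eval x = c * F x := by
      intro x
      simp [hf, hF, eval_prod]
    refine card_le_of_forall_card_fiber (p := p) (e := m) rfl hE hd (f := f) ?_ hf0 ?_ hlarge (T ζ)
      ?_
    · rw [hfd]
      exact he.symm
    · rw [hfd, hg]
    · intro x hx
      rw [hT, Finset.mem_filter] at hx
      have := card_filter_pow_eq_of_norm_eq_one (K := ZMod p) (E := E) (z := f.eval x)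
        (by rw [hfe, map_mul, hc, hx.2, inv_mul_cancel₀ hζ])
      rwa [ZMod.card] at this
  have hzero : (T 0).card ≤ Fintype.card ι := by
    rw [← Finset.card_univ]
    refine (Finset.card_le_card (t := Finset.univ.image fun i => algebraMap (ZMod p) E (a i))
      ?_).trans Finset.card_image_le
    intro x hx
    rw [hT, Finset.mem_filter, Algebra.norm_eq_zero_iff, hF, Finset.prod_eq_zero_iff] at hx
    obtain ⟨-, i, -, hi⟩ := hx
    exact Finset.mem_image.2 ⟨i, Finset.mem_univ i, sub_eq_zero.1 (eq_zero_of_pow_eq_zero hi)⟩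
  have hsum : ∑ ζ : ZMod p, (T ζ).card = (p ^ m) ^ 2 := by
    rw [← hE, ← Finset.card_univ]
    exact (Finset.card_eq_sum_card_fiberwise fun x _ => Finset.mem_univ _).symm
  set t : ℝ := (((p : ℝ) ^ m) ^ 2 + (2 * g + 1) * (p : ℝ) ^ m) / ((p - 1 : ℕ) : ℝ) with ht
  have hd' : (0 : ℝ) < ((p - 1 : ℕ) : ℝ) := by exact_mod_cast hd
  have hub' : ∀ ζ : ZMod p, ζ ≠ 0 → ((T ζ).card : ℝ) ≤ t := by
    intro ζ hζ
    rw [ht, le_div_iff₀ hd', mul_comm]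
    exact_mod_cast hub ζ hζ
  have hS : ∑ x : E, χ (Algebra.norm (ZMod p) (F x)) =
      ∑ ζ : ZMod p, χ ζ * (((T ζ).card : ℝ) - t : ℝ) := by
    have h1 : ∑ x : E, χ (Algebra.norm (ZMod p) (F x)) = ∑ ζ : ZMod p, χ ζ * (T ζ).card := by
      rw [← Finset.sum_fiberwise (s := Finset.univ) (g := fun x => Algebra.norm (ZMod p) (F x))]
      refine Finset.sum_congr rfl fun ζ _ => ?_
      rw [Finset.sum_congr rfl fun x hx => by rw [(Finset.mem_filter.1 hx).2], Finset.sum_const,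
        nsmul_eq_mul, mul_comm]
    have h2 : ∑ ζ : ZMod p, χ ζ * (t : ℂ) = 0 := by
      rw [← Finset.sum_mul, MulChar.sum_eq_zero_of_ne_one hχ, zero_mul]
    rw [h1, ← sub_zero (∑ ζ : ZMod p, χ ζ * ((T ζ).card : ℂ)), ← h2, ← Finset.sum_sub_distrib]
    refine Finset.sum_congr rfl fun ζ _ => ?_
    push_cast
    ring
  rw [hS]
  calc ‖∑ ζ : ZMod p, χ ζ * (((T ζ).card : ℝ) - t : ℝ)‖
      ≤ ∑ ζ : ZMod p, ‖χ ζ * (((T ζ).card : ℝ) - t : ℝ)‖ := norm_sum_le _ _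
    _ ≤ ∑ ζ : ZMod p, (if ζ = 0 then 0 else t - (T ζ).card) := by
        refine Finset.sum_le_sum fun ζ _ => ?_
        split_ifs with h
        · rw [h, MulChar.map_zero, zero_mul, norm_zero]
        · rw [norm_mul, Complex.norm_real, Real.norm_eq_abs, abs_sub_comm,
            abs_of_nonneg (sub_nonneg.2 (hub' ζ h))]
          refine (mul_le_mul_of_nonneg_right (DirichletCharacter.norm_le_one χ ζ)
            (sub_nonneg.2 (hub' ζ h))).trans (le_of_eq (one_mul _))
    _ = ((p - 1 : ℕ) : ℝ) * t - (((p : ℝ) ^ m) ^ 2 - (T 0).card) := by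
        rw [Finset.sum_ite, Finset.sum_const_zero, zero_add, Finset.sum_sub_distrib,
          Finset.sum_const, nsmul_eq_mul]
        have h1 : (Finset.univ.filter fun ζ : ZMod p => ¬ζ = 0) = Finset.univ.erase 0 := by
          ext; simp
        rw [h1, Finset.card_erase_of_mem (Finset.mem_univ _), Finset.card_univ, ZMod.card]
        have h2 := Finset.add_sum_erase Finset.univ (fun ζ => (T ζ).card) (Finset.mem_univ 0)
        rw [hsum] at h2
        have h3 : ((T 0).card : ℝ) + ∑ ζ ∈ Finset.univ.erase 0, ((T ζ).card : ℝ) =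
          ((p : ℝ) ^ m) ^ 2 := by exact_mod_cast h2
        linarith
    _ ≤ (2 * g + 1 + Fintype.card ι) * (p : ℝ) ^ m := by
        rw [ht, mul_div_cancel₀ _ hd'.ne']
        have h1 : ((T 0).card : ℝ) ≤ Fintype.card ι := by exact_mod_cast hzero
        have h2 : (1 : ℝ) ≤ (p : ℝ) ^ m := one_le_pow₀ (by exact_mod_cast hp.one_lt.le)
        nlinarith

/-- The Weil bound for multiplicative character sums. -/
theorem norm_sum_prod_mulChar_le {p : ℕ} [Fact p.Prime] {χ : MulChar (ZMod p) ℂ} (hχ : χ ≠ 1)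
    {ι : Type*} [Fintype ι] [Nonempty ι] (a : ι → ZMod p) {e : ι → ℕ}
    (he : (∑ i, e i).Coprime (p - 1)) :
    ‖∑ x : ZMod p, ∏ i, χ (a i - x) ^ e i‖ ≤ ((Fintype.card ι - 1 : ℕ) : ℝ) * √p := by
  classical
  have hp : p.Prime := Fact.out
  let fint : ∀ k, Fintype (GaloisField p k) := fun k => Fintype.ofFinite _
  have hL : ∀ k, 1 ≤ k → Module.finrank (ZMod p) (GaloisField p k) = k := fun k hk =>
    GaloisField.finrank p (by omega)
  set w := polyChar χ a e
  set S : ℕ → ℂ := fun k => ∑ x : GaloisField p k, w (fieldPoly (ZMod p) x) with hS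
  set g := (p - 1) * ∑ i, e i with hg
  have hw : ∀ k, S k = ∑ x : GaloisField p k, χ (Algebra.norm (ZMod p)
      (∏ i, (algebraMap (ZMod p) (GaloisField p k) (a i) - x) ^ e i)) := by
    intro k
    refine Finset.sum_congr rfl fun x _ => ?_
    rw [map_prod, map_prod, polyChar_apply]
    refine Finset.prod_congr rfl fun i _ => ?_
    rw [map_pow, map_pow, eval_fieldPoly]
  have hp0 : (0 : ℝ) < √p := Real.sqrt_pos.2 (by exact_mod_cast hp.pos)
  have hmain := norm_le_of_even_bound (N := Fintype.card ι - 1)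
    (c := fun n => ∑ g ∈ monicsOfDegree (ZMod p) n, w g) (S := S)
    (sum_monicsOfDegree_zero w) ?_ ?_ hp0 (C := 2 * g + 1 + Fintype.card ι)
    (n₀ := g ^ 2 + 3 * g + 1 + 1) ?_
  · refine le_trans (le_of_eq ?_) hmain
    rw [hw]
    congr 1
    have hfr := hL 1 le_rfl
    have hbij : Function.Bijective (algebraMap (ZMod p) (GaloisField p 1)) := by
      rw [Fintype.bijective_iff_injective_and_card]
      refine ⟨(algebraMap (ZMod p) (GaloisField p 1)).injective, ?_⟩
      rw [Module.card_eq_pow_finrank (K := ZMod p) (V := GaloisField p 1), hfr, pow_one]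
    refine Fintype.sum_bijective _ hbij _ _ fun x => ?_
    rw [map_prod, map_prod]
    refine Finset.prod_congr rfl fun i _ => ?_
    rw [map_pow, map_pow, ← map_sub, Algebra.norm_algebraMap, hfr, pow_one]
  · intro k hk
    exact sum_monicsOfDegree_polyChar_eq_zero hχ a (by rwa [ZMod.card]) (by omega)
  · intro n
    rw [natCast_mul_sum_monicsOfDegree hL w n, Finset.sum_filter]
    rw [Finset.Nat.sum_antidiagonal_eq_sum_range_succ_mk, Finset.sum_range_succ, if_neg (by simp),
      add_zero]
    refine Finset.sum_nbij' (fun k => n - k) (fun k => n - k) ?_ ?_ ?_ ?_ ?_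
    · intro k hk
      rw [Finset.mem_Icc] at hk
      rw [Finset.mem_range]
      omega
    · intro k hk
      rw [Finset.mem_range] at hk
      rw [Finset.mem_Icc]
      omega
    · intro k hk
      rw [Finset.mem_Icc] at hk
      omega
    · intro k hk
      rw [Finset.mem_range] at hk
      omega
    · intro k hk
      rw [Finset.mem_Icc] at hk
      have h1 : n - (n - k) = k := by omega
      rw [if_pos (by simp only; omega)]
      simp only [h1, hS]
  · intro n hn
    rw [hw]
    have h1 : Fintype.card (GaloisField p (2 * n)) = (p ^ n) ^ 2 := by
      rw [← Nat.card_eq_fintype_card, GaloisField.card p _ (by omega)]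
      ring
    refine (norm_sum_mulChar_norm_le h1 hχ a he hg ?_).trans (le_of_eq ?_)
    · exact lt_of_lt_of_le (by omega) (Nat.lt_pow_self hp.one_lt).le
    · rw [pow_mul, Real.sq_sqrt (Nat.cast_nonneg p)]

end Weil

section LocalSums

open Polynomial

/-- A Dirichlet character mod `q` that is nontrivial on units congruent to `1` modulo any proper
divisor of `q`; this is an elementary form of primitivity. -/
def NoProperPeriod {q : ℕ} (χ : DirichletCharacter ℂ q) : Prop :=
  ∀ d : ℕ, d ∣ q → d ≠ q → ∃ n : ℤ, IsCoprime n (q : ℤ) ∧ (d : ℤ) ∣ n - 1 ∧ χ (n : ZMod q) ≠ 1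

theorem norm_prod_pow_le_one {q : ℕ} [NeZero q] (χ : DirichletCharacter ℂ q) {ι : Type*} (s : Finset ι)
    (f : ι → ZMod q) (e : ι → ℕ) : ‖∏ i ∈ s, χ (f i) ^ e i‖ ≤ 1 := by
  rw [norm_prod]
  refine Finset.prod_le_one (fun _ _ => norm_nonneg _) fun i _ => ?_
  rw [norm_pow]
  exact pow_le_one₀ (norm_nonneg _) (χ.norm_le_one _)

theorem norm_sum_le_of_fiber {q : ℕ} [NeZero q] (χ : DirichletCharacter ℂ q) {ι : Type*} (s : Finset ι)
    (f : ZMod q → ι → ZMod q) (e : ι → ℕ) : ‖∑ x, ∏ i ∈ s, χ (f x i) ^ e i‖ ≤ q := by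
  refine (norm_sum_le _ _).trans ?_
  refine (Finset.sum_le_sum fun x _ => norm_prod_pow_le_one χ s (f x) e).trans ?_
  simp

/-- Complete sums to prime moduli. -/
theorem norm_sum_prod_prime_le {p : ℕ} [Fact p.Prime] {χ : DirichletCharacter ℂ p} (hχ : χ ≠ 1)
    {ι : Type*} [Fintype ι] [DecidableEq ι] (b : ι → ZMod p) {e : ι → ℕ} (he : ∀ i, e i ≠ 0)
    (hsum : p - 1 ∣ ∑ i, e i) {i₀ : ι} (hi₀ : (e i₀).Coprime (p - 1))
    (hb : ∀ i, i ≠ i₀ → b i ≠ b i₀) :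
    ‖∑ x, ∏ i, χ (x + b i) ^ e i‖ ≤ Fintype.card ι * √p := by
  have hp : p.Prime := Fact.out
  have hp1 : 1 ≤ √(p : ℝ) := by
    rw [Real.one_le_sqrt]
    exact_mod_cast hp.one_lt.le
  have hpos : 0 < p - 1 := Nat.sub_pos_of_lt hp.one_lt
  set c : ι → ZMod p := fun i => b i - b i₀ with hc
  have hc0 : ∀ i, i ≠ i₀ → c i ≠ 0 := fun i hi => sub_ne_zero.2 (hb i hi)
  have hsplit : ∑ i : {i // i ≠ i₀}, e i + e i₀ = ∑ i, e i := by
    rw [← Finset.sum_erase_add Finset.univ e (Finset.mem_univ i₀)]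
    congr 1
    exact (Finset.sum_subtype (Finset.univ.erase i₀) (by simp) e).symm
  have hcardsub : Fintype.card {i // i ≠ i₀} = Fintype.card ι - 1 := by
    rw [Fintype.card_subtype_compl, Fintype.card_subtype_eq]
  have hpc : ∀ t : ZMod p, t ≠ 0 → χ t ^ (p - 1) = 1 := by
    intro t ht
    rw [← map_pow, ZMod.pow_card_sub_one_eq_one ht, map_one]
  rcases isEmpty_or_nonempty {i // i ≠ i₀} with hemp | hne
  · have h1 : e i₀ = ∑ i, e i := by
      rw [← hsplit, Finset.univ_eq_empty, Finset.sum_empty, zero_add]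
    rw [← h1] at hsum
    have h2 : p - 1 = 1 := Nat.dvd_one.1 ((Nat.dvd_gcd hsum dvd_rfl).trans hi₀.dvd)
    exfalso
    apply hχ
    rw [MulChar.eq_one_iff]
    intro u
    have := hpc u u.ne_zero
    rwa [h2, pow_one] at this
  have hcop : (∑ i : {i // i ≠ i₀}, e i).Coprime (p - 1) := by
    have h1 : (p - 1).gcd (∑ i : {i // i ≠ i₀}, e i) ∣ e i₀ := by
      rw [← Nat.dvd_add_right (Nat.gcd_dvd_right (p - 1) _), hsplit]
      exact (Nat.gcd_dvd_left _ _).trans hsum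
    rw [Nat.coprime_comm]
    have h2 := Nat.dvd_gcd h1 (Nat.gcd_dvd_left (p - 1) (∑ i : {i // i ≠ i₀}, e i))
    rw [hi₀] at h2
    exact Nat.dvd_one.1 h2
  have hW := norm_sum_prod_mulChar_le hχ (fun i : {i // i ≠ i₀} => (c i)⁻¹) hcop
  have h1 : ∑ x, ∏ i, χ (x + b i) ^ e i = ∑ x, ∏ i, χ (x + c i) ^ e i := by
    refine (Fintype.sum_equiv (Equiv.subRight (b i₀)) _ _ fun x => ?_).symm
    refine Finset.prod_congr rfl fun i _ => ?_
    simp only [hc, Equiv.subRight_apply]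
    congr 2
    ring
  set G : ZMod p → ℂ := fun t => ∏ i : {i // i ≠ i₀}, χ (1 + t * c i) ^ e i with hG
  have hinv : ∀ x : ZMod p, x ≠ 0 → ∏ i, χ (x + c i) ^ e i = G x⁻¹ := by
    intro x hx
    have h2 : ∀ i, χ (x + c i) ^ e i = χ x ^ e i * χ (1 + x⁻¹ * c i) ^ e i := by
      intro i
      rw [← mul_pow, ← map_mul, mul_add, mul_one, mul_inv_cancel_left₀ hx]
    rw [Finset.prod_congr rfl fun i _ => h2 i, Finset.prod_mul_distrib, Finset.prod_pow_eq_pow_sum]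
    obtain ⟨k, hk⟩ := hsum
    rw [hk, pow_mul, hpc x hx, one_pow, one_mul, ← Finset.mul_prod_erase _ _ (Finset.mem_univ i₀)]
    have h3 : c i₀ = 0 := sub_self _
    rw [h3, mul_zero, add_zero, map_one, one_pow, one_mul]
    exact Finset.prod_subtype (Finset.univ.erase i₀) (by simp) fun i => χ (1 + x⁻¹ * c i) ^ e i
  have h2 : ∑ x, ∏ i, χ (x + c i) ^ e i = (∑ t, G t) - G 0 := by
    rw [← Finset.sum_erase_add _ _ (Finset.mem_univ (0 : ZMod p)),
      ← Finset.sum_erase_add _ G (Finset.mem_univ (0 : ZMod p)), add_sub_cancel_right]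
    have h3 : ∏ i, χ (0 + c i) ^ e i = 0 := by
      refine Finset.prod_eq_zero (Finset.mem_univ i₀) ?_
      have h4 : (0 : ZMod p) + c i₀ = 0 := by simp [hc]
      rw [h4, MulChar.map_zero, zero_pow (he i₀)]
    rw [h3, add_zero]
    refine Finset.sum_nbij' (fun x => x⁻¹) (fun x => x⁻¹) ?_ ?_ ?_ ?_ ?_
    · intro x hx
      simpa using hx
    · intro x hx
      simpa using hx
    · intro x _
      exact inv_inv x
    · intro x _
      exact inv_inv x
    · intro x hx
      exact hinv x (Finset.ne_of_mem_erase hx)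
  have h3 : ∑ t, G t = (∏ i : {i // i ≠ i₀}, χ (c i) ^ e i) *
      ∑ x : ZMod p, ∏ i : {i // i ≠ i₀}, χ ((c i)⁻¹ - x) ^ e i := by
    rw [Finset.mul_sum]
    refine Fintype.sum_equiv (Equiv.neg _) _ _ fun x => ?_
    rw [← Finset.prod_mul_distrib]
    refine Finset.prod_congr rfl fun i _ => ?_
    rw [← mul_pow, ← map_mul, Equiv.neg_apply, sub_neg_eq_add, mul_add,
      mul_inv_cancel₀ (hc0 i i.2), mul_comm (c i)]
  rw [h1, h2, h3]
  have h4 : ‖G 0‖ ≤ 1 := norm_prod_pow_le_one χ _ _ _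
  have hk : 1 ≤ Fintype.card ι := Fintype.card_pos_iff.2 ⟨i₀⟩
  have h5 : ((Fintype.card {i // i ≠ i₀} - 1 : ℕ) : ℝ) + 1 ≤ Fintype.card ι := by
    rw [hcardsub]
    exact_mod_cast (by omega)
  calc _ ≤ ‖(∏ i : {i // i ≠ i₀}, χ (c i) ^ e i) *
      ∑ x : ZMod p, ∏ i : {i // i ≠ i₀}, χ ((c i)⁻¹ - x) ^ e i‖ + ‖G 0‖ := norm_sub_le _ _
    _ ≤ 1 * (((Fintype.card {i // i ≠ i₀} - 1 : ℕ) : ℝ) * √p) + 1 := by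
        rw [norm_mul]
        gcongr
        exact norm_prod_pow_le_one χ _ _ _
    _ ≤ (((Fintype.card {i // i ≠ i₀} - 1 : ℕ) : ℝ) + 1) * √p := by nlinarith
    _ ≤ Fintype.card ι * √p := by gcongr

end LocalSums

section LocalSums

open Polynomial

theorem isUnit_of_castHom_ne_zero {p : ℕ} [Fact p.Prime] {x : ZMod (p ^ 2)}
    (hx : ZMod.castHom (dvd_pow_self p two_ne_zero) (ZMod p) x ≠ 0) : IsUnit x := by
  have hp : p.Prime := Fact.out
  have : NeZero (p ^ 2) := ⟨pow_ne_zero 2 hp.ne_zero⟩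
  rw [← ZMod.natCast_zmod_val x] at hx ⊢
  rw [map_natCast, Ne, ZMod.natCast_eq_zero_iff] at hx
  rw [ZMod.isUnit_iff_coprime]
  exact ((Nat.Prime.coprime_iff_not_dvd hp).2 hx).symm.pow_right 2

/-- The additive character `t ↦ χ(1 + pt)` attached to a Dirichlet character mod `p ^ 2`. -/
noncomputable def addCharOfSq {p : ℕ} (χ : DirichletCharacter ℂ (p ^ 2)) :
    AddChar (ZMod (p ^ 2)) ℂ where
  toFun t := χ (1 + p * t)
  map_zero_eq_one' := by simp
  map_add_eq_mul' s t := by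
    have h : ((p : ZMod (p ^ 2))) * p = 0 := by
      rw [← pow_two]
      exact_mod_cast ZMod.natCast_self (p ^ 2)
    rw [← map_mul]
    congr 1
    linear_combination -(s * t) * h

theorem addCharOfSq_apply {p : ℕ} (χ : DirichletCharacter ℂ (p ^ 2)) (t : ZMod (p ^ 2)) :
    addCharOfSq χ t = χ (1 + p * t) := rfl

theorem AddChar.apply_sum_eq_prod {A M ι : Type*} [AddCommMonoid A] [CommMonoid M] (ψ : AddChar A M)
    (s : Finset ι) (f : ι → A) : ψ (∑ i ∈ s, f i) = ∏ i ∈ s, ψ (f i) := by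
  classical
  induction s using Finset.induction_on with
  | empty => simp
  | insert i s hi ih => rw [Finset.sum_insert hi, Finset.prod_insert hi, map_add_eq_mul, ih]

theorem card_filter_eval_castHom_eq_zero {p : ℕ} [Fact p.Prime] [NeZero (p ^ 2)] {H : (ZMod p)[X]}
    (hH : H ≠ 0) {k : ℕ} (hk : H.natDegree ≤ k) :
    (Finset.univ.filter fun x : ZMod (p ^ 2) =>
      H.eval (ZMod.castHom (dvd_pow_self p two_ne_zero) (ZMod p) x) = 0).card ≤ k * p := by
  have hp : p.Prime := Fact.out
  calc _ ≤ ((H.roots.toFinset ×ˢ Finset.range p).image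
      fun a : ZMod p × ℕ => ((a.1.val + p * a.2 : ℕ) : ZMod (p ^ 2))).card := by
        refine Finset.card_le_card fun x hx => ?_
        rw [Finset.mem_filter] at hx
        rw [Finset.mem_image]
        refine ⟨(ZMod.castHom (dvd_pow_self p two_ne_zero) (ZMod p) x, x.val / p), ?_, ?_⟩
        · rw [Finset.mem_product, Multiset.mem_toFinset, mem_roots hH, Finset.mem_range]
          refine ⟨hx.2, Nat.div_lt_of_lt_mul ?_⟩
          rw [← pow_two]
          exact x.val_lt
        · have h1 : (ZMod.castHom (dvd_pow_self p two_ne_zero) (ZMod p) x).val = x.val % p := by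
            conv_lhs => rw [← ZMod.natCast_zmod_val x]
            rw [map_natCast, ZMod.val_natCast]
          simp only [h1, Nat.mod_add_div, ZMod.natCast_zmod_val]
    _ ≤ (H.roots.toFinset ×ˢ Finset.range p).card := Finset.card_image_le
    _ ≤ k * p := by
        rw [Finset.card_product, Finset.card_range]
        exact Nat.mul_le_mul_right _
          ((Multiset.toFinset_card_le _).trans ((card_roots' H).trans hk))

/-- Complete sums to moduli that are squares of primes. -/
theorem norm_sum_prod_prime_sq_le {p : ℕ} [Fact p.Prime] [NeZero (p ^ 2)]
    {χ : DirichletCharacter ℂ (p ^ 2)}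
    {t₀ : ZMod (p ^ 2)} (hχ : χ (1 + (p : ZMod (p ^ 2)) * t₀) ≠ 1)
    {ι : Type*} [Fintype ι] [DecidableEq ι] (b : ι → ZMod (p ^ 2)) {e : ι → ℕ} (he : ∀ i, e i ≠ 0)
    {i₀ : ι} (hi₀ : ¬ p ∣ e i₀)
    (hb : ∀ i, i ≠ i₀ → ZMod.castHom (dvd_pow_self p two_ne_zero) (ZMod p) (b i) ≠
      ZMod.castHom (dvd_pow_self p two_ne_zero) (ZMod p) (b i₀)) :
    ‖∑ x, ∏ i, χ (x + b i) ^ e i‖ ≤ Fintype.card ι * p := by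
  have hp : p.Prime := Fact.out
  set π := ZMod.castHom (dvd_pow_self p two_ne_zero) (ZMod p) with hπ
  set ψ := addCharOfSq χ with hψ
  set F : ZMod (p ^ 2) → ℂ := fun x => ∏ i, χ (x + b i) ^ e i with hF
  set L : ZMod (p ^ 2) → ZMod (p ^ 2) := fun x => ∑ i, e i • (x + b i)⁻¹ with hL
  have hunit : ∀ x, IsUnit x ↔ π x ≠ 0 := fun x =>
    ⟨fun h => (h.map π).ne_zero, isUnit_of_castHom_ne_zero⟩
  have hπp : π p = 0 := by simp
  have hshift : ∀ x t, (∀ i, IsUnit (x + b i)) → F (x + p * t) = F x * ψ (L x * t) := by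
    intro x t hx
    have h1 : ψ (L x * t) = ∏ i, χ (1 + p * (t * (x + b i)⁻¹)) ^ e i := by
      rw [hL, Finset.sum_mul, AddChar.apply_sum_eq_prod]
      refine Finset.prod_congr rfl fun i _ => ?_
      rw [smul_mul_assoc, AddChar.map_nsmul_eq_pow, hψ, addCharOfSq_apply, mul_comm t]
    rw [h1, hF, ← Finset.prod_mul_distrib]
    refine Finset.prod_congr rfl fun i _ => ?_
    rw [← mul_pow, ← map_mul]
    congr 2
    have h2 := ZMod.mul_inv_of_unit _ (hx i)
    linear_combination -(p * t) * h2
  have hzero : ∀ x, (∃ i, ¬ IsUnit (x + b i)) → ∀ t, F (x + p * t) = 0 := by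
    rintro x ⟨i, hi⟩ t
    refine Finset.prod_eq_zero (Finset.mem_univ i) ?_
    rw [MulChar.map_nonunit χ, zero_pow (he i)]
    rw [hunit, not_not] at hi ⊢
    rw [add_right_comm, map_add, hi, map_mul, hπp, zero_mul, zero_add]
  set H : (ZMod p)[X] := ∑ i, C (e i : ZMod p) * ∏ l ∈ Finset.univ.erase i, (X + C (π (b l)))
    with hH
  have hHL : ∀ x, (∀ i, IsUnit (x + b i)) → π (L x) = 0 → H.eval (π x) = 0 := by
    intro x hx hLx
    have h1 : H.eval (π x) = (∏ l, (π x + π (b l))) * π (L x) := by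
      rw [hH, eval_finsetSum, hL, map_sum, Finset.mul_sum]
      refine Finset.sum_congr rfl fun i _ => ?_
      have h2 : (π x + π (b i)) * π (x + b i)⁻¹ = 1 := by
        rw [← map_add, ← map_mul, ZMod.mul_inv_of_unit _ (hx i), map_one]
      rw [eval_mul, eval_C, eval_prod, ← Finset.mul_prod_erase _ _ (Finset.mem_univ i), map_nsmul,
        nsmul_eq_mul]
      simp only [eval_add, eval_X, eval_C]
      linear_combination -(e i : ZMod p) * (∏ l ∈ Finset.univ.erase i, (π x + π (b l))) * h2
    rw [h1, hLx, mul_zero]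
  have hH0 : H ≠ 0 := by
    intro h0
    have h1 : H.eval (-π (b i₀)) = e i₀ * ∏ l ∈ Finset.univ.erase i₀, (π (b l) - π (b i₀)) := by
      rw [hH, eval_finsetSum, Finset.sum_eq_single i₀]
      · rw [eval_mul, eval_C, eval_prod]
        congr 1
        refine Finset.prod_congr rfl fun l _ => ?_
        simp only [eval_add, eval_X, eval_C]
        ring
      · intro i _ hi
        rw [eval_mul, eval_prod, Finset.prod_eq_zero (Finset.mem_erase.2 ⟨hi.symm, Finset.mem_univ _⟩),
          mul_zero]
        simp
      · simp
    rw [h0, eval_zero] at h1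
    refine mul_ne_zero ?_ ?_ h1.symm
    · rwa [Ne, ZMod.natCast_eq_zero_iff]
    · rw [Finset.prod_ne_zero_iff]
      intro l hl
      exact sub_ne_zero.2 (hb l (Finset.ne_of_mem_erase hl))
  have hHd : H.natDegree ≤ Fintype.card ι := by
    refine natDegree_sum_le_of_forall_le _ _ fun i _ => ?_
    refine (natDegree_C_mul_le _ _).trans ((natDegree_prod_le _ _).trans ?_)
    refine (Finset.sum_le_card_nsmul _ _ 1 fun l _ => ?_).trans ?_
    · exact (natDegree_X_add_C _).le
    · rw [smul_eq_mul, mul_one]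
      exact Finset.card_le_univ _
  have hsum : ∀ x, ‖∑ t, F (x + p * t)‖ ≤ if H.eval (π x) = 0 then ((p ^ 2 : ℕ) : ℝ) else 0 := by
    intro x
    by_cases hx : ∀ i, IsUnit (x + b i)
    · split_ifs with h
      · refine (norm_sum_le _ _).trans ?_
        refine (Finset.sum_le_sum fun t _ => norm_prod_pow_le_one χ _ _ e).trans ?_
        simp
      · have hLu : IsUnit (L x) := (hunit _).2 fun h0 => h (hHL x hx h0)
        rw [Finset.sum_congr rfl fun t _ => hshift x t hx, ← Finset.mul_sum]
        have h1 : ψ ≠ 1 := by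
          intro h1
          apply hχ
          rw [← addCharOfSq_apply, ← hψ, h1, AddChar.one_apply]
        have h2 : ∑ t, ψ (L x * t) = ∑ t, ψ t := by
          obtain ⟨u, hu⟩ := hLu
          rw [← hu]
          exact Fintype.sum_equiv u.mulLeft _ _ fun t => rfl
        rw [h2, AddChar.sum_eq_zero_of_ne_one h1, mul_zero, norm_zero]
    · rw [not_forall] at hx
      rw [Finset.sum_eq_zero fun t _ => hzero x hx t, norm_zero]
      split_ifs <;> positivity
  have htot : ((p ^ 2 : ℕ) : ℂ) * ∑ x, F x = ∑ x, ∑ t, F (x + p * t) := by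
    rw [Finset.sum_comm]
    have h1 : ∀ t, ∑ x, F (x + p * t) = ∑ x, F x := fun t =>
      Fintype.sum_equiv (Equiv.addRight (p * t)) _ _ fun x => rfl
    rw [Finset.sum_congr rfl fun t _ => h1 t, Finset.sum_const, Finset.card_univ, ZMod.card,
      nsmul_eq_mul]
  have hq : (0 : ℝ) < ((p ^ 2 : ℕ) : ℝ) := by exact_mod_cast Nat.pos_of_ne_zero (NeZero.ne _)
  have hfin : ((p ^ 2 : ℕ) : ℝ) * ‖∑ x, F x‖ ≤ ((p ^ 2 : ℕ) : ℝ) * (Fintype.card ι * p) := by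
    rw [← Complex.norm_natCast, ← norm_mul, htot]
    refine (norm_sum_le _ _).trans ((Finset.sum_le_sum fun x _ => hsum x).trans ?_)
    rw [← Finset.sum_filter, Finset.sum_const, nsmul_eq_mul, mul_comm, Complex.norm_natCast]
    gcongr
    exact_mod_cast card_filter_eval_castHom_eq_zero hH0 hHd
  exact le_of_mul_le_mul_left hfin hq

end LocalSums

section LocalSums

theorem NoProperPeriod.exists_mul {m n : ℕ} [NeZero m] [NeZero n] (h : m.Coprime n)
    {χ : DirichletCharacter ℂ (m * n)} (hχ : NoProperPeriod χ) :
    ∃ (χ₁ : DirichletCharacter ℂ m) (χ₂ : DirichletCharacter ℂ n), NoProperPeriod χ₁ ∧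
      NoProperPeriod χ₂ ∧ ∀ x, χ x = χ₁ (ZMod.chineseRemainder h x).1 *
        χ₂ (ZMod.chineseRemainder h x).2 := by
  set c := ZMod.chineseRemainder h with hc
  let χ₁ : DirichletCharacter ℂ m :=
    { toFun := fun a => χ (c.symm (a, 1))
      map_one' := by
        rw [← Prod.one_eq_mk, map_one, map_one]
      map_mul' := fun a b => by rw [← map_mul, ← map_mul, Prod.mk_mul_mk, one_mul]
      map_nonunit' := fun a ha => by
        apply χ.map_nonunit
        intro hu
        have := hu.map c
        rw [RingEquiv.apply_symm_apply, Prod.isUnit_iff] at this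
        exact ha this.1 }
  let χ₂ : DirichletCharacter ℂ n :=
    { toFun := fun a => χ (c.symm (1, a))
      map_one' := by
        rw [← Prod.one_eq_mk, map_one, map_one]
      map_mul' := fun a b => by rw [← map_mul, ← map_mul, Prod.mk_mul_mk, one_mul]
      map_nonunit' := fun a ha => by
        apply χ.map_nonunit
        intro hu
        have := hu.map c
        rw [RingEquiv.apply_symm_apply, Prod.isUnit_iff] at this
        exact ha this.2 }
  have h₁ : ∀ a, χ₁ a = χ (c.symm (a, 1)) := fun _ => rfl
  have h₂ : ∀ a, χ₂ a = χ (c.symm (1, a)) := fun _ => rfl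
  have hone : ∀ (k d : ℕ) (u : ℤ), (k : ℤ) ∣ u - 1 → k = d → (u : ZMod d) = 1 := by
    rintro k d u hu rfl
    rw [← sub_eq_zero, ← Int.cast_one, ← Int.cast_sub, ZMod.intCast_zmod_eq_zero_iff_dvd]
    exact hu
  refine ⟨χ₁, χ₂, ?_, ?_, ?_⟩
  · intro d hd hdm
    obtain ⟨u, hu1, hu2, hu3⟩ := hχ (d * n) (Nat.mul_dvd_mul_right hd n)
      fun hh => hdm (Nat.eq_of_mul_eq_mul_right (NeZero.pos n) hh)
    push_cast at hu1 hu2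
    refine ⟨u, hu1.of_mul_right_left, (dvd_mul_right _ _).trans hu2, ?_⟩
    rw [h₁]
    convert hu3
    rw [RingEquiv.symm_apply_eq, map_intCast]
    refine Prod.ext ?_ ?_
    · simp
    · simpa using (hone n n u ((dvd_mul_left _ _).trans hu2) rfl).symm
  · intro d hd hdm
    obtain ⟨u, hu1, hu2, hu3⟩ := hχ (m * d) (Nat.mul_dvd_mul_left m hd)
      fun hh => hdm (Nat.eq_of_mul_eq_mul_left (NeZero.pos m) hh)
    push_cast at hu1 hu2
    refine ⟨u, hu1.of_mul_right_right, (dvd_mul_left _ _).trans hu2, ?_⟩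
    rw [h₂]
    convert hu3
    rw [RingEquiv.symm_apply_eq, map_intCast]
    refine Prod.ext ?_ ?_
    · simpa using (hone m m u ((dvd_mul_right _ _).trans hu2) rfl).symm
    · simp
  · intro x
    rw [h₁, h₂, ← map_mul, ← map_mul, Prod.mk_mul_mk, one_mul, mul_one]
    congr 1
    exact (c.symm_apply_apply x).symm

/-- Complete sums of products of shifted characters to a cubefree modulus. -/
theorem norm_sum_prod_shift_le {ι : Type*} [Fintype ι] [DecidableEq ι] (b : ι → ℤ) {e : ι → ℕ}
    (he : ∀ i, e i ≠ 0) (i₀ : ι) (q : ℕ) :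
    ∀ [NeZero q], (∀ p : ℕ, p.Prime → ¬ p ^ 3 ∣ q) →
    ∀ χ : DirichletCharacter ℂ q, NoProperPeriod χ → q.totient ∣ ∑ i, e i →
    (e i₀).Coprime q.totient →
    ‖∑ x : ZMod q, ∏ i, χ (x + b i) ^ e i‖ ≤ (Fintype.card ι : ℝ) ^ q.primeFactors.card * √q *
      (q.gcd (∏ i ∈ Finset.univ.erase i₀, (b i - b i₀)).natAbs : ℕ) := by
  set Δ := (∏ i ∈ Finset.univ.erase i₀, (b i - b i₀)).natAbs with hΔ
  have hk : (1 : ℝ) ≤ Fintype.card ι := by exact_mod_cast Fintype.card_pos_iff.2 ⟨i₀⟩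
  induction q using Nat.recOnPosPrimePosCoprime with
  | zero => exact fun {h0} => absurd rfl h0.ne
  | one =>
    intro _ _ χ _ _ _
    refine (norm_sum_le_of_fiber χ _ (fun x i => x + b i) e).trans ?_
    simp
  | prime_pow p n hp hn =>
    intro _ hcube χ hχ hsum hcop
    have : Fact p.Prime := ⟨hp⟩
    rw [Nat.primeFactors_prime_pow hn.ne' hp, Finset.card_singleton, pow_one]
    have hn2 : n = 1 ∨ n = 2 := by
      by_contra hcon
      exact hcube p hp (pow_dvd_pow p (by omega))
    have hg1 : 1 ≤ (p ^ n).gcd Δ := Nat.gcd_pos_of_pos_left _ (pow_pos hp.pos n)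
    have hsq : √((p ^ n : ℕ) : ℝ) * √((p ^ n : ℕ) : ℝ) = (p ^ n : ℕ) :=
      Real.mul_self_sqrt (Nat.cast_nonneg _)
    by_cases hpΔ : p ∣ Δ
    · refine (norm_sum_le_of_fiber χ _ (fun x i => x + b i) e).trans ?_
      have h1 : p ≤ (p ^ n).gcd Δ :=
        Nat.le_of_dvd hg1 (Nat.dvd_gcd (dvd_pow_self p hn.ne') hpΔ)
      have h2 : √((p ^ n : ℕ) : ℝ) ≤ p := by
        rw [Real.sqrt_le_left (Nat.cast_nonneg _)]
        have : p ^ n ≤ p ^ 2 := Nat.pow_le_pow_right hp.pos (by omega)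
        exact_mod_cast this
      calc ((p ^ n : ℕ) : ℝ) = 1 * √((p ^ n : ℕ) : ℝ) * √((p ^ n : ℕ) : ℝ) := by
            rw [one_mul, hsq]
        _ ≤ Fintype.card ι * √((p ^ n : ℕ) : ℝ) * ((p ^ n).gcd Δ : ℕ) := by
            gcongr
            exact h2.trans (by exact_mod_cast h1)
    · have hbne : ∀ i, i ≠ i₀ → ((b i : ZMod p)) ≠ b i₀ := by
        intro i hi hbi
        apply hpΔ
        rw [hΔ, ← Int.natCast_dvd]
        refine dvd_trans ?_ (Finset.dvd_prod_of_mem _ (Finset.mem_erase.2 ⟨hi, Finset.mem_univ i⟩))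
        rw [← ZMod.intCast_zmod_eq_zero_iff_dvd, Int.cast_sub, hbi, sub_self]
      have hfin : ‖∑ x : ZMod (p ^ n), ∏ i, χ (x + b i) ^ e i‖ ≤
          Fintype.card ι * √((p ^ n : ℕ) : ℝ) := by
        rcases hn2 with rfl | rfl
        · have key : ∀ (q : ℕ) (hq : q = p) (χ : DirichletCharacter ℂ q) [NeZero q],
              NoProperPeriod χ → q.totient ∣ ∑ i, e i → (e i₀).Coprime q.totient →
              ‖∑ x : ZMod q, ∏ i, χ (x + b i) ^ e i‖ ≤ Fintype.card ι * √(q : ℝ) := by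
            rintro q rfl χ _ hχ hsum hcop
            rw [Nat.totient_prime hp] at hsum hcop
            refine norm_sum_prod_prime_le ?_ (fun i => (b i : ZMod q)) he hsum hcop hbne
            rintro rfl
            obtain ⟨u, hu1, -, hu3⟩ := hχ 1 (one_dvd _) hp.one_lt.ne
            apply hu3
            have hu : IsUnit (u : ZMod q) := by
              obtain ⟨x, y, hxy⟩ := hu1
              refine IsUnit.of_mul_eq_one (x : ZMod q) ?_
              have := congrArg (Int.cast : ℤ → ZMod q) hxy
              push_cast at this
              rw [ZMod.natCast_self, mul_zero, add_zero] at this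
              rwa [mul_comm]
            obtain ⟨w, hw⟩ := hu
            rw [← hw, MulChar.one_apply_coe]
          exact key (p ^ 1) (pow_one p) χ hχ hsum hcop
        · obtain ⟨u, -, ⟨t, ht⟩, hu3⟩ := hχ p (dvd_pow_self p two_ne_zero)
            (by nlinarith [hp.one_lt])
          have hu : u = 1 + p * t := by linarith
          rw [hu] at hu3
          push_cast at hu3
          have h1 : √((p ^ 2 : ℕ) : ℝ) = p := by
            push_cast
            exact Real.sqrt_sq (Nat.cast_nonneg p)
          rw [h1]
          refine norm_sum_prod_prime_sq_le hu3 (fun i => (b i : ZMod (p ^ 2))) he (i₀ := i₀) ?_ ?_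
          · intro hdvd
            have h2 : p ∣ (p ^ 2).totient := by
              rw [Nat.totient_prime_pow hp two_pos]
              exact (dvd_pow_self p one_ne_zero).mul_right _
            have := Nat.dvd_gcd hdvd h2
            rw [hcop] at this
            exact hp.one_lt.ne' (Nat.dvd_one.1 this)
          · intro i hi
            rw [map_intCast, map_intCast]
            exact hbne i hi
      refine hfin.trans ?_
      refine le_mul_of_one_le_right (by positivity) ?_
      exact_mod_cast hg1
  | coprime m n hm hn hmn ihm ihn =>
    intro _ hcube χ hχ hsum hcop
    have : NeZero m := ⟨by omega⟩
    have : NeZero n := ⟨by omega⟩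
    obtain ⟨χ₁, χ₂, h₁, h₂, hmul⟩ := hχ.exists_mul hmn
    rw [Nat.totient_mul hmn] at hsum hcop
    have e₁ := ihm (fun p hp hd => hcube p hp (hd.mul_right n)) χ₁ h₁
      ((dvd_mul_right _ _).trans hsum) hcop.coprime_mul_right_right
    have e₂ := ihn (fun p hp hd => hcube p hp (hd.mul_left m)) χ₂ h₂
      ((dvd_mul_left _ _).trans hsum) hcop.coprime_mul_left_right
    have hprod : ∑ x : ZMod (m * n), ∏ i, χ (x + b i) ^ e i =
        (∑ x : ZMod m, ∏ i, χ₁ (x + b i) ^ e i) * ∑ x : ZMod n, ∏ i, χ₂ (x + b i) ^ e i := by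
      rw [Finset.sum_mul_sum, ← Fintype.sum_prod_type']
      refine Fintype.sum_equiv (ZMod.chineseRemainder hmn).toEquiv _ _ fun x => ?_
      rw [← Finset.prod_mul_distrib]
      refine Finset.prod_congr rfl fun i _ => ?_
      rw [hmul, mul_pow, map_add, map_intCast]
      rfl
    rw [hprod, norm_mul, hmn.primeFactors_mul, Finset.card_union_of_disjoint hmn.disjoint_primeFactors,
      pow_add, Nat.cast_mul, Real.sqrt_mul (Nat.cast_nonneg m), Nat.gcd_comm (m * n),
      hmn.gcd_mul, Nat.gcd_comm Δ, Nat.gcd_comm Δ, Nat.cast_mul]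
    refine (mul_le_mul e₁ e₂ (norm_nonneg _) (by positivity)).trans (le_of_eq ?_)
    ring

end LocalSums

section DivisorBounds

open Finset

theorem Nat.card_divisors_le_mul_rpow {κ : ℝ} (hκ : 0 < κ) :
    ∃ C : ℝ, 1 ≤ C ∧ ∀ n : ℕ, n ≠ 0 → (n.divisors.card : ℝ) ≤ C * (n : ℝ) ^ κ := by
  obtain ⟨P, hP⟩ : ∃ P : ℕ, (2 : ℝ) ^ (1 / κ) ≤ P := exists_nat_ge _
  have hl : 0 < κ * Real.log 2 := mul_pos hκ (Real.log_pos one_lt_two)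
  set K : ℝ := 1 + 1 / (κ * Real.log 2) with hK
  have hK1 : 1 ≤ K := by
    have : 0 < 1 / (κ * Real.log 2) := by positivity
    linarith
  refine ⟨K ^ P, one_le_pow₀ hK1, fun n hn => ?_⟩
  have key : ∀ p ∈ n.primeFactors, ((n.factorization p + 1 : ℕ) : ℝ) ≤
      (if p < P then K else 1) * ((p : ℝ) ^ n.factorization p) ^ κ := by
    intro p hp
    set a := n.factorization p
    have hp2 : (2 : ℝ) ≤ p := by exact_mod_cast (Nat.prime_of_mem_primeFactors hp).two_le
    have e1 : ((p : ℝ) ^ a) ^ κ = ((p : ℝ) ^ κ) ^ a := by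
      rw [← Real.rpow_natCast, ← Real.rpow_natCast, ← Real.rpow_mul (by positivity),
        ← Real.rpow_mul (by positivity), mul_comm]
    rw [e1]
    split_ifs with h
    · have e2 : 1 + κ * Real.log 2 * a ≤ ((p : ℝ) ^ κ) ^ a := by
        calc 1 + κ * Real.log 2 * a ≤ Real.exp (κ * Real.log 2 * a) := by
              linarith [Real.add_one_le_exp (κ * Real.log 2 * a)]
          _ = ((2 : ℝ) ^ κ) ^ a := by
              rw [Real.rpow_def_of_pos two_pos, ← Real.exp_nat_mul]; ring_nf
          _ ≤ _ := by gcongr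
      calc ((a + 1 : ℕ) : ℝ) ≤ K * (1 + κ * Real.log 2 * a) := by
            have : K * (1 + κ * Real.log 2 * a) = 1 + a + (1 / (κ * Real.log 2)
              + κ * Real.log 2 * a) := by
              rw [hK]; field_simp; ring
            rw [this]; push_cast
            have : 0 ≤ 1 / (κ * Real.log 2) + κ * Real.log 2 * a := by positivity
            linarith
        _ ≤ _ := by gcongr
    · rw [one_mul]
      have h2 : (2 : ℝ) ≤ (p : ℝ) ^ κ := by
        have : (2 : ℝ) ^ (1 / κ) ≤ p := hP.trans (by exact_mod_cast not_lt.1 h)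
        calc (2 : ℝ) = ((2 : ℝ) ^ (1 / κ)) ^ κ := by
              rw [← Real.rpow_mul (by norm_num)]; field_simp; simp
          _ ≤ _ := by gcongr
      calc ((a + 1 : ℕ) : ℝ) ≤ (2 : ℝ) ^ a := by exact_mod_cast Nat.lt_two_pow_self
        _ ≤ _ := by gcongr
  rw [Nat.card_divisors hn]
  push_cast at key ⊢
  refine (prod_le_prod (fun _ _ => by positivity) key).trans ?_
  rw [prod_mul_distrib]
  have e3 : ∏ p ∈ n.primeFactors, ((p : ℝ) ^ n.factorization p) ^ κ = (n : ℝ) ^ κ := by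
    rw [Real.finsetProd_rpow _ _ (fun _ _ => by positivity)]
    congr 1
    conv_rhs => rw [← Nat.prod_factorization_pow_eq_self hn]
    rw [Finsupp.prod, Nat.support_factorization]; push_cast; rfl
  rw [e3]
  gcongr
  rw [prod_ite, prod_const, prod_const_one, mul_one]
  apply pow_le_pow_right₀ hK1
  calc _ ≤ (range P).card := card_le_card (fun p hp => by simpa using (mem_filter.1 hp).2)
    _ = P := card_range P

theorem Nat.two_pow_card_primeFactors_le (n : ℕ) (hn : n ≠ 0) :
    2 ^ n.primeFactors.card ≤ n.divisors.card := by
  rw [Nat.card_divisors hn, ← prod_const]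
  refine prod_le_prod' fun p hp => ?_
  have := (Nat.prime_of_mem_primeFactors hp).factorization_pos_of_dvd hn
    (Nat.dvd_of_mem_primeFactors hp)
  omega

theorem Nat.pow_card_primeFactors_le (k n : ℕ) (hn : n ≠ 0) :
    k ^ n.primeFactors.card ≤ n.divisors.card ^ k := by
  calc k ^ n.primeFactors.card ≤ (2 ^ k) ^ n.primeFactors.card :=
        Nat.pow_le_pow_left Nat.lt_two_pow_self.le _
    _ = (2 ^ n.primeFactors.card) ^ k := by rw [← pow_mul, ← pow_mul, mul_comm]
    _ ≤ _ := Nat.pow_le_pow_left (Nat.two_pow_card_primeFactors_le n hn) _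

/-- Möbius inversion for sums over integers coprime to `m`. -/
theorem Finset.sum_filter_coprime_eq_sum_divisors {R : Type*} [CommRing R] {m : ℕ} (hm : m ≠ 0)
    (N : ℕ) (F : ℕ → R) :
    ∑ n ∈ Icc 1 N with n.Coprime m, F n =
      ∑ d ∈ m.divisors, (ArithmeticFunction.moebius d : R) * ∑ k ∈ Icc 1 (N / d), F (d * k) := by
  have h1 : ∀ n ∈ Icc 1 N, (if n.Coprime m then F n else 0) =
      ∑ d ∈ m.divisors, if d ∣ n then (ArithmeticFunction.moebius d : R) * F n else 0 := by
    intro n hn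
    have hn0 : n ≠ 0 := by have := mem_Icc.1 hn; omega
    have e1 : (m.divisors.filter (· ∣ n)) = (n.gcd m).divisors := by
      ext d; simp [Nat.dvd_gcd_iff, hm, hn0, Nat.gcd_eq_zero_iff]; tauto
    rw [← sum_filter, e1, ← sum_mul]
    have e2 := congrArg (fun f => f (n.gcd m)) ArithmeticFunction.moebius_mul_coe_zeta
    simp only [ArithmeticFunction.coe_mul_zeta_apply,
      ArithmeticFunction.one_apply] at e2
    have e3 := congrArg (Int.cast : ℤ → R) e2
    push_cast at e3
    rw [e3]
    simp [Nat.Coprime]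
  rw [sum_filter, sum_congr rfl h1, sum_comm]
  refine sum_congr rfl fun d hd => ?_
  have hd0 : 0 < d := Nat.pos_of_mem_divisors hd
  rw [← sum_filter, ← mul_sum]
  congr 1
  symm
  refine sum_bij (fun k _ => d * k) ?_ ?_ ?_ ?_
  · intro k hk
    have := mem_Icc.1 hk
    simp only [mem_filter, mem_Icc, dvd_mul_right, and_true]
    exact ⟨Nat.mul_pos hd0 this.1, by
      rw [mul_comm]; exact (Nat.le_div_iff_mul_le hd0).1 this.2⟩
  · intro a _ b _ h
    exact Nat.eq_of_mul_eq_mul_left hd0 h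
  · intro n hn
    obtain ⟨hn1, k, rfl⟩ := mem_filter.1 hn
    refine ⟨k, ?_, rfl⟩
    have := mem_Icc.1 hn1
    refine mem_Icc.2 ⟨Nat.pos_of_ne_zero ?_, (Nat.le_div_iff_mul_le hd0).2 (by
      rw [mul_comm]; exact this.2)⟩
    rintro rfl; simp at this
  · intros; rfl

theorem Nat.le_card_filter_coprime {m : ℕ} (hm : m ≠ 0) (N : ℕ) :
    N ≤ 2 * m.divisors.card ^ 2 * #{n ∈ Icc 1 N | n.Coprime m} := by
  set t := m.divisors.card
  set c := #{n ∈ Icc 1 N | n.Coprime m}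
  have ht : 1 ≤ t := Finset.card_pos.2 (Nat.nonempty_divisors.2 hm)
  have h1 : (c : ℝ) = ∑ d ∈ m.divisors, (ArithmeticFunction.moebius d : ℝ) * (N / d : ℕ) := by
    have := sum_filter_coprime_eq_sum_divisors hm N (fun _ => (1 : ℝ))
    simpa using this
  have h2 : ∑ d ∈ m.divisors, (ArithmeticFunction.moebius d : ℝ) * (1 / d : ℝ) =
      m.totient / m := by
    have h3 := sum_filter_coprime_eq_sum_divisors hm m (fun _ => (1 : ℝ))
    have h4 : #{n ∈ Icc 1 m | n.Coprime m} = m.totient := by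
      rw [Nat.totient_eq_card_coprime, Finset.range_eq_Ico]
      rcases eq_or_ne m 1 with rfl | h1
      · simp
      · congr 1
        ext n
        simp only [mem_filter, mem_Icc, mem_Ico, Nat.coprime_comm]
        constructor
        · rintro ⟨⟨h5, h6⟩, h7⟩
          refine ⟨⟨by omega, lt_of_le_of_ne h6 ?_⟩, h7⟩
          rintro rfl; simp at h7; omega
        · rintro ⟨⟨h5, h6⟩, h7⟩
          refine ⟨⟨Nat.pos_of_ne_zero ?_, h6.le⟩, h7⟩
          rintro rfl; simp at h7; omega
    simp only [sum_const, nsmul_eq_mul, mul_one, h4, Nat.card_Icc, Nat.add_sub_cancel] at h3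
    rw [h3, sum_div]
    refine sum_congr rfl fun d hd => ?_
    rw [Nat.cast_div (Nat.dvd_of_mem_divisors hd)
      (by have := Nat.pos_of_mem_divisors hd; positivity)]
    field_simp
  have h5 : (N : ℝ) * (m.totient / m) - t ≤ c := by
    rw [h1, ← h2, mul_sum, sub_le_iff_le_add]
    have : (t : ℝ) = ∑ d ∈ m.divisors, (1 : ℝ) := by simp [t]
    rw [this, ← sum_add_distrib]
    refine sum_le_sum fun d hd => ?_
    have hd0 : (0 : ℝ) < d := by exact_mod_cast Nat.pos_of_mem_divisors hd
    have a1 : |(ArithmeticFunction.moebius d : ℝ)| ≤ 1 := by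
      exact_mod_cast ArithmeticFunction.abs_moebius_le_one
    have a2 : |(N / d : ℝ) - (N / d : ℕ)| ≤ 1 := by
      have u1 : ((N / d : ℕ) : ℝ) ≤ N / d := Nat.cast_div_le
      have u2 : (N / d : ℝ) < (N / d : ℕ) + 1 := by
        rw [div_lt_iff₀ hd0, mul_comm]
        exact_mod_cast Nat.lt_mul_div_succ N (Nat.pos_of_mem_divisors hd)
      rw [abs_le]; constructor <;> linarith
    have a3 := (abs_le.1 ((abs_mul _ _).le.trans (mul_le_one₀ a1 (abs_nonneg _) a2))).2
    have : (N : ℝ) * ((ArithmeticFunction.moebius d : ℝ) * (1 / d)) =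
      (ArithmeticFunction.moebius d : ℝ) * (N / d) := by ring
    rw [this]; linarith
  have h6 : (m : ℝ) ≤ t * m.totient := by
    have q1 := Nat.totient_mul_prod_primeFactors m
    have q2 : ∏ p ∈ m.primeFactors, p ≤ 2 ^ m.primeFactors.card * ∏ p ∈ m.primeFactors, (p - 1) := by
      rw [← prod_const, ← prod_mul_distrib]
      refine prod_le_prod' fun p hp => ?_
      have := (Nat.prime_of_mem_primeFactors hp).two_le
      omega
    have q3 : 0 < ∏ p ∈ m.primeFactors, (p - 1) := by
      refine prod_pos fun p hp => ?_
      have := (Nat.prime_of_mem_primeFactors hp).two_le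
      omega
    have q4 : m * ∏ p ∈ m.primeFactors, (p - 1) ≤ t * m.totient * ∏ p ∈ m.primeFactors, (p - 1) := by
      rw [← q1]
      calc m.totient * ∏ p ∈ m.primeFactors, p ≤
            m.totient * (2 ^ m.primeFactors.card * ∏ p ∈ m.primeFactors, (p - 1)) := by gcongr
        _ ≤ m.totient * (t * ∏ p ∈ m.primeFactors, (p - 1)) := by
          gcongr; exact Nat.two_pow_card_primeFactors_le m hm
        _ = _ := by ring
    exact_mod_cast Nat.le_of_mul_le_mul_right q4 q3
  rcases Nat.eq_zero_or_pos N with rfl | hN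
  · simp
  have hc1 : 1 ≤ c := Finset.card_pos.2 ⟨1, by simp; omega⟩
  by_cases hs : N ≤ 2 * t ^ 2
  · calc N ≤ 2 * t ^ 2 := hs
      _ ≤ _ := Nat.le_mul_of_pos_right _ hc1
  push Not at hs
  have hs' : (2 : ℝ) * t ^ 2 < N := by exact_mod_cast hs
  have hm0 : (0 : ℝ) < m := by positivity
  have ht0 : (1 : ℝ) ≤ t := by exact_mod_cast ht
  have h7 : (1 : ℝ) ≤ t * (m.totient / m) := by
    rw [← mul_div_assoc, le_div_iff₀ hm0]; linarith
  have h8 : (N : ℝ) ≤ t * c + t ^ 2 := by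
    have v1 := mul_le_mul_of_nonneg_left h5 (by linarith : (0 : ℝ) ≤ t)
    have v2 : (N : ℝ) * 1 ≤ N * (t * (m.totient / m)) := by gcongr
    nlinarith
  have h9 : (N : ℝ) ≤ 2 * t * c := by linarith
  have h10 : (N : ℝ) ≤ 2 * t ^ 2 * c := by
    refine h9.trans ?_
    have : (0 : ℝ) ≤ c := by positivity
    have : (t : ℝ) ≤ t ^ 2 := by nlinarith
    gcongr
  exact_mod_cast h10

theorem Nat.sum_gcd_le {q : ℕ} (hq : q ≠ 0) (B : ℕ) :
    ∑ h ∈ Icc 1 B, q.gcd h ≤ B * q.divisors.card := by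
  calc ∑ h ∈ Icc 1 B, q.gcd h ≤ ∑ h ∈ Icc 1 B, ∑ d ∈ q.divisors, if d ∣ h then d else 0 := by
        refine sum_le_sum fun h _ => ?_
        refine le_trans ?_ (single_le_sum (f := fun d => if d ∣ h then d else 0)
          (fun _ _ => Nat.zero_le _) (Nat.mem_divisors.2 ⟨Nat.gcd_dvd_left q h, hq⟩))
        simp [Nat.gcd_dvd_right]
    _ = ∑ d ∈ q.divisors, ∑ h ∈ Icc 1 B, if d ∣ h then d else 0 := sum_comm
    _ ≤ ∑ d ∈ q.divisors, B := by
        refine sum_le_sum fun d hd => ?_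
        rw [← sum_filter, sum_const, smul_eq_mul]
        have : #{h ∈ Icc 1 B | d ∣ h} = B / d := by
          rw [← Nat.Ioc_filter_dvd_card_eq_div]; rfl
        rw [this]
        exact Nat.div_mul_le_self _ _
    _ = _ := by rw [sum_const, smul_eq_mul, mul_comm]

end DivisorBounds

section Moment

open Finset

theorem Finset.card_filter_no_unique_value_le {r : ℕ} (hr : r ≠ 0) (B : Finset ℕ) :
    #{f ∈ Fintype.piFinset (fun _ : Fin r ⊕ Fin r => B) | ∀ i, ∃ j ≠ i, f j = f i} ≤
      r ^ (2 * r) * #B ^ r := by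
  classical
  set S : Finset ((Fin r ⊕ Fin r → Fin r) × (Fin r → ℕ)) :=
    univ ×ˢ Fintype.piFinset (fun _ : Fin r => B) with hS
  have hcard : #S = r ^ (2 * r) * #B ^ r := by
    simp [hS, card_product, two_mul]
  rw [← hcard]
  refine le_trans (card_le_card ?_) (card_image_le (f := fun p => p.2 ∘ p.1))
  intro f hf
  obtain ⟨hf1, hf2⟩ := mem_filter.1 hf
  rw [Fintype.mem_piFinset] at hf1
  set s := univ.image f with hs
  have h1 : #s ≤ r := by
    have h2 := card_eq_sum_card_image f univ
    have h3 : #s • 2 ≤ ∑ b ∈ s, #{a ∈ univ | f a = b} := by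
      refine card_nsmul_le_sum _ _ _ fun b hb => ?_
      obtain ⟨i, -, rfl⟩ := mem_image.1 hb
      obtain ⟨j, hj, hji⟩ := hf2 i
      exact one_lt_card.2 ⟨i, by simp, j, by simp [hji], hj.symm⟩
    rw [← h2] at h3
    simp at h3; omega
  obtain ⟨emb⟩ : Nonempty (s ↪ Fin r) :=
    Function.Embedding.nonempty_of_card_le (by simpa using h1)
  have hne : Nonempty s := ⟨⟨f (Sum.inl ⟨0, Nat.pos_of_ne_zero hr⟩), by simp [hs]⟩⟩
  refine mem_image.2 ⟨⟨fun i => emb ⟨f i, by simp [hs]⟩, fun j => (Function.invFun emb j).1⟩, ?_, ?_⟩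
  · simp only [hS, mem_product, mem_univ, true_and, Fintype.mem_piFinset]
    intro j
    obtain ⟨i, -, hi⟩ := mem_image.1 (Function.invFun emb j).2
    rw [← hi]; exact hf1 i
  · funext i
    simp [Function.leftInverse_invFun emb.injective _]

theorem Nat.gcd_prod_dvd_prod_gcd {ι : Type*} (q : ℕ) (s : Finset ι) (f : ι → ℕ) :
    q.gcd (∏ i ∈ s, f i) ∣ ∏ i ∈ s, q.gcd (f i) := by
  classical
  induction s using Finset.induction_on with
  | empty => simp
  | insert a s ha ih =>
    rw [prod_insert ha, prod_insert ha]
    exact (Nat.gcd_mul_right_dvd_mul_gcd _ _ _).trans (mul_dvd_mul_left _ ih)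

theorem Nat.sum_gcd_sub_le {q : ℕ} (hq : q ≠ 0) (B v : ℕ) (hv : v ∈ Icc 1 B) :
    ∑ y ∈ Icc 1 B, (if y = v then 0 else q.gcd ((y : ℤ) - v).natAbs) ≤
      2 * B * q.divisors.card := by
  have hv' := mem_Icc.1 hv
  have h0 : ∀ y ∈ Icc 1 B, (if y = v then 0 else q.gcd ((y : ℤ) - v).natAbs) =
      (if v < y then q.gcd (y - v) else 0) + (if y < v then q.gcd (v - y) else 0) := by
    intro y _
    rcases lt_trichotomy y v with h | h | h
    · rw [if_neg h.ne, if_neg h.not_gt, if_pos h, zero_add]; congr 1; omega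
    · simp [h]
    · rw [if_neg h.ne', if_pos h, if_neg h.not_gt, add_zero]; congr 1; omega
  rw [sum_congr rfl h0, sum_add_distrib, ← sum_filter, ← sum_filter]
  have h1 : ∑ y ∈ Icc 1 B with v < y, q.gcd (y - v) ≤ B * q.divisors.card := by
    refine le_trans ?_ (Nat.sum_gcd_le hq B)
    rw [← sum_image (s := {y ∈ Icc 1 B | v < y}) (g := fun y => y - v) (f := fun h => q.gcd h)]
    · refine sum_le_sum_of_subset fun h hh => ?_
      simp only [mem_image, mem_filter, mem_Icc] at hh ⊢
      omega
    · intro a ha b hb hab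
      simp at ha hb hab; omega
  have h2 : ∑ y ∈ Icc 1 B with y < v, q.gcd (v - y) ≤ B * q.divisors.card := by
    refine le_trans ?_ (Nat.sum_gcd_le hq B)
    rw [← sum_image (s := {y ∈ Icc 1 B | y < v}) (g := fun y => v - y) (f := fun h => q.gcd h)]
    · refine sum_le_sum_of_subset fun h hh => ?_
      simp only [mem_image, mem_filter, mem_Icc] at hh ⊢
      omega
    · intro a ha b hb hab
      simp at ha hb hab; omega
  linarith

theorem Nat.sum_piFinset_prod_gcd_le {ι : Type*} [Fintype ι] [DecidableEq ι] {q : ℕ} (hq : q ≠ 0)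
    (B : ℕ) (i₀ : ι) :
    ∑ f ∈ Fintype.piFinset (fun _ : ι => Icc 1 B), ∏ i ∈ univ.erase i₀,
        (if f i = f i₀ then 0 else q.gcd ((f i : ℤ) - f i₀).natAbs) ≤
      B * (2 * B * q.divisors.card) ^ (Fintype.card ι - 1) := by
  set W : ℕ → ι → ℕ → ℕ := fun v i y =>
    if i = i₀ then (if y = v then 1 else 0) else
      (if y = v then 0 else q.gcd ((y : ℤ) - v).natAbs) with hW
  have h1 : ∀ f ∈ Fintype.piFinset (fun _ : ι => Icc 1 B), ∏ i ∈ univ.erase i₀,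
        (if f i = f i₀ then 0 else q.gcd ((f i : ℤ) - f i₀).natAbs) =
      ∑ v ∈ Icc 1 B, ∏ i, W v i (f i) := by
    intro f hf
    rw [Fintype.mem_piFinset] at hf
    rw [sum_eq_single (f i₀)]
    · rw [← mul_prod_erase univ _ (mem_univ i₀)]
      simp only [hW, if_true, one_mul]
      exact prod_congr rfl fun i hi => by rw [if_neg (ne_of_mem_erase hi)]
    · intro v _ hv
      exact prod_eq_zero (mem_univ i₀) (by simp [hW, hv.symm])
    · intro h; exact absurd (hf i₀) h
  rw [sum_congr rfl h1, sum_comm]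
  calc _ ≤ ∑ v ∈ Icc 1 B, (2 * B * q.divisors.card) ^ (Fintype.card ι - 1) := by
        refine sum_le_sum fun v hv => ?_
        rw [← prod_univ_sum, ← mul_prod_erase univ _ (mem_univ i₀)]
        have e1 : ∑ y ∈ Icc 1 B, W v i₀ y = 1 := by
          simp only [hW, if_true]
          rw [sum_ite_eq' (Icc 1 B) v]; simp only [hv, if_true]
        rw [e1, one_mul]
        calc _ ≤ ∏ i ∈ univ.erase i₀, (2 * B * q.divisors.card) := by
              refine prod_le_prod' fun i hi => ?_
              simp only [hW, if_neg (ne_of_mem_erase hi)]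
              exact Nat.sum_gcd_sub_le hq B v hv
          _ = _ := by rw [prod_const, card_erase_of_mem (mem_univ _), Finset.card_univ]
    _ = _ := by simp

theorem DirichletCharacter.star_apply_eq_pow {q : ℕ} [NeZero q] (χ : DirichletCharacter ℂ q)
    (x : ZMod q) : star (χ x) = χ x ^ (2 * q.totient - 1) := by
  have hφ : 0 < q.totient := Nat.totient_pos.2 (NeZero.pos q)
  by_cases hx : IsUnit x
  · obtain ⟨u, rfl⟩ := hx
    have h1 : χ u ^ (2 * q.totient) = 1 := by
      rw [mul_comm, pow_mul, ← map_pow, ← Units.val_pow_eq_pow_val, ZMod.pow_totient]; simp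
    have h2 : ‖χ (u : ZMod q)‖ = 1 := χ.unit_norm_eq_one u
    have h0 : χ (u : ZMod q) ≠ 0 := by rw [← norm_pos_iff, h2]; exact one_pos
    have h3 : star (χ (u : ZMod q)) * χ u = 1 := by
      have := Complex.normSq_eq_conj_mul_self (z := χ (u : ZMod q))
      rw [Complex.normSq_eq_norm_sq, h2] at this
      simpa using this.symm
    refine mul_right_cancel₀ h0 ?_
    rw [h3, ← pow_succ, Nat.sub_add_cancel (by omega), h1]
  · rw [χ.map_nonunit hx, star_zero, zero_pow (by omega)]

/-- Even moments of short sums of a character to a cubefree modulus. -/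
theorem sum_norm_sum_shift_pow_le {q : ℕ} [NeZero q] (hq : ∀ p : ℕ, p.Prime → ¬ p ^ 3 ∣ q)
    (χ : DirichletCharacter ℂ q) (hχ : NoProperPeriod χ) {r : ℕ} (hr : r ≠ 0) (B : ℕ) :
    ∑ x : ZMod q, ‖∑ b ∈ Icc 1 B, χ (x + b)‖ ^ (2 * r) ≤
      (r : ℝ) ^ (2 * r) * B ^ r * q + 2 * r * ((2 * r : ℕ) : ℝ) ^ q.primeFactors.card * √q *
        (B * (2 * B * q.divisors.card) ^ (2 * r - 1)) := by
  have hq0 : q ≠ 0 := NeZero.ne q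
  have hφ : 0 < q.totient := Nat.totient_pos.2 (NeZero.pos q)
  set ι := Fin r ⊕ Fin r
  set e : ι → ℕ := Sum.elim (fun _ => 1) (fun _ => 2 * q.totient - 1) with he
  have hcι : Fintype.card ι = 2 * r := by simp [ι, two_mul]
  set T : (ι → ℕ) → ℝ := fun f => ‖∑ x : ZMod q, ∏ i, χ (x + f i) ^ e i‖ with hT
  have h1 : ∑ x : ZMod q, ‖∑ b ∈ Icc 1 B, χ (x + b)‖ ^ (2 * r) ≤
      ∑ f ∈ Fintype.piFinset (fun _ : ι => Icc 1 B), T f := by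
    have e1 : ((∑ x : ZMod q, ‖∑ b ∈ Icc 1 B, χ (x + b)‖ ^ (2 * r) : ℝ) : ℂ) =
        ∑ f ∈ Fintype.piFinset (fun _ : ι => Icc 1 B), ∑ x : ZMod q, ∏ i, χ (x + f i) ^ e i := by
      rw [sum_comm, Complex.ofReal_sum]
      refine sum_congr rfl fun x _ => ?_
      rw [← prod_univ_sum (fun _ => Icc 1 B) (fun (i : ι) (b : ℕ) => χ (x + b) ^ e i),
        Fintype.prod_sum_type]
      simp only [he, Sum.elim_inl, Sum.elim_inr, pow_one, ← DirichletCharacter.star_apply_eq_pow,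
        prod_const, card_univ, Fintype.card_fin]
      rw [← star_sum, ← mul_pow, pow_mul]
      push_cast
      congr 1
      rw [← Complex.ofReal_pow, ← Complex.normSq_eq_norm_sq, Complex.normSq_eq_conj_mul_self,
        mul_comm]; rfl
    have e2 := congrArg norm e1
    rw [Complex.norm_real, Real.norm_of_nonneg (by positivity)] at e2
    rw [e2]; exact norm_sum_le _ _
  set k : ℝ := ((2 * r : ℕ) : ℝ) ^ q.primeFactors.card * √q with hk
  have hT1 : ∀ f, T f ≤ q := fun f => by
    refine (norm_sum_le _ _).trans ?_
    calc _ ≤ ∑ x : ZMod q, (1 : ℝ) := sum_le_sum fun x _ => norm_prod_pow_le_one χ _ _ _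
      _ = q := by simp
  have hT2 : ∀ f (i₀ : ι), (∀ j ≠ i₀, f j ≠ f i₀) → T f ≤ k * ((∏ i ∈ univ.erase i₀,
        (if f i = f i₀ then 0 else q.gcd ((f i : ℤ) - f i₀).natAbs) : ℕ) : ℝ) := by
    intro f i₀ hf
    have h2 := norm_sum_prod_shift_le (ι := ι) (fun i => (f i : ℤ)) (e := e) ?_ i₀ q hq χ hχ ?_ ?_
    · rw [hcι] at h2
      simp only [Int.cast_natCast] at h2
      refine h2.trans (mul_le_mul_of_nonneg_left ?_ (by positivity))
      rw [prod_congr rfl fun i hi => if_neg (hf i (ne_of_mem_erase hi))]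
      norm_cast
      rw [← Int.natAbsHom_apply, map_prod]
      exact Nat.le_of_dvd (prod_pos fun i _ => Nat.gcd_pos_of_pos_left _ (NeZero.pos q))
        (by simpa using Nat.gcd_prod_dvd_prod_gcd q (univ.erase i₀) _)
    · rintro (i | i) <;> simp [he]; omega
    · rw [Fintype.sum_sum_type]
      simp only [he, Sum.elim_inl, Sum.elim_inr, sum_const, card_univ, Fintype.card_fin,
        smul_eq_mul, ← mul_add]
      rw [add_comm, Nat.sub_add_cancel (by omega)]
      exact ⟨r * 2, by ring⟩
    · rcases i₀ with i | i
      · simp [he]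
      · simp only [he, Sum.elim_inr]
        rw [Nat.coprime_iff_gcd_eq_one, ← Nat.coprime_iff_gcd_eq_one]
        have := (Nat.coprime_self_sub_left (n := 2 * q.totient) (m := 1) (by omega)).2
          (Nat.coprime_one_left _)
        exact Nat.Coprime.coprime_dvd_right ⟨2, by ring⟩ this
  refine h1.trans ?_
  rw [← sum_filter_add_sum_filter_not _ (fun f : ι → ℕ => ∀ i, ∃ j ≠ i, f j = f i)]
  refine add_le_add ?_ ?_
  · calc _ ≤ ∑ f ∈ Fintype.piFinset (fun _ : ι => Icc 1 B) with (∀ i, ∃ j ≠ i, f j = f i), (q : ℝ) :=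
          sum_le_sum fun f _ => hT1 f
      _ = #{f ∈ Fintype.piFinset (fun _ : ι => Icc 1 B) | ∀ i, ∃ j ≠ i, f j = f i} * (q : ℝ) := by
          rw [sum_const, nsmul_eq_mul]
      _ ≤ _ := by
          have := card_filter_no_unique_value_le hr (Icc 1 B)
          rw [Nat.card_Icc, Nat.add_sub_cancel] at this
          gcongr
          exact_mod_cast this
  · calc _ ≤ ∑ f ∈ Fintype.piFinset (fun _ : ι => Icc 1 B) with ¬ (∀ i, ∃ j ≠ i, f j = f i),
            ∑ i₀ : ι, k * ((∏ i ∈ univ.erase i₀,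
        (if f i = f i₀ then 0 else q.gcd ((f i : ℤ) - f i₀).natAbs) : ℕ) : ℝ) := by
          refine sum_le_sum fun f hf => ?_
          have := (mem_filter.1 hf).2
          push Not at this
          obtain ⟨i₀, hi⟩ := this
          refine (hT2 f i₀ hi).trans ?_
          exact single_le_sum (f := fun i₀ => k * ((∏ i ∈ univ.erase i₀,
            (if f i = f i₀ then 0 else q.gcd ((f i : ℤ) - f i₀).natAbs) : ℕ) : ℝ))
            (fun _ _ => by positivity) (mem_univ i₀)
      _ ≤ ∑ f ∈ Fintype.piFinset (fun _ : ι => Icc 1 B),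
            ∑ i₀ : ι, k * ((∏ i ∈ univ.erase i₀,
        (if f i = f i₀ then 0 else q.gcd ((f i : ℤ) - f i₀).natAbs) : ℕ) : ℝ) :=
          sum_le_sum_of_subset_of_nonneg (filter_subset _ _)
            (fun _ _ _ => sum_nonneg fun _ _ => by positivity)
      _ ≤ ∑ i₀ : ι, k * ((B * (2 * B * q.divisors.card) ^ (Fintype.card ι - 1) : ℕ) : ℝ) := by
          rw [sum_comm]
          refine sum_le_sum fun i₀ _ => ?_
          rw [← mul_sum, ← Nat.cast_sum]
          gcongr
          exact Nat.sum_piFinset_prod_gcd_le hq0 B i₀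
      _ = _ := by
          rw [sum_const, card_univ, hcι, nsmul_eq_mul, hk]; push_cast; ring

end Moment

section ShiftMethod

open Finset

theorem Finset.sum_comp_pow_le {α β : Type*} [Fintype β] [DecidableEq β] (P : Finset α)
    (φ : α → β) (T : β → ℝ) (hT : ∀ x, 0 ≤ T x) {r : ℕ} (hr : r ≠ 0) :
    (∑ p ∈ P, T (φ p)) ^ (2 * r) ≤ (#P : ℝ) ^ (2 * r - 2) *
      #{z ∈ P ×ˢ P | φ z.1 = φ z.2} * ∑ x, T x ^ (2 * r) := by
  have hν : ∀ g : β → ℝ, ∑ p ∈ P, g (φ p) = ∑ x, (#{p ∈ P | φ p = x} : ℝ) * g x := by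
    intro g
    rw [← sum_fiberwise P φ]
    refine sum_congr rfl fun x _ => ?_
    rw [sum_congr rfl fun p hp => by rw [(mem_filter.1 hp).2], sum_const, nsmul_eq_mul]
  have h1 : (∑ p ∈ P, T (φ p)) ^ r ≤ (#P : ℝ) ^ (r - 1) * ∑ p ∈ P, T (φ p) ^ r := by
    obtain ⟨s, rfl⟩ := Nat.exists_eq_succ_of_ne_zero hr
    rcases P.eq_empty_or_nonempty with rfl | hP
    · simp
    have := pow_sum_div_card_le_sum_pow (s := P) (f := fun p => T (φ p))
      (fun _ _ => hT _) s
    have hc : (0 : ℝ) < (#P : ℝ) ^ s := by have := hP.card_pos; positivity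
    rw [div_le_iff₀ hc, mul_comm] at this
    simpa using this
  have h2 : (∑ p ∈ P, T (φ p) ^ r) ^ 2 ≤
      #{z ∈ P ×ˢ P | φ z.1 = φ z.2} * ∑ x, T x ^ (2 * r) := by
    rw [hν (fun x => T x ^ r)]
    refine (sum_mul_sq_le_sq_mul_sq _ _ _).trans (le_of_eq ?_)
    congr 1
    · have e1 := hν (fun x => (#{p ∈ P | φ p = x} : ℝ))
      simp only [pow_two]
      rw [← e1, card_filter, sum_product]
      push_cast
      refine sum_congr rfl fun p _ => ?_
      rw [card_filter]; push_cast
      exact sum_congr rfl fun p' _ => by simp [eq_comm]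
    · refine sum_congr rfl fun x _ => ?_
      rw [← pow_mul, mul_comm]
  have h0 : 0 ≤ ∑ p ∈ P, T (φ p) := sum_nonneg fun _ _ => hT _
  calc (∑ p ∈ P, T (φ p)) ^ (2 * r) = ((∑ p ∈ P, T (φ p)) ^ r) ^ 2 := by rw [← pow_mul, mul_comm]
    _ ≤ ((#P : ℝ) ^ (r - 1) * ∑ p ∈ P, T (φ p) ^ r) ^ 2 := by gcongr
    _ = (#P : ℝ) ^ (2 * r - 2) * (∑ p ∈ P, T (φ p) ^ r) ^ 2 := by
        rw [mul_pow, ← pow_mul]; congr 2; omega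
    _ ≤ (#P : ℝ) ^ (2 * r - 2) * (#{z ∈ P ×ˢ P | φ z.1 = φ z.2} * ∑ x, T x ^ (2 * r)) := by gcongr
    _ = _ := by ring

theorem norm_sum_Icc_sub_sum_Icc_add_le (f : ℕ → ℂ) (hf : ∀ n, ‖f n‖ ≤ 1) (K h : ℕ) :
    ‖∑ n ∈ Icc 1 K, f n - ∑ n ∈ Icc 1 K, f (n + h)‖ ≤ 2 * h := by
  induction h with
  | zero => simp
  | succ h ih =>
    have key : ∀ K : ℕ, ∑ n ∈ Icc 1 K, f (n + h) - ∑ n ∈ Icc 1 K, f (n + (h + 1)) =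
        f (1 + h) - f (K + 1 + h) := by
      intro K
      induction K with
      | zero => simp
      | succ K ih =>
        rw [sum_Icc_succ_top (by omega), sum_Icc_succ_top (by omega)]
        have e : K + 1 + (h + 1) = K + 1 + 1 + h := by ring
        rw [e]
        linear_combination ih
    have e : ∑ n ∈ Icc 1 K, f n - ∑ n ∈ Icc 1 K, f (n + (h + 1)) =
        (∑ n ∈ Icc 1 K, f n - ∑ n ∈ Icc 1 K, f (n + h)) + (f (1 + h) - f (K + 1 + h)) := by
      rw [← key]; ring
    rw [e]
    refine (norm_add_le _ _).trans ?_
    have := (norm_sub_le (f (1 + h)) (f (K + 1 + h))).trans (add_le_add (hf _) (hf _))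
    push_cast
    linarith

/-- Burgess' shifting trick, combined with Hölder's inequality. -/
theorem exists_shift_bound {q : ℕ} [NeZero q] (χ : DirichletCharacter ℂ q) {A B K r D : ℕ}
    (hr : r ≠ 0) (hAK : A * K ≤ q) (hD : ∀ n, n ≠ 0 → n ≤ q → n.divisors.card ≤ D) :
    ∃ E : ℝ, 0 ≤ E ∧
      (#{a ∈ Icc 1 A | a.Coprime q} : ℝ) * B * ‖∑ n ∈ Icc 1 K, χ n‖ ≤
        (#{a ∈ Icc 1 A | a.Coprime q} : ℝ) * B * (2 * (A * B)) + E ∧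
      E ^ (2 * r) ≤ (#{a ∈ Icc 1 A | a.Coprime q} * K : ℝ) ^ (2 * r - 1) * D *
        ∑ x : ZMod q, ‖∑ b ∈ Icc 1 B, χ (x + b)‖ ^ (2 * r) := by
  set 𝒜 := {a ∈ Icc 1 A | a.Coprime q} with h𝒜
  set T : ZMod q → ℝ := fun x => ‖∑ b ∈ Icc 1 B, χ (x + b)‖ with hT
  set P := 𝒜 ×ˢ Icc 1 K with hP
  set φ : ℕ × ℕ → ZMod q := fun p => p.2 * (p.1 : ZMod q)⁻¹ with hφ
  have hinv : ∀ a ∈ 𝒜, (a : ZMod q) * (a : ZMod q)⁻¹ = 1 := fun a ha =>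
    ZMod.coe_mul_inv_eq_one a (mem_filter.1 ha).2
  have hcP : (#P : ℝ) = #𝒜 * K := by simp [hP]
  refine ⟨∑ p ∈ P, T (φ p), sum_nonneg fun _ _ => norm_nonneg _, ?_, ?_⟩
  · have h1 : ∀ a ∈ 𝒜, B * ‖∑ n ∈ Icc 1 K, χ n‖ ≤
        B * (2 * (A * B)) + ∑ n ∈ Icc 1 K, T (φ (a, n)) := by
      intro a ha
      have e1 : ∀ b : ℕ, ∑ n ∈ Icc 1 K, χ ((n + a * b : ℕ) : ZMod q) =
          χ a * ∑ n ∈ Icc 1 K, χ (φ (a, n) + b) := by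
        intro b
        rw [mul_sum]
        refine sum_congr rfl fun n _ => ?_
        rw [← map_mul]; congr 1
        simp only [hφ]; push_cast
        linear_combination (-(n : ZMod q)) * hinv a ha
      have e2 : ∀ b ∈ Icc 1 B, ‖∑ n ∈ Icc 1 K, χ n - χ a * ∑ n ∈ Icc 1 K, χ (φ (a, n) + b)‖ ≤
          2 * (A * B) := by
        intro b hb
        rw [← e1]
        refine (norm_sum_Icc_sub_sum_Icc_add_le (fun n : ℕ => χ n) (fun n => χ.norm_le_one _)
          K (a * b)).trans ?_
        have hb' := (mem_Icc.1 hb).2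
        have ha' := (mem_Icc.1 (mem_filter.1 ha).1).2
        push_cast; gcongr
      have e3 : (B : ℂ) * ∑ n ∈ Icc 1 K, χ n =
          ∑ b ∈ Icc 1 B, (∑ n ∈ Icc 1 K, χ n - χ a * ∑ n ∈ Icc 1 K, χ (φ (a, n) + b)) +
          χ a * ∑ n ∈ Icc 1 K, ∑ b ∈ Icc 1 B, χ (φ (a, n) + b) := by
        rw [sum_sub_distrib, ← mul_sum, sum_comm (s := Icc 1 K)]
        simp
      have e4 := congrArg norm e3
      rw [norm_mul, Complex.norm_natCast] at e4
      rw [e4]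
      refine (norm_add_le _ _).trans (add_le_add ?_ ?_)
      · refine (norm_sum_le_of_le _ e2).trans (le_of_eq ?_)
        simp
      · rw [norm_mul]
        refine (mul_le_of_le_one_left (norm_nonneg _) (χ.norm_le_one _)).trans ?_
        exact norm_sum_le _ _
    have h2 := sum_le_sum h1
    rw [sum_add_distrib, ← sum_product' 𝒜 (Icc 1 K) (fun a n => T (φ (a, n)))] at h2
    simp only [sum_const, nsmul_eq_mul] at h2
    rw [mul_assoc, mul_assoc]
    exact h2
  · refine (Finset.sum_comp_pow_le P φ T (fun _ => norm_nonneg _) hr).trans ?_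
    have hQ : #{z ∈ P ×ˢ P | φ z.1 = φ z.2} ≤ D * #P := by
      refine card_le_mul_card_image_of_maps_to (f := fun z => (z.2.1, z.1.2)) ?_ D ?_
      · rintro ⟨⟨a, n⟩, ⟨a', n'⟩⟩ hz
        simp only [hP, mem_filter, mem_product] at hz ⊢
        exact ⟨hz.1.2.1, hz.1.1.2⟩
      · rintro ⟨a', n⟩ hb
        simp only [hP, mem_product] at hb
        have ha1 := mem_Icc.1 (mem_filter.1 hb.1).1
        have hn1 := mem_Icc.1 hb.2
        have hw : n * a' ≤ q := by
          calc n * a' ≤ K * A := Nat.mul_le_mul hn1.2 ha1.2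
            _ ≤ q := by rw [mul_comm]; exact hAK
        have hw0 : n * a' ≠ 0 := by have := hn1.1; have := ha1.1; positivity
        refine le_trans ?_ (hD _ hw0 hw)
        have key : ∀ z ∈ {z ∈ {z ∈ P ×ˢ P | φ z.1 = φ z.2} | (z.2.1, z.1.2) = (a', n)},
            z.2.1 = a' ∧ z.1.2 = n ∧ z.2.2 * z.1.1 = n * a' ∧ z.1.1 ≠ 0 := by
          rintro ⟨⟨a₁, n₁⟩, ⟨a₂, n₂⟩⟩ hz
          simp only [hP, mem_filter, mem_product, Prod.mk.injEq] at hz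
          obtain ⟨⟨⟨⟨ha, hn⟩, ⟨ha', hn'⟩⟩, h⟩, rfl, rfl⟩ := hz
          have b1 := mem_Icc.1 (mem_filter.1 ha).1
          have b2 := mem_Icc.1 hn'
          refine ⟨rfl, rfl, ?_, Nat.pos_iff_ne_zero.1 b1.1⟩
          have hz' : ((n₂ * a₁ : ℕ) : ZMod q) = ((n₁ * a₂ : ℕ) : ZMod q) := by
            simp only [hφ] at h
            push_cast
            have i1 := hinv a₁ ha
            have i2 := hinv a₂ ha'
            linear_combination (-(a₁ : ZMod q) * a₂) * h + n₁ * a₂ * i1 - n₂ * a₁ * i2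
          have hz2 : n₂ * a₁ ≤ q := by
            calc n₂ * a₁ ≤ K * A := Nat.mul_le_mul b2.2 b1.2
              _ ≤ q := by rw [mul_comm]; exact hAK
          have hz0 : n₂ * a₁ ≠ 0 := by have := b1.1; have := b2.1; positivity
          rw [ZMod.natCast_eq_natCast_iff] at hz'
          rcases hz2.eq_or_lt with h3 | h3
          · rcases hw.eq_or_lt with h4 | h4
            · exact h3.trans h4.symm
            · exfalso
              rw [h3] at hz'
              have := (Nat.modEq_zero_iff_dvd.1 ((hz'.symm.trans (by simp [Nat.ModEq]))))
              exact hw0 (Nat.eq_zero_of_dvd_of_lt this h4)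
          · rcases hw.eq_or_lt with h4 | h4
            · exfalso
              rw [h4] at hz'
              have := (Nat.modEq_zero_iff_dvd.1 ((hz'.trans (by simp [Nat.ModEq]))))
              exact hz0 (Nat.eq_zero_of_dvd_of_lt this h3)
            · exact Nat.ModEq.eq_of_lt_of_lt hz' h3 h4
        refine card_le_card_of_injOn (fun z => z.1.1) ?_ ?_
        · intro z hz
          obtain ⟨-, -, h3, -⟩ := key z hz
          exact Nat.mem_divisors.2 ⟨⟨z.2.2, by rw [← h3, mul_comm]⟩, hw0⟩
        · intro z hz z' hz' h
          obtain ⟨h1, h2, h3, h4⟩ := key z hz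
          obtain ⟨h1', h2', h3', -⟩ := key z' hz'
          have h' : z.1.1 = z'.1.1 := h
          have h5 : z.2.2 = z'.2.2 := by
            rw [← h3', ← h'] at h3
            exact Nat.eq_of_mul_eq_mul_right (Nat.pos_of_ne_zero h4) h3
          ext <;> simp [h1, h1', h2, h2', h', h5]
    have hQ' : (#{z ∈ P ×ˢ P | φ z.1 = φ z.2} : ℝ) ≤ D * #P := by exact_mod_cast hQ
    rw [← hcP]
    have e : (#P : ℝ) ^ (2 * r - 1) * D = (#P : ℝ) ^ (2 * r - 2) * (D * #P) := by
      have : 2 * r - 1 = (2 * r - 2) + 1 := by omega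
      rw [this, pow_succ]; ring
    rw [e]
    have : 0 ≤ ∑ x, T x ^ (2 * r) := sum_nonneg fun _ _ => pow_nonneg (norm_nonneg _) _
    gcongr

end ShiftMethod

section Burgess

open Finset

theorem div_pow_le_of_pow_le {ε κ c C₁ c' a B K E Q : ℝ} {r : ℕ} (hr0' : r ≠ 0)
    (hκ : κ * (4 * r + 3) = ε / 2) (hc0 : 0 < c) (hC₁ : 1 ≤ C₁)
    (hc' : c' = 4 * c * C₁ ^ (4 * r + 3) + 1) (ha0 : 0 < a) (hB0 : 0 < B) (hK0 : 0 < K)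
    (hQ0 : 0 < Q)
    (h1 : E ^ (2 * r) ≤ (a * K) ^ (2 * r - 1) * (C₁ * Q ^ κ) *
        (c * (C₁ * Q ^ κ) ^ (4 * r) * √Q * B ^ (2 * r)))
    (h3 : √Q * Q ^ ε ≤ 4 * (C₁ * Q ^ κ) ^ 2 * (a * K)) :
    (E / (a * B)) ^ (2 * r) ≤ (c' * K * Q ^ (-(ε / (4 * r)))) ^ (2 * r) := by
  have hr0 : (0 : ℝ) < r := by positivity
  have hc'1 : 1 ≤ c' := by
    have : 0 < 4 * c * C₁ ^ (4 * r + 3) := by positivity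
    linarith
  have h2 : (a * K) ^ (2 * r - 1) * (a * K) = a ^ (2 * r) * K ^ (2 * r) := by
    rw [← pow_succ, ← mul_pow]; congr 1; omega
  have h4 : Q ^ ε = Q ^ (ε / 2) * Q ^ (ε / 2) := by
    rw [← Real.rpow_add hQ0]; ring_nf
  have h5 : (C₁ * Q ^ κ) ^ (4 * r + 3) = C₁ ^ (4 * r + 3) * Q ^ (ε / 2) := by
    rw [mul_pow, ← Real.rpow_natCast (Q ^ κ), ← Real.rpow_mul hQ0.le]
    congr 2
    push_cast; linarith
  have h6 : (Q ^ (-(ε / (4 * r)))) ^ (2 * r) = (Q ^ (ε / 2))⁻¹ := by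
    rw [← Real.rpow_natCast, ← Real.rpow_mul hQ0.le, ← Real.rpow_neg hQ0.le]
    congr 1; push_cast; field_simp; norm_num
  have h7 : 4 * c * C₁ ^ (4 * r + 3) ≤ c' ^ (2 * r) := by
    calc 4 * c * C₁ ^ (4 * r + 3) ≤ c' := by linarith
      _ ≤ _ := le_self_pow₀ hc'1 (by omega)
  have hP : 0 < Q ^ (ε / 2) := by positivity
  rw [div_pow, mul_pow, mul_pow, mul_pow, h6, div_le_iff₀ (by positivity)]
  refine le_of_mul_le_mul_right ?_ (show 0 < (a * K) * Q ^ ε by positivity)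
  calc E ^ (2 * r) * (a * K * Q ^ ε) ≤ (a * K) ^ (2 * r - 1) * (C₁ * Q ^ κ) *
      (c * (C₁ * Q ^ κ) ^ (4 * r) * √Q * B ^ (2 * r)) * (a * K * Q ^ ε) := by gcongr
    _ = ((a * K) ^ (2 * r - 1) * (a * K)) * (c * (C₁ * Q ^ κ) ^ (4 * r + 1) * B ^ (2 * r)) *
        (√Q * Q ^ ε) := by ring
    _ ≤ ((a * K) ^ (2 * r - 1) * (a * K)) * (c * (C₁ * Q ^ κ) ^ (4 * r + 1) * B ^ (2 * r)) *
        (4 * (C₁ * Q ^ κ) ^ 2 * (a * K)) := by gcongr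
    _ = (4 * c * C₁ ^ (4 * r + 3)) * (a ^ (2 * r) * K ^ (2 * r) * B ^ (2 * r) *
          (a * K) * Q ^ (ε / 2)) := by
        have : (C₁ * Q ^ κ) ^ (4 * r + 1) * (C₁ * Q ^ κ) ^ 2 = (C₁ * Q ^ κ) ^ (4 * r + 3) := by rw [← pow_add]
        rw [h2]
        linear_combination (4 * c * a ^ (2 * r) * K ^ (2 * r) * B ^ (2 * r) *
          (a * K)) * (this + h5)
    _ ≤ c' ^ (2 * r) * (a ^ (2 * r) * K ^ (2 * r) * B ^ (2 * r) *
          (a * K) * Q ^ (ε / 2)) := by gcongr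
    _ = _ := by rw [h4]; field_simp

set_option maxHeartbeats 1000000 in
theorem norm_sum_Icc_le_of_le_sq {ε : ℝ} (hε : 0 < ε) : ∃ δ : ℝ, 0 < δ ∧ ∃ C : ℝ, 0 < C ∧
    ∀ (q : ℕ) [NeZero q], (∀ p : ℕ, p.Prime → ¬ p ^ 3 ∣ q) → ∀ χ : DirichletCharacter ℂ q,
    NoProperPeriod χ → ∀ (K : ℕ) (X : ℝ), (q : ℝ) ^ (1 / 2 + ε) ≤ X → X ≤ q → K ≤ X →
    X * (q : ℝ) ^ ε ≤ (K : ℝ) ^ 2 → ‖∑ n ∈ Icc 1 K, χ n‖ ≤ C * K * (q : ℝ) ^ (-δ) := by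
  obtain ⟨r, hr⟩ : ∃ r : ℕ, 1 / ε < r := exists_nat_gt _
  have hr0 : (0 : ℝ) < r := lt_trans (by positivity) hr
  have hr0' : r ≠ 0 := by rintro rfl; simp at hr0
  have hrε : 1 / (2 * r : ℝ) ≤ ε / 2 := by
    rw [div_lt_iff₀ hε] at hr
    rw [div_le_div_iff₀ (by positivity) two_pos]; linarith
  set κ : ℝ := ε / (2 * (4 * r + 3)) with hκ
  have hκ0 : 0 < κ := by positivity
  obtain ⟨C₁, hC₁, hdiv⟩ := Nat.card_divisors_le_mul_rpow hκ0
  set c : ℝ := r ^ (2 * r) + 2 * r * 2 ^ (2 * r) with hc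
  have hc0 : 0 < c := by positivity
  set c' : ℝ := 4 * c * C₁ ^ (4 * r + 3) + 1 with hc'
  have hc'1 : 1 ≤ c' := by
    have : 0 < 4 * c * C₁ ^ (4 * r + 3) := by positivity
    linarith
  refine ⟨ε / (4 * r), by positivity, 4 + c', by linarith, ?_⟩
  intro q _ hq χ hχ K X hX1 hX2 hKX hXK
  have hQ1 : (1 : ℝ) ≤ q := by exact_mod_cast NeZero.pos q
  have hqn : ∀ n : ℕ, n ≤ q → (n : ℝ) ≤ q := fun n h => by exact_mod_cast h
  set Q : ℝ := (q : ℝ) with hQ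
  have hQ0 : 0 < Q := by linarith
  have hX0 : 0 < X := lt_of_lt_of_le (by positivity) hX1
  have hK0 : (0 : ℝ) < K := by
    have : 0 < X * Q ^ ε := by positivity
    have : (0 : ℝ) < (K : ℝ) ^ 2 := by linarith
    exact lt_of_le_of_ne (by positivity) fun h => by rw [← h] at this; simp at this
  set t : ℝ := C₁ * Q ^ κ with ht
  have hQκ : 1 ≤ Q ^ κ := Real.one_le_rpow hQ1 hκ0.le
  have ht1 : 1 ≤ t := by nlinarith
  set A : ℕ := ⌊X / K⌋₊ with hA
  have hA1 : (A : ℝ) ≤ X / K := Nat.floor_le (by positivity)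
  have hA2 : X / K ≤ 2 * A := by
    have h1 : 1 ≤ A := (Nat.le_floor_iff (by positivity)).2 (by
      rw [Nat.cast_one, le_div_iff₀ hK0]; linarith)
    have h1' : (1 : ℝ) ≤ A := by exact_mod_cast h1
    have := Nat.lt_floor_add_one (X / K)
    linarith
  have hAK : A * K ≤ q := by
    rw [le_div_iff₀ hK0] at hA1
    have : ((A * K : ℕ) : ℝ) ≤ (q : ℝ) := by push_cast; exact hA1.trans hX2
    exact Nat.cast_le.1 this
  set B : ℕ := ⌈Q ^ (1 / (2 * r : ℝ))⌉₊ with hB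
  have hQr : 1 ≤ Q ^ (1 / (2 * r : ℝ)) := Real.one_le_rpow hQ1 (by positivity)
  have hB1 : Q ^ (1 / (2 * r : ℝ)) ≤ B := Nat.le_ceil _
  have hB2 : (B : ℝ) ≤ 2 * Q ^ (1 / (2 * r : ℝ)) := by
    have := Nat.ceil_lt_add_one (zero_le_one.trans hQr)
    linarith
  have hB0 : (0 : ℝ) < B := by linarith
  have hBr : √Q ≤ (B : ℝ) ^ r := by
    calc √Q = (Q ^ (1 / (2 * r : ℝ))) ^ r := by
          rw [← Real.rpow_natCast, ← Real.rpow_mul hQ0.le, Real.sqrt_eq_rpow]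
          congr 1; field_simp
      _ ≤ _ := by gcongr
  set D : ℕ := ⌊t⌋₊ with hD
  have hDt : (D : ℝ) ≤ t := Nat.floor_le (by linarith)
  have hDD : ∀ n, n ≠ 0 → n ≤ q → n.divisors.card ≤ D := by
    intro n hn hnq
    refine Nat.le_floor ((hdiv n hn).trans ?_)
    exact mul_le_mul_of_nonneg_left (Real.rpow_le_rpow (by positivity) (hqn n hnq) hκ0.le)
      (by linarith)
  have hτ : (q.divisors.card : ℝ) ≤ t := hdiv q (NeZero.ne q)
  obtain ⟨E, hE0, hE1, hE2⟩ := exists_shift_bound χ (B := B) hr0' hAK hDD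
  set a : ℝ := (#{a ∈ Icc 1 A | a.Coprime q} : ℝ) with ha
  have haA : X / K ≤ 4 * t ^ 2 * a := by
    have h1 : (A : ℝ) ≤ 2 * (q.divisors.card : ℝ) ^ 2 * a := by
      rw [ha]; exact_mod_cast Nat.le_card_filter_coprime (NeZero.ne q) A
    have h2 : 2 * (q.divisors.card : ℝ) ^ 2 * a ≤ 2 * t ^ 2 * a := by gcongr
    linarith
  have ha0 : 0 < a := by
    have h1 : 0 < X / K := by positivity
    have h2 : 0 < 4 * t ^ 2 * a := by linarith
    exact (pos_iff_pos_of_mul_pos h2).1 (by positivity)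
  have hM := sum_norm_sum_shift_pow_le hq χ hχ hr0' B
  have hω : (((2 * r : ℕ) : ℝ)) ^ q.primeFactors.card ≤ t ^ (2 * r) := by
    calc (((2 * r : ℕ) : ℝ)) ^ q.primeFactors.card ≤ (q.divisors.card : ℝ) ^ (2 * r) := by
          exact_mod_cast Nat.pow_card_primeFactors_le (2 * r) q (NeZero.ne q)
      _ ≤ _ := by gcongr
  have hM2 : ∑ x : ZMod q, ‖∑ b ∈ Icc 1 B, χ (x + b)‖ ^ (2 * r) ≤
      c * t ^ (4 * r) * √Q * (B : ℝ) ^ (2 * r) := by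
    refine hM.trans ?_
    have e1 : (r : ℝ) ^ (2 * r) * B ^ r * q ≤
        r ^ (2 * r) * t ^ (4 * r) * √Q * (B : ℝ) ^ (2 * r) := by
      have h1 : (q : ℝ) = √Q * √Q := (Real.mul_self_sqrt hQ0.le).symm
      have h2 : 1 ≤ t ^ (4 * r) := one_le_pow₀ ht1
      calc (r : ℝ) ^ (2 * r) * B ^ r * q = r ^ (2 * r) * 1 * √Q * (B ^ r * √Q) := by
            rw [h1]; ring
        _ ≤ r ^ (2 * r) * t ^ (4 * r) * √Q * (B ^ r * B ^ r) := by gcongr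
        _ = _ := by rw [two_mul r, pow_add (B : ℝ)]
    have e2 : 2 * r * ((2 * r : ℕ) : ℝ) ^ q.primeFactors.card * √q *
        (B * (2 * B * q.divisors.card) ^ (2 * r - 1)) ≤
        2 * r * 2 ^ (2 * r) * t ^ (4 * r) * √Q * (B : ℝ) ^ (2 * r) := by
      have h1 : (2 * B * (q.divisors.card : ℝ)) ^ (2 * r - 1) * B ≤
          2 ^ (2 * r) * t ^ (2 * r) * B ^ (2 * r) := by
        calc (2 * B * (q.divisors.card : ℝ)) ^ (2 * r - 1) * B ≤
              (2 * B * t) ^ (2 * r - 1) * (2 * B * t) := by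
              gcongr
              nlinarith
          _ = (2 * B * t) ^ (2 * r) := by rw [← pow_succ]; congr 1; omega
          _ = _ := by rw [mul_pow, mul_pow]; ring
      calc _ = 2 * r * ((2 * r : ℕ) : ℝ) ^ q.primeFactors.card * √q *
            ((2 * B * (q.divisors.card : ℝ)) ^ (2 * r - 1) * B) := by ring
        _ ≤ 2 * r * t ^ (2 * r) * √Q * (2 ^ (2 * r) * t ^ (2 * r) * B ^ (2 * r)) := by gcongr
        _ = _ := by
          have : t ^ (4 * r) = t ^ (2 * r) * t ^ (2 * r) := by rw [← pow_add]; congr 1; ring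
          rw [this]; ring
    refine (add_le_add e1 e2).trans (le_of_eq ?_)
    rw [hc]; ring
  have hF : (E / (a * B)) ^ (2 * r) ≤ (c' * K * Q ^ (-(ε / (4 * r)))) ^ (2 * r) := by
    refine div_pow_le_of_pow_le (c := c) (C₁ := C₁) (κ := κ) hr0' ?_ hc0 hC₁ hc' ha0 hB0 hK0 hQ0 ?_ ?_
    · rw [hκ]; field_simp
    · refine hE2.trans ?_
      gcongr
    · rw [Real.sqrt_eq_rpow, ← Real.rpow_add hQ0]
      rw [div_le_iff₀ hK0] at haA
      linarith
  have hF' : E / (a * B) ≤ c' * K * Q ^ (-(ε / (4 * r))) :=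
    (pow_le_pow_iff_left₀ (by positivity) (by positivity) (by omega)).1 hF
  have hG : 2 * (A * B : ℝ) ≤ 4 * K * Q ^ (-(ε / (4 * r))) := by
    have g1 : (A : ℝ) ≤ K * Q ^ (-ε) := by
      refine hA1.trans ?_
      rw [div_le_iff₀ hK0, Real.rpow_neg hQ0.le]
      have : 0 < Q ^ ε := by positivity
      rw [← le_div_iff₀ this] at hXK
      refine hXK.trans (le_of_eq ?_)
      field_simp
    have g2 : (B : ℝ) ≤ 2 * Q ^ (ε / 2) := hB2.trans (by gcongr)
    calc 2 * (A * B : ℝ) ≤ 2 * ((K * Q ^ (-ε)) * (2 * Q ^ (ε / 2))) := by gcongr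
      _ = 4 * K * Q ^ (-ε + ε / 2) := by rw [Real.rpow_add hQ0]; ring
      _ ≤ 4 * K * Q ^ (-(ε / (4 * r))) := by
        have : ε / (4 * r) ≤ ε / 2 := by
          have : (1 : ℝ) ≤ r := by exact_mod_cast Nat.pos_of_ne_zero hr0'
          gcongr; linarith
        gcongr
        linarith
  have : ‖∑ n ∈ Icc 1 K, χ n‖ ≤ 2 * (A * B) + E / (a * B) := by
    rw [← sub_le_iff_le_add', le_div_iff₀ (by positivity)]
    linarith
  calc _ ≤ _ := this
    _ ≤ _ := add_le_add hG hF'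
    _ = _ := by ring

theorem sum_Icc_one_eq_sum_range {q : ℕ} (hq : 1 < q) (χ : DirichletCharacter ℂ q) (K : ℕ) :
    ∑ n ∈ Icc 1 K, χ n = ∑ n ∈ range (K + 1), χ n := by
  have : Fact (1 < q) := ⟨hq⟩
  rw [range_eq_Ico, sum_eq_sum_Ico_succ_bot (by omega : 0 < K + 1)]
  simp only [Nat.cast_zero, χ.map_zero, zero_add]
  rfl

theorem norm_sum_Icc_one_le {q : ℕ} [NeZero q] (χ : DirichletCharacter ℂ q) (K : ℕ) :
    ‖∑ n ∈ Icc 1 K, χ n‖ ≤ K := by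
  refine (norm_sum_le_of_le (f := fun n : ℕ => χ n) (Icc 1 K)
    fun n _ => χ.norm_le_one (n : ZMod q)).trans (le_of_eq ?_)
  simp

theorem sum_Icc_one_eq_sum_Icc_mod {q : ℕ} (hq : 1 < q) {χ : DirichletCharacter ℂ q}
    (hχ : χ ≠ 1) (K : ℕ) : ∑ n ∈ Icc 1 K, χ n = ∑ n ∈ Icc 1 (K % q), χ n := by
  have : NeZero q := ⟨by omega⟩
  have hper : ∀ N : ℕ, ∑ n ∈ range (q + N), χ n = ∑ n ∈ range N, χ n := by
    intro N
    rw [sum_range_add]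
    have h0 : ∑ n ∈ range q, χ (n : ZMod q) = 0 := by
      rw [← MulChar.sum_eq_zero_of_ne_one hχ]
      refine sum_bij (fun n _ => (n : ZMod q)) (by simp) ?_ ?_ (by simp)
      · intro a ha b hb h
        rw [mem_range] at ha hb
        exact Nat.ModEq.eq_of_lt_of_lt ((ZMod.natCast_eq_natCast_iff _ _ _).1 h) ha hb
      · intro x _
        exact ⟨x.val, mem_range.2 (ZMod.val_lt x), by simp⟩
    rw [h0, zero_add]
    simp
  have hper' : ∀ j N : ℕ, ∑ n ∈ range (q * j + N), χ n = ∑ n ∈ range N, χ n := by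
    intro j N
    induction j with
    | zero => simp
    | succ j ih => rw [← ih, ← hper (q * j + N)]; congr 2; ring
  rw [sum_Icc_one_eq_sum_range hq, sum_Icc_one_eq_sum_range hq,
    ← hper' (K / q) (K % q + 1), ← add_assoc, Nat.div_add_mod]

theorem NoProperPeriod.ne_one {q : ℕ} (hq : 1 < q) {χ : DirichletCharacter ℂ q}
    (hχ : NoProperPeriod χ) : χ ≠ 1 := by
  rintro rfl
  obtain ⟨n, hn, -, h⟩ := hχ 1 (one_dvd q) hq.ne
  apply h
  rw [MulChar.one_apply]
  exact (ZMod.coe_int_isUnit_iff_isCoprime _ _).2 hn.symm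

/-- Burgess' bound for characters without a proper period, to a cubefree modulus. -/
theorem exists_burgess_bound {ε : ℝ} (hε : 0 < ε) : ∃ δ : ℝ, 0 < δ ∧ ∃ C : ℝ, 0 < C ∧
    ∀ q : ℕ, 1 < q → (∀ p : ℕ, p.Prime → ¬ p ^ 3 ∣ q) → ∀ χ : DirichletCharacter ℂ q,
    NoProperPeriod χ → ∀ K : ℕ,
    ‖∑ n ∈ Icc 1 K, χ n‖ ≤ C * K * (q : ℝ) ^ (-δ) + (q : ℝ) ^ (1 / 4 + ε) := by
  wlog hε2 : ε ≤ 1 / 2 generalizing ε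
  · obtain ⟨δ, hδ, C, hC, h⟩ := this (ε := 1 / 2) (by norm_num) le_rfl
    refine ⟨δ, hδ, C, hC, fun q hq1 hq χ hχ K => (h q hq1 hq χ hχ K).trans ?_⟩
    have : (1 : ℝ) ≤ q := by exact_mod_cast hq1.le
    gcongr
    linarith
  obtain ⟨δ, hδ, C, hC, h⟩ := norm_sum_Icc_le_of_le_sq hε
  refine ⟨δ, hδ, C, hC, fun q hq1 hq χ hχ K => ?_⟩
  have : NeZero q := ⟨by omega⟩
  rw [sum_Icc_one_eq_sum_Icc_mod hq1 (hχ.ne_one hq1)]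
  set L := K % q with hL
  have hLK : L ≤ K := Nat.mod_le _ _
  have hLq : (L : ℝ) ≤ q := by exact_mod_cast (Nat.mod_lt K (by omega)).le
  have hQ1 : (1 : ℝ) ≤ q := by exact_mod_cast hq1.le
  have hQ0 : (0 : ℝ) < q := by linarith
  rcases lt_or_ge (L : ℝ) ((q : ℝ) ^ (1 / 4 + ε)) with h1 | h1
  · refine ((norm_sum_Icc_one_le χ L).trans h1.le).trans ?_
    have : 0 ≤ C * K * (q : ℝ) ^ (-δ) := by positivity
    linarith
  have hsq : (q : ℝ) ^ (1 / 2 + 2 * ε) ≤ (L : ℝ) ^ 2 := by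
    calc (q : ℝ) ^ (1 / 2 + 2 * ε) = ((q : ℝ) ^ (1 / 4 + ε)) ^ 2 := by
          rw [← Real.rpow_natCast, ← Real.rpow_mul hQ0.le]; congr 1; push_cast; ring
      _ ≤ _ := by gcongr
  have key : ‖∑ n ∈ Icc 1 L, χ n‖ ≤ C * L * (q : ℝ) ^ (-δ) := by
    rcases le_or_gt (L : ℝ) ((q : ℝ) ^ (1 / 2 + ε)) with h2 | h2
    · refine h q hq χ hχ L ((q : ℝ) ^ (1 / 2 + ε)) le_rfl ?_ h2 ?_
      · calc (q : ℝ) ^ (1 / 2 + ε) ≤ (q : ℝ) ^ (1 : ℝ) :=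
              Real.rpow_le_rpow_of_exponent_le hQ1 (by linarith)
          _ = q := Real.rpow_one _
      · rw [← Real.rpow_add hQ0]
        refine le_trans (le_of_eq ?_) hsq
        ring_nf
    · refine h q hq χ hχ L q ?_ le_rfl hLq ?_
      · calc (q : ℝ) ^ (1 / 2 + ε) ≤ (q : ℝ) ^ (1 : ℝ) :=
              Real.rpow_le_rpow_of_exponent_le hQ1 (by linarith)
          _ = q := Real.rpow_one _
      · calc (q : ℝ) * (q : ℝ) ^ ε = (q : ℝ) ^ (1 + ε) := by
              rw [Real.rpow_add hQ0, Real.rpow_one]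
          _ ≤ (q : ℝ) ^ (2 * (1 / 2 + ε)) :=
              Real.rpow_le_rpow_of_exponent_le hQ1 (by linarith)
          _ = ((q : ℝ) ^ (1 / 2 + ε)) ^ 2 := by
              rw [← Real.rpow_natCast, ← Real.rpow_mul hQ0.le]; congr 1; push_cast; ring
          _ ≤ _ := by gcongr
  refine key.trans ?_
  have h3 : C * L * (q : ℝ) ^ (-δ) ≤ C * K * (q : ℝ) ^ (-δ) := by gcongr
  have h4 : 0 ≤ (q : ℝ) ^ (1 / 4 + ε) := by positivity
  linarith

end Burgess

section CharSums

open Finset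

theorem exists_nat_forall_le_rpow (C : ℝ) {η : ℝ} (hη : 0 < η) :
    ∃ M : ℕ, ∀ m : ℕ, M ≤ m → C ≤ (m : ℝ) ^ η := by
  have h := ((tendsto_rpow_atTop hη).comp tendsto_natCast_atTop_atTop).eventually_ge_atTop C
  exact Filter.eventually_atTop.1 h

/-- The number of divisors is eventually at most any fixed positive power. -/
theorem Nat.exists_forall_card_divisors_le_rpow (C : ℝ) {η : ℝ} (hη : 0 < η) :
    ∃ M : ℕ, 1 ≤ M ∧ ∀ m : ℕ, M ≤ m → C * (m.divisors.card : ℝ) ≤ (m : ℝ) ^ η := by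
  obtain ⟨C₁, hC₁, h⟩ := Nat.card_divisors_le_mul_rpow (half_pos hη)
  obtain ⟨M, hM⟩ := exists_nat_forall_le_rpow (|C| * C₁) (half_pos hη)
  refine ⟨max M 1, le_max_right _ _, fun m hm => ?_⟩
  have hm0 : 0 < m := lt_of_lt_of_le one_pos ((le_max_right _ _).trans hm)
  have hm0' : (0 : ℝ) < m := by exact_mod_cast hm0
  calc C * (m.divisors.card : ℝ) ≤ |C| * (C₁ * (m : ℝ) ^ (η / 2)) :=
        mul_le_mul (le_abs_self C) (h m hm0.ne') (by positivity) (abs_nonneg C)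
    _ = |C| * C₁ * (m : ℝ) ^ (η / 2) := by ring
    _ ≤ (m : ℝ) ^ (η / 2) * (m : ℝ) ^ (η / 2) := by
        gcongr; exact hM m ((le_max_left _ _).trans hm)
    _ = (m : ℝ) ^ η := by rw [← Real.rpow_add hm0']; ring_nf

theorem DirichletCharacter.IsPrimitive.noProperPeriod {q : ℕ} [NeZero q]
    {χ : DirichletCharacter ℂ q} (hχ : χ.IsPrimitive) : NoProperPeriod χ := by
  intro d hd hdq
  by_contra! hcon
  have hf : χ.FactorsThrough d := by
    rw [DirichletCharacter.factorsThrough_iff_ker_unitsMap hd]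
    intro u hu
    rw [MonoidHom.mem_ker] at hu ⊢
    have hcast : (((u : ZMod q).val : ℤ) : ZMod q) = u := by simp
    have h1 := hcon ((u : ZMod q).val : ℤ) ?_ ?_
    · rw [hcast] at h1
      ext; simpa using h1
    · rw [Nat.isCoprime_iff_coprime]
      exact ZMod.val_coe_unit_coprime u
    · rw [← ZMod.intCast_zmod_eq_zero_iff_dvd]
      have h2 := congrArg Units.val hu
      rw [ZMod.unitsMap_val, Units.val_one, ZMod.cast_eq_val] at h2
      push_cast
      rw [h2, sub_self]
  have := Nat.sInf_le ((DirichletCharacter.mem_conductorSet_iff χ).2 hf)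
  have h3 : χ.conductor = q := hχ
  rw [DirichletCharacter.conductor] at h3
  rw [h3] at this
  exact hdq (le_antisymm (Nat.le_of_dvd (NeZero.pos q) hd) this)

theorem norm_sum_Icc_le_of_conductor {m : ℕ} [NeZero m] (χ : DirichletCharacter ℂ m) (N : ℕ) {U : ℝ}
    (hU : ∀ K ≤ N, ‖∑ n ∈ Icc 1 K, χ.primitiveCharacter n‖ ≤ U) :
    ‖∑ n ∈ Icc 1 N, χ n‖ ≤ m.divisors.card * U := by
  have h1 : ∑ n ∈ Icc 1 N, χ n =
      ∑ n ∈ Icc 1 N with n.Coprime m, χ.primitiveCharacter n := by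
    rw [sum_filter]
    refine sum_congr rfl fun n _ => ?_
    split_ifs with h
    · have := χ.primitiveCharacter_apply_of_isCoprime (Nat.isCoprime_iff_coprime.2 h)
      simpa using this.symm
    · exact χ.map_nonunit fun hu => h ((ZMod.isUnit_iff_coprime n m).1 hu)
  rw [h1, sum_filter_coprime_eq_sum_divisors (NeZero.ne m)]
  refine (norm_sum_le_of_le (f := fun d : ℕ => _) m.divisors (n := fun _ => U) ?_).trans (by simp)
  intro d _
  have h2 : ∑ k ∈ Icc 1 (N / d), χ.primitiveCharacter ((d * k : ℕ) : ZMod χ.conductor) =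
      χ.primitiveCharacter d * ∑ k ∈ Icc 1 (N / d), χ.primitiveCharacter k := by
    rw [mul_sum]; exact sum_congr rfl fun k _ => by rw [Nat.cast_mul, map_mul]
  rw [h2, norm_mul, norm_mul]
  have h3 : ‖((ArithmeticFunction.moebius d : ℤ) : ℂ)‖ ≤ 1 := by
    rw [Complex.norm_intCast]
    exact_mod_cast ArithmeticFunction.abs_moebius_le_one
  have h4 := hU (N / d) (Nat.div_le_self _ _)
  calc _ ≤ 1 * (1 * U) := by
        gcongr
        exact DirichletCharacter.norm_le_one _ _
    _ = U := by ring

/-- Burgess' bound for all nontrivial characters to a large cubefree modulus. -/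
theorem exists_norm_sum_Icc_le {ε : ℝ} (hε : 0 < ε) : ∃ δ : ℝ, 0 < δ ∧ ∃ M : ℕ, ∀ m : ℕ,
    M ≤ m → (∀ p : ℕ, p.Prime → ¬ p ^ 3 ∣ m) → ∀ χ : DirichletCharacter ℂ m, χ ≠ 1 →
    ∀ N : ℕ, (m : ℝ) ^ (1 / 4 + ε) ≤ N → ‖∑ n ∈ Icc 1 N, χ n‖ ≤ N * (m : ℝ) ^ (-δ) := by
  obtain ⟨δ, hδ, C, hC, h⟩ := exists_burgess_bound (half_pos hε)
  set η : ℝ := min (δ / 8) (min (ε / 2) (1 / 8)) with hη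
  have hη0 : 0 < η := by positivity
  have hη1 : η ≤ δ / 8 := min_le_left _ _
  have hη2 : η ≤ ε / 2 := (min_le_right _ _).trans (min_le_left _ _)
  have hη3 : η ≤ 1 / 8 := (min_le_right _ _).trans (min_le_right _ _)
  obtain ⟨M, hM1, hM⟩ := Nat.exists_forall_card_divisors_le_rpow (C + 1) (half_pos hη0)
  refine ⟨η / 2, half_pos hη0, M, fun m hm hcf χ hχ N hN => ?_⟩
  have hm0 : 0 < m := lt_of_lt_of_le hM1 hm
  have : NeZero m := ⟨hm0.ne'⟩
  have hm1 : (1 : ℝ) ≤ m := by exact_mod_cast hm0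
  have hm0' : (0 : ℝ) < m := by linarith
  have hqm := χ.conductor_dvd_level
  have hq0 := χ.conductor_ne_zero
  have hq1 : 1 < χ.conductor := by
    have := mt DirichletCharacter.eq_one_iff_conductor_eq_one.2 hχ
    omega
  have : NeZero χ.conductor := ⟨hq0⟩
  have hNP := χ.primitiveCharacter_isPrimitive.noProperPeriod
  have hqm' : (χ.conductor : ℝ) ≤ m := by exact_mod_cast Nat.le_of_dvd hm0 hqm
  have hq1' : (1 : ℝ) ≤ χ.conductor := by exact_mod_cast hq1.le
  have hfin : ‖∑ n ∈ Icc 1 N, χ n‖ ≤ m.divisors.card * ((C + 1) * (N * (m : ℝ) ^ (-η))) := by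
    refine norm_sum_Icc_le_of_conductor χ N fun K hK => ?_
    have hKN : (K : ℝ) ≤ N := by exact_mod_cast hK
    have hNη : 0 ≤ N * (m : ℝ) ^ (-η) := by positivity
    rcases le_or_gt (χ.conductor : ℝ) ((m : ℝ) ^ (1 / 8 : ℝ)) with h1 | h1
    · rw [sum_Icc_one_eq_sum_Icc_mod hq1 (hNP.ne_one hq1)]
      refine (norm_sum_Icc_one_le _ _).trans ?_
      have h2 : ((K % χ.conductor : ℕ) : ℝ) ≤ χ.conductor := by
        exact_mod_cast (Nat.mod_lt _ (by omega)).le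
      calc _ ≤ _ := h2.trans h1
        _ ≤ (m : ℝ) ^ (1 / 4 + ε + -η) := Real.rpow_le_rpow_of_exponent_le hm1 (by linarith)
        _ = (m : ℝ) ^ (1 / 4 + ε) * (m : ℝ) ^ (-η) := Real.rpow_add hm0' _ _
        _ ≤ N * (m : ℝ) ^ (-η) := by gcongr
        _ ≤ _ := by nlinarith
    · refine (h _ hq1 (fun p hp hd => hcf p hp (hd.trans hqm)) _ hNP K).trans ?_
      have e1 : (χ.conductor : ℝ) ^ (-δ) ≤ (m : ℝ) ^ (-η) := by
        calc (χ.conductor : ℝ) ^ (-δ) ≤ ((m : ℝ) ^ (1 / 8 : ℝ)) ^ (-δ) :=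
              Real.rpow_le_rpow_of_nonpos (by positivity) h1.le (by linarith)
          _ = (m : ℝ) ^ (1 / 8 * -δ) := by rw [← Real.rpow_mul hm0'.le]
          _ ≤ _ := Real.rpow_le_rpow_of_exponent_le hm1 (by linarith)
      have e2 : (χ.conductor : ℝ) ^ (1 / 4 + ε / 2) ≤ N * (m : ℝ) ^ (-η) := by
        calc (χ.conductor : ℝ) ^ (1 / 4 + ε / 2) ≤ (m : ℝ) ^ (1 / 4 + ε / 2) := by gcongr
          _ ≤ (m : ℝ) ^ (1 / 4 + ε + -η) := Real.rpow_le_rpow_of_exponent_le hm1 (by linarith)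
          _ = (m : ℝ) ^ (1 / 4 + ε) * (m : ℝ) ^ (-η) := Real.rpow_add hm0' _ _
          _ ≤ _ := by gcongr
      calc _ ≤ C * N * (m : ℝ) ^ (-η) + N * (m : ℝ) ^ (-η) := by gcongr
        _ = _ := by ring
  calc _ ≤ _ := hfin
    _ = (C + 1) * m.divisors.card * (N * (m : ℝ) ^ (-η)) := by ring
    _ ≤ (m : ℝ) ^ (η / 2) * (N * (m : ℝ) ^ (-η)) := by gcongr; exact hM m hm
    _ = N * ((m : ℝ) ^ (η / 2) * (m : ℝ) ^ (-η)) := by ring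
    _ = _ := by rw [← Real.rpow_add hm0']; ring_nf

end CharSums

section MeanValues

open Finset

variable {m : ℕ}

theorem DirichletCharacter.sum_norm_sq_eq [NeZero m] (g : ZMod m → ℂ) :
    ∑ χ : DirichletCharacter ℂ m, ‖∑ x, g x * χ x‖ ^ 2 =
      m.totient * ∑ x with IsUnit x, ‖g x‖ ^ 2 := by
  classical
  have key : ∑ χ : DirichletCharacter ℂ m, ((‖∑ x, g x * χ x‖ ^ 2 : ℝ) : ℂ) =
      m.totient * ∑ x with IsUnit x, ((‖g x‖ ^ 2 : ℝ) : ℂ) := by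
    have h1 : ∀ χ : DirichletCharacter ℂ m, ((‖∑ x, g x * χ x‖ ^ 2 : ℝ) : ℂ) =
        ∑ y with IsUnit y, ∑ x, star (g y) * g x * (χ y⁻¹ * χ x) := by
      intro χ
      rw [← Complex.normSq_eq_norm_sq, Complex.normSq_eq_conj_mul_self, map_sum, sum_mul_sum,
        sum_filter]
      refine sum_congr rfl fun y _ => ?_
      split_ifs with hy
      · refine sum_congr rfl fun x _ => ?_
        have h2 : star (χ y) = χ y⁻¹ := by
          obtain ⟨u, rfl⟩ := hy
          rw [MulChar.star_apply', MulChar.inv_apply, Ring.inverse_unit, ZMod.inv_coe_unit]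
        rw [map_mul, ← h2]
        simp only [RCLike.star_def]; ring
      · simp [χ.map_nonunit hy]
    rw [sum_congr rfl fun χ _ => h1 χ, sum_comm, mul_sum]
    refine sum_congr rfl fun y hy => ?_
    rw [sum_comm]
    have hy' := (mem_filter.1 hy).2
    simp only [← mul_sum, DirichletCharacter.sum_char_inv_mul_char_eq ℂ hy']
    simp only [mul_ite, mul_zero, sum_ite_eq, mem_univ, if_true]
    rw [← Complex.normSq_eq_norm_sq, Complex.normSq_eq_conj_mul_self]
    simp only [RCLike.star_def]; ring
  exact_mod_cast key

variable {α : Type*} (P : Finset α) (f : α → ZMod m)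

theorem sum_comp_eq_sum_card_fiber_mul [NeZero m] (χ : DirichletCharacter ℂ m) :
    ∑ p ∈ P, χ (f p) = ∑ x, (#{p ∈ P | f p = x} : ℂ) * χ x := by
  rw [← sum_fiberwise P f]
  refine sum_congr rfl fun x _ => ?_
  rw [sum_congr rfl fun p hp => by rw [(mem_filter.1 hp).2], sum_const, nsmul_eq_mul]

theorem DirichletCharacter.sum_norm_sum_sq_le [NeZero m] {D : ℝ}
    (hD : ∀ x, (#{p ∈ P | f p = x} : ℝ) ≤ D) :
    ∑ χ : DirichletCharacter ℂ m, ‖∑ p ∈ P, χ (f p)‖ ^ 2 ≤ m.totient * (D * #P) := by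
  classical
  simp only [sum_comp_eq_sum_card_fiber_mul, DirichletCharacter.sum_norm_sq_eq]
  gcongr
  calc _ ≤ ∑ x : ZMod m, ‖((#{p ∈ P | f p = x} : ℕ) : ℂ)‖ ^ 2 :=
        sum_le_sum_of_subset_of_nonneg (filter_subset _ _) (fun _ _ _ => by positivity)
    _ ≤ ∑ x : ZMod m, D * #{p ∈ P | f p = x} := by
        refine sum_le_sum fun x _ => ?_
        rw [Complex.norm_natCast, pow_two]
        gcongr
        exact hD x
    _ = _ := by
        rw [← mul_sum, ← Nat.cast_sum, ← card_eq_sum_card_fiberwise (by simp)]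

theorem card_units_not_mem_image_mul_sq_le [NeZero m] :
    (#{x : ZMod m | IsUnit x ∧ ∀ p ∈ P, f p ≠ x} : ℝ) * (#{p ∈ P | IsUnit (f p)} : ℝ) ^ 2 ≤
      m.totient * ∑ χ : DirichletCharacter ℂ m with χ ≠ 1, ‖∑ p ∈ P, χ (f p)‖ ^ 2 := by
  classical
  set W : ℝ := ((#{p ∈ P | IsUnit (f p)} : ℕ) : ℝ) with hW
  have hφ : (0 : ℝ) < m.totient := by exact_mod_cast Nat.totient_pos.2 (NeZero.pos m)
  set g : ZMod m → ℂ := fun x => (#{p ∈ P | f p = x} : ℂ) - (W / m.totient : ℝ) with hg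
  have h1 : ∀ χ : DirichletCharacter ℂ m, χ ≠ 1 → ∑ x, g x * χ x = ∑ p ∈ P, χ (f p) := by
    intro χ hχ
    simp only [hg, sub_mul, sum_sub_distrib, ← mul_sum, MulChar.sum_eq_zero_of_ne_one hχ, mul_zero,
      sub_zero, sum_comp_eq_sum_card_fiber_mul]
  have h2 := DirichletCharacter.sum_norm_sq_eq g
  have h3 : ∑ x, g x * (1 : DirichletCharacter ℂ m) x = 0 := by
    simp only [hg, sub_mul, sum_sub_distrib, ← mul_sum, ← sum_comp_eq_sum_card_fiber_mul]
    have e1 : ∑ p ∈ P, (1 : DirichletCharacter ℂ m) (f p) = (W : ℂ) := by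
      have e3 : ∀ y : ZMod m, (1 : DirichletCharacter ℂ m) y = if IsUnit y then 1 else 0 := by
        intro y
        split_ifs with hy
        · exact MulChar.one_apply hy
        · exact MulChar.map_nonunit _ hy
      simp only [e3, hW, sum_boole, Complex.ofReal_natCast]
    have e2 : ∑ x, (1 : DirichletCharacter ℂ m) x = (m.totient : ℂ) := by
      rw [MulChar.sum_one_eq_card_units, ZMod.card_units_eq_totient]
    rw [e1, e2]
    push_cast
    have : (m.totient : ℂ) ≠ 0 := by exact_mod_cast hφ.ne'
    field_simp; ring
  have h4 : ∑ χ : DirichletCharacter ℂ m with χ ≠ 1, ‖∑ p ∈ P, χ (f p)‖ ^ 2 =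
      m.totient * ∑ x with IsUnit x, ‖g x‖ ^ 2 := by
    rw [← h2, ← sum_filter_add_sum_filter_not univ (fun χ : DirichletCharacter ℂ m => χ ≠ 1)]
    have e1 : ∑ χ : DirichletCharacter ℂ m with ¬ χ ≠ 1, ‖∑ x, g x * χ x‖ ^ 2 = 0 := by
      refine sum_eq_zero fun χ hχ => ?_
      have : χ = 1 := by simpa using (mem_filter.1 hχ).2
      rw [this, h3]; simp
    rw [e1, add_zero]
    exact sum_congr rfl fun χ hχ => by rw [h1 χ (mem_filter.1 hχ).2]
  have h5 : (#{x : ZMod m | IsUnit x ∧ ∀ p ∈ P, f p ≠ x} : ℝ) * (W / m.totient) ^ 2 ≤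
      ∑ x with IsUnit x, ‖g x‖ ^ 2 := by
    calc _ = ∑ x : ZMod m with (IsUnit x ∧ ∀ p ∈ P, f p ≠ x), (W / m.totient) ^ 2 := by
          rw [sum_const, nsmul_eq_mul]
      _ = ∑ x : ZMod m with (IsUnit x ∧ ∀ p ∈ P, f p ≠ x), ‖g x‖ ^ 2 := by
          refine sum_congr rfl fun x hx => ?_
          have : {p ∈ P | f p = x} = ∅ := filter_eq_empty_iff.2 (mem_filter.1 hx).2.2
          simp only [hg, this, card_empty, Nat.cast_zero, zero_sub, norm_neg, Complex.norm_real,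
            Real.norm_eq_abs, sq_abs]
      _ ≤ _ := sum_le_sum_of_subset_of_nonneg
          (fun x hx => mem_filter.2 ⟨mem_univ _, (mem_filter.1 hx).2.1⟩)
          (fun _ _ _ => by positivity)
  rw [h4]
  calc _ = (m.totient : ℝ) * (m.totient * ((#{x : ZMod m | IsUnit x ∧ ∀ p ∈ P, f p ≠ x} : ℝ) *
        (W / m.totient) ^ 2)) := by field_simp
    _ ≤ _ := by gcongr

variable {ι : Type*} [Fintype ι] [DecidableEq ι] (N : ι → ℕ)

theorem prod_sum_Icc_eq_sum_piFinset (χ : DirichletCharacter ℂ m) :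
    ∏ i, ∑ n ∈ Icc 1 (N i), χ n =
      ∑ p ∈ Fintype.piFinset (fun i => Icc 1 (N i)), χ ((∏ i, p i : ℕ) : ZMod m) := by
  rw [prod_univ_sum]
  exact sum_congr rfl fun p _ => by rw [Nat.cast_prod, map_prod]

theorem card_piFinset_prod_eq_le {t : ℝ} (ht : 1 ≤ t)
    (hdiv : ∀ n, n ≠ 0 → n ≤ ∏ i, N i → (n.divisors.card : ℝ) ≤ t) (x : ZMod m) :
    (#{p ∈ Fintype.piFinset (fun i => Icc 1 (N i)) | ((∏ i, p i : ℕ) : ZMod m) = x} : ℝ) ≤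
      ((∏ i, N i : ℕ) / m + 1) * t ^ Fintype.card ι := by
  set L := ∏ i, N i with hL
  set S := {p ∈ Fintype.piFinset (fun i => Icc 1 (N i)) | ((∏ i, p i : ℕ) : ZMod m) = x} with hS
  set R := {n ∈ Icc 1 L | ((n : ℕ) : ZMod m) = x} with hR
  have hmaps : ∀ p ∈ S, ∏ i, p i ∈ R := by
    intro p hp
    obtain ⟨h1, h2⟩ := mem_filter.1 hp
    rw [Fintype.mem_piFinset] at h1
    refine mem_filter.2 ⟨mem_Icc.2 ⟨?_, ?_⟩, h2⟩
    · exact Nat.pos_of_ne_zero (prod_ne_zero_iff.2 fun i _ => by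
        have := (mem_Icc.1 (h1 i)).1; omega)
    · exact prod_le_prod' fun i _ => (mem_Icc.1 (h1 i)).2
  have hfib : ∀ n ∈ R, (#{p ∈ S | ∏ i, p i = n} : ℝ) ≤ t ^ Fintype.card ι := by
    intro n hn
    have hn1 := mem_Icc.1 (mem_filter.1 hn).1
    have hn0 : n ≠ 0 := by omega
    have h1 : #{p ∈ S | ∏ i, p i = n} ≤ #(Fintype.piFinset fun _ : ι => n.divisors) := by
      refine card_le_card fun p hp => ?_
      rw [Fintype.mem_piFinset]
      intro i
      refine Nat.mem_divisors.2 ⟨?_, hn0⟩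
      rw [← (mem_filter.1 hp).2]
      exact dvd_prod_of_mem _ (mem_univ i)
    rw [Fintype.card_piFinset, prod_const, Finset.card_univ] at h1
    calc (#{p ∈ S | ∏ i, p i = n} : ℝ) ≤ (n.divisors.card : ℝ) ^ Fintype.card ι := by
          exact_mod_cast h1
      _ ≤ _ := by gcongr; exact hdiv n hn0 hn1.2
  have hRc : (#R : ℝ) ≤ L / m + 1 := by
    have h1 : #R ≤ L / m + 1 := by
      rw [← card_range (L / m + 1)]
      refine card_le_card_of_injOn (fun n => n / m) (fun n hn => ?_) fun n hn n' hn' h => ?_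
      · have := mem_Icc.1 (mem_filter.1 hn).1
        exact mem_coe.2 (mem_range.2 (Nat.lt_succ_of_le (Nat.div_le_div_right this.2)))
      · have h3 : n % m = n' % m := by
          rw [← Nat.ModEq, ← ZMod.natCast_eq_natCast_iff, (mem_filter.1 hn).2, (mem_filter.1 hn').2]
        rw [← Nat.div_add_mod n m, ← Nat.div_add_mod n' m, h3]
        exact congrArg (fun z => m * z + n' % m) h
    have h2 : ((L / m : ℕ) : ℝ) ≤ L / m := Nat.cast_div_le
    have h3 : (#R : ℝ) ≤ (L / m : ℕ) + 1 := by exact_mod_cast h1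
    linarith
  have h1 : (#S : ℝ) = ∑ n ∈ R, (#{p ∈ S | ∏ i, p i = n} : ℝ) := by
    exact_mod_cast card_eq_sum_card_fiberwise hmaps
  rw [h1]
  calc _ ≤ ∑ n ∈ R, t ^ Fintype.card ι := sum_le_sum hfib
    _ = #R * t ^ Fintype.card ι := by rw [sum_const, nsmul_eq_mul]
    _ ≤ _ := by gcongr

theorem sum_norm_prod_sum_Icc_sq_le [NeZero m] {t : ℝ} (ht : 1 ≤ t)
    (hdiv : ∀ n, n ≠ 0 → n ≤ ∏ i, N i → (n.divisors.card : ℝ) ≤ t) (hm : m ≤ ∏ i, N i) :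
    ∑ χ : DirichletCharacter ℂ m, ‖∏ i, ∑ n ∈ Icc 1 (N i), χ n‖ ^ 2 ≤
      2 * t ^ Fintype.card ι * ((∏ i, N i : ℕ) : ℝ) ^ 2 := by
  simp only [prod_sum_Icc_eq_sum_piFinset]
  refine (DirichletCharacter.sum_norm_sum_sq_le _ _ (card_piFinset_prod_eq_le N ht hdiv)).trans ?_
  set L := ∏ i, N i with hL
  have hm0 : (0 : ℝ) < m := by exact_mod_cast NeZero.pos m
  have hφ : (m.totient : ℝ) ≤ m := by exact_mod_cast Nat.totient_le m
  have hc : #(Fintype.piFinset fun i => Icc 1 (N i)) = L := by simp [hL]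
  have h1 : (1 : ℝ) ≤ (L : ℝ) / m := by
    rw [le_div_iff₀ hm0, one_mul]; exact_mod_cast hm
  rw [hc]
  calc (m.totient : ℝ) * (((L : ℝ) / m + 1) * t ^ Fintype.card ι * L) ≤
        m * (((L : ℝ) / m + L / m) * t ^ Fintype.card ι * L) := by gcongr
    _ = _ := by field_simp; ring

end MeanValues

section MissingUnits

open Finset

variable {m : ℕ} [NeZero m] {ι : Type*} [Fintype ι] [DecidableEq ι] (N : ι → ℕ)

theorem prod_le_mul_card_filter_isUnit {D : ℝ} (hD : 2 * (m.divisors.card : ℝ) ^ 2 ≤ D) :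
    ((∏ i, N i : ℕ) : ℝ) ≤ D ^ Fintype.card ι *
      (#{p ∈ Fintype.piFinset (fun i => Icc 1 (N i)) | IsUnit ((∏ i, p i : ℕ) : ZMod m)} : ℝ) := by
  have h1 : {p ∈ Fintype.piFinset (fun i => Icc 1 (N i)) | IsUnit ((∏ i, p i : ℕ) : ZMod m)} =
      Fintype.piFinset (fun i => {n ∈ Icc 1 (N i) | n.Coprime m}) := by
    ext p
    simp only [mem_filter, Fintype.mem_piFinset, ZMod.isUnit_iff_coprime,
      Nat.coprime_prod_left_iff, mem_univ, true_imp_iff]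
    exact ⟨fun h i => ⟨h.1 i, h.2 i⟩, fun h => ⟨fun i => (h i).1, fun i => (h i).2⟩⟩
  rw [h1, Fintype.card_piFinset, ← Finset.card_univ, ← prod_const, Nat.cast_prod, Nat.cast_prod,
    ← prod_mul_distrib]
  refine prod_le_prod (fun _ _ => by positivity) fun i _ => ?_
  refine le_trans (b := 2 * (m.divisors.card : ℝ) ^ 2 * (#{n ∈ Icc 1 (N i) | n.Coprime m} : ℝ))
    ?_ (by gcongr)
  exact_mod_cast Nat.le_card_filter_coprime (NeZero.ne m) (N i)

/-- A second-moment bound over characters for the number of units outside of a product set,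
splitting the characters according to the size of the sum over the auxiliary variable `q ≤ Q`. -/
theorem card_units_not_mem_prod_le {t g b : ℝ} (ht : 1 ≤ t) (hg : 0 < g)
    {Q : ℕ} (hQ : 0 < Q) (k : ℕ) (hN : ∀ i, 0 < N i)
    (hdm : (m.divisors.card : ℝ) ≤ t)
    (hdL : ∀ n, n ≠ 0 → n ≤ ∏ i, N i → (n.divisors.card : ℝ) ≤ t)
    (hdQ : ∀ n, n ≠ 0 → n ≤ Q ^ k → (n.divisors.card : ℝ) ≤ t)
    (hmL : m ≤ ∏ i, N i) (hmQ : m ≤ Q ^ k)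
    (hS : ∀ χ : DirichletCharacter ℂ m, χ ≠ 1 →
      ‖∏ i, ∑ n ∈ Icc 1 (N i), χ n‖ ≤ ((∏ i, N i : ℕ) : ℝ) * b) :
    (#{x : ZMod m | IsUnit x ∧ ∀ p ∈ Fintype.piFinset (fun i => Icc 1 (N i)) ×ˢ Icc 1 Q,
        (((∏ i, p.1 i) * p.2 : ℕ) : ZMod m) ≠ x} : ℝ) ≤
      m * ((2 * t ^ 2) ^ (Fintype.card ι + 1)) ^ 2 *
        (2 * t ^ Fintype.card ι * g ^ 2 + 2 * t ^ k * b ^ 2 / g ^ (2 * k)) := by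
  classical
  set c := Fintype.card ι with hc
  have hL0 : (0 : ℝ) < ((∏ i, N i : ℕ) : ℝ) := by
    exact_mod_cast prod_pos fun i _ => hN i
  have hmom := sum_norm_prod_sum_Icc_sq_le (m := m) N ht hdL hmL
  have hQ' : (∏ _i : Fin k, Q) = Q ^ k := by simp
  have hmomQ := sum_norm_prod_sum_Icc_sq_le (m := m) (fun _ : Fin k => Q) ht
    (by rw [hQ']; exact hdQ) (by rw [hQ']; exact hmQ)
  rw [hQ'] at hmomQ
  simp only [prod_const, Finset.card_univ, Fintype.card_fin] at hmomQ
  have hQ0 : (0 : ℝ) < (Q : ℝ) := by exact_mod_cast hQ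
  have hD : 2 * (m.divisors.card : ℝ) ^ 2 ≤ 2 * t ^ 2 := by gcongr
  have hWL := prod_le_mul_card_filter_isUnit (m := m) N hD
  have hWQ : (Q : ℝ) ≤ 2 * t ^ 2 * (#{n ∈ Icc 1 Q | n.Coprime m} : ℝ) := by
    refine le_trans (b := 2 * (m.divisors.card : ℝ) ^ 2 * (#{n ∈ Icc 1 Q | n.Coprime m} : ℝ))
      ?_ (by gcongr)
    exact_mod_cast Nat.le_card_filter_coprime (NeZero.ne m) Q
  set L : ℝ := ((∏ i, N i : ℕ) : ℝ) with hL
  set P := Fintype.piFinset (fun i => Icc 1 (N i)) ×ˢ Icc 1 Q with hP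
  set f : (ι → ℕ) × ℕ → ZMod m := fun p => (((∏ i, p.1 i) * p.2 : ℕ) : ZMod m) with hf
  have hmain := card_units_not_mem_image_mul_sq_le P f
  have hunit : #{p ∈ P | IsUnit (f p)} =
      #{p ∈ Fintype.piFinset (fun i => Icc 1 (N i)) | IsUnit ((∏ i, p i : ℕ) : ZMod m)} *
        #{n ∈ Icc 1 Q | n.Coprime m} := by
    rw [← card_product]
    congr 1
    ext p
    simp only [hP, hf, mem_filter, mem_product, Nat.cast_mul, IsUnit.mul_iff]
    rw [ZMod.isUnit_iff_coprime p.2 m]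
    tauto
  have hsum : ∀ χ : DirichletCharacter ℂ m, ∑ p ∈ P, χ (f p) =
      (∏ i, ∑ n ∈ Icc 1 (N i), χ n) * ∑ q ∈ Icc 1 Q, χ q := by
    intro χ
    rw [prod_sum_Icc_eq_sum_piFinset, sum_mul_sum, hP, sum_product]
    refine sum_congr rfl fun p _ => sum_congr rfl fun q _ => ?_
    simp only [hf, Nat.cast_mul, map_mul]
  have hpt : ∀ χ : DirichletCharacter ℂ m, χ ≠ 1 → ‖∑ p ∈ P, χ (f p)‖ ^ 2 ≤
      (g * Q) ^ 2 * ‖∏ i, ∑ n ∈ Icc 1 (N i), χ n‖ ^ 2 +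
        (L * b * Q) ^ 2 / (g * Q) ^ (2 * k) * ‖(∑ q ∈ Icc 1 Q, χ q) ^ k‖ ^ 2 := by
    intro χ hχ
    rw [hsum, norm_mul, mul_pow, norm_pow, ← pow_mul, mul_comm k 2]
    have hgQ : 0 < g * Q := by positivity
    rcases le_total ‖∑ q ∈ Icc 1 Q, χ q‖ (g * Q) with h | h
    · refine le_add_of_le_of_nonneg ?_ (by positivity)
      rw [mul_comm]; gcongr
    · refine le_add_of_nonneg_of_le (by positivity) ?_
      have h1 : (1 : ℝ) ≤ ‖∑ q ∈ Icc 1 Q, χ q‖ ^ (2 * k) / (g * Q) ^ (2 * k) := by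
        rw [one_le_div (by positivity)]; gcongr
      calc _ ≤ (L * b) ^ 2 * (Q : ℝ) ^ 2 := by
            gcongr
            · exact hS χ hχ
            · exact norm_sum_Icc_one_le χ Q
        _ = (L * b * Q) ^ 2 * 1 := by ring
        _ ≤ (L * b * Q) ^ 2 * (‖∑ q ∈ Icc 1 Q, χ q‖ ^ (2 * k) / (g * Q) ^ (2 * k)) := by gcongr
        _ = _ := by ring
  have htot : ∑ χ : DirichletCharacter ℂ m with χ ≠ 1, ‖∑ p ∈ P, χ (f p)‖ ^ 2 ≤
      (L * Q) ^ 2 * (2 * t ^ c * g ^ 2 + 2 * t ^ k * b ^ 2 / g ^ (2 * k)) := by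
    calc _ ≤ ∑ χ : DirichletCharacter ℂ m with χ ≠ 1,
          ((g * Q) ^ 2 * ‖∏ i, ∑ n ∈ Icc 1 (N i), χ n‖ ^ 2 +
          (L * b * Q) ^ 2 / (g * Q) ^ (2 * k) * ‖(∑ q ∈ Icc 1 Q, χ q) ^ k‖ ^ 2) :=
          sum_le_sum fun χ hχ => hpt χ (mem_filter.1 hχ).2
      _ ≤ ∑ χ : DirichletCharacter ℂ m,
          ((g * Q) ^ 2 * ‖∏ i, ∑ n ∈ Icc 1 (N i), χ n‖ ^ 2 +
          (L * b * Q) ^ 2 / (g * Q) ^ (2 * k) * ‖(∑ q ∈ Icc 1 Q, χ q) ^ k‖ ^ 2) :=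
          sum_le_sum_of_subset_of_nonneg (filter_subset _ _) fun _ _ _ => by positivity
      _ = (g * Q) ^ 2 * ∑ χ : DirichletCharacter ℂ m, ‖∏ i, ∑ n ∈ Icc 1 (N i), χ n‖ ^ 2 +
          (L * b * Q) ^ 2 / (g * Q) ^ (2 * k) *
            ∑ χ : DirichletCharacter ℂ m, ‖(∑ q ∈ Icc 1 Q, χ q) ^ k‖ ^ 2 := by
          rw [sum_add_distrib, mul_sum, mul_sum]
      _ ≤ (g * Q) ^ 2 * (2 * t ^ c * L ^ 2) +
          (L * b * Q) ^ 2 / (g * Q) ^ (2 * k) * (2 * t ^ k * ((Q ^ k : ℕ) : ℝ) ^ 2) := by gcongr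
      _ = _ := by
          rw [mul_pow g (Q : ℝ) (2 * k), Nat.cast_pow, ← pow_mul (Q : ℝ) k 2, mul_comm k 2]
          have : (Q : ℝ) ^ (2 * k) ≠ 0 := by positivity
          field_simp
  set A : ℝ := (#{x : ZMod m | IsUnit x ∧ ∀ p ∈ P, f p ≠ x} : ℝ) with hA
  have hW : L * Q ≤ (2 * t ^ 2) ^ (c + 1) * (#{p ∈ P | IsUnit (f p)} : ℝ) := by
    rw [hunit, Nat.cast_mul]
    calc L * Q ≤ _ := mul_le_mul hWL hWQ hQ0.le (by positivity)
      _ = _ := by ring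
  have hφ : (m.totient : ℝ) ≤ m := by exact_mod_cast Nat.totient_le m
  set E : ℝ := 2 * t ^ c * g ^ 2 + 2 * t ^ k * b ^ 2 / g ^ (2 * k) with hE
  have hE0 : 0 ≤ E := by positivity
  have hA0 : 0 ≤ A := by positivity
  have hfin : A * (L * Q) ^ 2 ≤ (m * ((2 * t ^ 2) ^ (c + 1)) ^ 2 * E) * (L * Q) ^ 2 := by
    calc A * (L * Q) ^ 2 ≤ A * ((2 * t ^ 2) ^ (c + 1) * (#{p ∈ P | IsUnit (f p)} : ℝ)) ^ 2 := by
          gcongr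
      _ = ((2 * t ^ 2) ^ (c + 1)) ^ 2 * (A * (#{p ∈ P | IsUnit (f p)} : ℝ) ^ 2) := by ring
      _ ≤ ((2 * t ^ 2) ^ (c + 1)) ^ 2 * (m * ((L * Q) ^ 2 * E)) := by
          exact mul_le_mul_of_nonneg_left (hmain.trans (by gcongr)) (by positivity)
      _ = _ := by ring
  exact le_of_mul_le_mul_right hfin (by positivity)

end MissingUnits

section CoprimeClasses

open Finset

/-- The residues modulo `m` of the products `∏ i, n i` with `1 ≤ n i ≤ N i`. -/
def boxProducts (m : ℕ) {ι : Type*} [Fintype ι] [DecidableEq ι] (N : ι → ℕ) : Finset (ZMod m) :=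
  (Fintype.piFinset fun i => Icc 1 (N i)).image fun p => ((∏ i, p i : ℕ) : ZMod m)

theorem card_units_not_mem_boxProducts_le_rpow {ε : ℝ} (hε : 0 < ε) : ∃ δ : ℝ, 0 < δ ∧ ∃ M : ℕ,
    ∀ m : ℕ, M ≤ m → ∀ [NeZero m], (∀ p : ℕ, p.Prime → ¬ p ^ 3 ∣ m) → ∀ (N : Fin 4 → ℕ) (i₀ : Fin 4),
      (∀ i, N i ≤ m ^ 2) → (m : ℝ) ^ (1 / 4 + ε) ≤ N i₀ →
      (m : ℝ) ^ (1 + ε) ≤ ((∏ i, N i : ℕ) : ℝ) →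
      (#{x : ZMod m | IsUnit x ∧ x ∉ boxProducts m N} : ℝ) ≤ (m : ℝ) ^ (1 - δ) := by
  set σ : ℝ := ε / 2 with hσ
  have hσ0 : 0 < σ := by positivity
  obtain ⟨β, hβ, M₁, hM₁⟩ := exists_norm_sum_Icc_le (show 0 < ε / 4 by positivity)
  set k : ℕ := ⌈2 / σ⌉₊ with hk
  have hkσ : 2 / σ ≤ k := Nat.le_ceil _
  have hk0 : (0 : ℝ) < k := lt_of_lt_of_le (by positivity) hkσ
  have hk1 : (1 : ℝ) ≤ k := by
    have : 0 < k := by exact_mod_cast hk0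
    exact_mod_cast this
  set κ : ℝ := β / (2 * k * (24 + k)) with hκ
  have hκ0 : 0 < κ := by positivity
  set c : ℝ := 8 + σ * k with hc
  have hc0 : 0 < c := by positivity
  obtain ⟨C, hC1, hC⟩ := Nat.card_divisors_le_mul_rpow (show 0 < κ / c by positivity)
  obtain ⟨M₂, hM₂⟩ := exists_nat_forall_le_rpow 2 (show 0 < σ / 2 by positivity)
  obtain ⟨M₃, hM₃⟩ := exists_nat_forall_le_rpow (2 ^ 12 * C ^ (24 + k))
    (show 0 < β / (4 * k) by positivity)
  refine ⟨β / (4 * k), by positivity, max (max M₁ M₂) (max M₃ 1), ?_⟩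
  intro m hm _ hcube N i₀ hNm hN₀ hprod
  simp only [max_le_iff] at hm
  obtain ⟨⟨hm1, hm2⟩, hm3, hm4⟩ := hm
  have h2 := hM₂ m hm2
  have h3 := hM₃ m hm3
  have hmr : (1 : ℝ) ≤ m := by exact_mod_cast hm4
  have hm0 : (0 : ℝ) < m := by linarith
  have hmono : ∀ {x y : ℝ}, x ≤ y → (m : ℝ) ^ x ≤ (m : ℝ) ^ y := fun h =>
    Real.rpow_le_rpow_of_exponent_le hmr h
  have hone : ∀ {y : ℝ}, 0 ≤ y → 1 ≤ (m : ℝ) ^ y := fun h => Real.one_le_rpow hmr h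
  -- the auxiliary variable
  set Q : ℕ := ⌊(m : ℝ) ^ σ⌋₊ with hQ
  have hQle : (Q : ℝ) ≤ (m : ℝ) ^ σ := Nat.floor_le (by positivity)
  have hQge : (m : ℝ) ^ (σ / 2) ≤ Q := by
    have e1 : (m : ℝ) ^ σ = (m : ℝ) ^ (σ / 2) * (m : ℝ) ^ (σ / 2) := by
      rw [← Real.rpow_add hm0]; ring_nf
    have e2 : (m : ℝ) ^ σ < Q + 1 := Nat.lt_floor_add_one _
    nlinarith
  have hQ1 : (1 : ℝ) ≤ Q := (hone (by positivity)).trans hQge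
  have hQ0 : 0 < Q := by exact_mod_cast (lt_of_lt_of_le one_pos hQ1)
  have hQN : Q ≤ N i₀ := by
    have : (Q : ℝ) ≤ N i₀ := (hQle.trans (hmono (by rw [hσ]; linarith))).trans hN₀
    exact_mod_cast this
  set Y : ℕ := N i₀ / Q with hY
  have hYQ : Y * Q ≤ N i₀ := Nat.div_mul_le_self _ _
  have hY0 : 0 < Y := Nat.div_pos hQN hQ0
  have hNY : (N i₀ : ℝ) ≤ 2 * Q * Y := by
    have e1 : N i₀ < Q * Y + Q := by
      have := Nat.lt_div_mul_add (a := N i₀) hQ0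
      rw [mul_comm]; exact this
    have e2 : Q ≤ Q * Y := Nat.le_mul_of_pos_right _ hY0
    have e3 : N i₀ ≤ 2 * Q * Y := by rw [mul_assoc]; omega
    exact_mod_cast e3
  have hYge : (m : ℝ) ^ (1 / 4 + ε / 4) ≤ Y := by
    have e1 : (m : ℝ) ^ (1 / 4 + ε) =
        (m : ℝ) ^ (σ / 2) * (m : ℝ) ^ σ * (m : ℝ) ^ (1 / 4 + ε / 4) := by
      rw [← Real.rpow_add hm0, ← Real.rpow_add hm0]; congr 1; rw [hσ]; ring
    have e2 : (m : ℝ) ^ (σ / 2) * (m : ℝ) ^ σ * (m : ℝ) ^ (1 / 4 + ε / 4) ≤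
        (m : ℝ) ^ (σ / 2) * (m : ℝ) ^ σ * Y := by
      rw [← e1]
      calc _ ≤ (N i₀ : ℝ) := hN₀
        _ ≤ 2 * Q * Y := hNY
        _ ≤ _ := by gcongr
    exact le_of_mul_le_mul_left e2 (by positivity)
  set N' : Fin 4 → ℕ := Function.update N i₀ Y with hN'
  set R : ℕ := ∏ i ∈ univ.erase i₀, N i with hR
  have hL : ∏ i, N i = N i₀ * R := (mul_prod_erase _ _ (mem_univ i₀)).symm
  have hL' : ∏ i, N' i = Y * R := by
    rw [← mul_prod_erase _ _ (mem_univ i₀), hN', Function.update_self]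
    congr 1
    exact prod_congr rfl fun i hi => Function.update_of_ne (ne_of_mem_erase hi) _ _
  have hprod0 : 0 < ∏ i, N i := by
    have : (0 : ℝ) < ((∏ i, N i : ℕ) : ℝ) := lt_of_lt_of_le (by positivity) hprod
    exact_mod_cast this
  have hNpos : ∀ i, 0 < N i := fun i =>
    Nat.pos_of_ne_zero (prod_ne_zero_iff.1 hprod0.ne' i (mem_univ i))
  have hN'pos : ∀ i, 0 < N' i := by
    intro i
    rcases eq_or_ne i i₀ with rfl | h
    · simpa [hN'] using hY0
    · simpa [hN', h] using hNpos i
  have hmL : m ≤ ∏ i, N' i := by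
    have e1 : (m : ℝ) ^ (σ / 2) * (m : ℝ) ^ σ * m ≤ (m : ℝ) ^ (σ / 2) * (m : ℝ) ^ σ * (Y * R) := by
      calc _ = (m : ℝ) ^ (σ / 2 + σ + 1) := by
            rw [Real.rpow_add hm0, Real.rpow_add hm0, Real.rpow_one]
        _ ≤ (m : ℝ) ^ (1 + ε) := hmono (by rw [hσ]; linarith)
        _ ≤ _ := hprod
        _ = (N i₀ : ℝ) * R := by rw [hL]; push_cast; ring
        _ ≤ 2 * Q * Y * R := by gcongr
        _ = 2 * Q * (Y * R) := by ring
        _ ≤ _ := by gcongr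
    have e2 : (m : ℝ) ≤ Y * R := le_of_mul_le_mul_left e1 (by positivity)
    rw [hL']; exact_mod_cast e2
  have hmQ : m ≤ Q ^ k := by
    have : (m : ℝ) ≤ (Q : ℝ) ^ k := by
      calc (m : ℝ) = (m : ℝ) ^ (1 : ℝ) := (Real.rpow_one _).symm
        _ ≤ (m : ℝ) ^ (σ / 2 * k) := hmono (by
            have := (div_le_iff₀ hσ0).1 hkσ
            linarith)
        _ = ((m : ℝ) ^ (σ / 2)) ^ k := by rw [Real.rpow_mul hm0.le, Real.rpow_natCast]
        _ ≤ _ := by gcongr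
    exact_mod_cast this
  set t : ℝ := C * (m : ℝ) ^ κ with ht
  have ht1 : 1 ≤ t := one_le_mul_of_one_le_of_one_le hC1 (hone hκ0.le)
  have hdiv : ∀ n : ℕ, n ≠ 0 → (n : ℝ) ≤ (m : ℝ) ^ c → (n.divisors.card : ℝ) ≤ t := by
    intro n hn hnm
    refine (hC n hn).trans ?_
    rw [ht]
    gcongr
    calc (n : ℝ) ^ (κ / c) ≤ ((m : ℝ) ^ c) ^ (κ / c) := by gcongr
      _ = (m : ℝ) ^ κ := by rw [← Real.rpow_mul hm0.le]; congr 1; field_simp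
  have hdL : ∀ n : ℕ, n ≠ 0 → n ≤ ∏ i, N' i → (n.divisors.card : ℝ) ≤ t := by
    intro n hn hnL
    refine hdiv n hn ?_
    have e1 : n ≤ m ^ 8 := by
      calc n ≤ ∏ i, N' i := hnL
        _ ≤ ∏ i, N i := by rw [hL, hL']; exact Nat.mul_le_mul_right _ (Nat.div_le_self _ _)
        _ ≤ ∏ _i : Fin 4, m ^ 2 := prod_le_prod' fun i _ => hNm i
        _ = m ^ 8 := by simp [← pow_mul]
    calc (n : ℝ) ≤ (m : ℝ) ^ 8 := by exact_mod_cast e1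
      _ = (m : ℝ) ^ (8 : ℝ) := by norm_cast
      _ ≤ _ := hmono (by rw [hc]; nlinarith)
  have hdQ : ∀ n : ℕ, n ≠ 0 → n ≤ Q ^ k → (n.divisors.card : ℝ) ≤ t := by
    intro n hn hnQ
    refine hdiv n hn ?_
    calc (n : ℝ) ≤ (Q : ℝ) ^ k := by exact_mod_cast hnQ
      _ ≤ ((m : ℝ) ^ σ) ^ k := by gcongr
      _ = (m : ℝ) ^ (σ * k) := by rw [Real.rpow_mul hm0.le, Real.rpow_natCast]
      _ ≤ _ := hmono (by rw [hc]; linarith)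
  have hdm : (m.divisors.card : ℝ) ≤ t := by
    refine hdiv m (NeZero.ne m) ?_
    calc (m : ℝ) = (m : ℝ) ^ (1 : ℝ) := (Real.rpow_one _).symm
      _ ≤ _ := hmono (by rw [hc]; nlinarith)
  have hS : ∀ χ : DirichletCharacter ℂ m, χ ≠ 1 →
      ‖∏ i, ∑ n ∈ Icc 1 (N' i), χ n‖ ≤ ((∏ i, N' i : ℕ) : ℝ) * (m : ℝ) ^ (-β) := by
    intro χ hχ
    have e1 := hM₁ m hm1 hcube χ hχ Y hYge
    rw [norm_prod, Nat.cast_prod, ← mul_prod_erase _ _ (mem_univ i₀),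
      ← mul_prod_erase _ (fun i => (N' i : ℝ)) (mem_univ i₀), mul_right_comm]
    refine mul_le_mul ?_ (prod_le_prod (fun _ _ => norm_nonneg _) fun i _ =>
      norm_sum_Icc_one_le χ _) (prod_nonneg fun _ _ => norm_nonneg _) (by positivity)
    simpa [hN'] using e1
  have hcore := card_units_not_mem_prod_le N' ht1 (g := (m : ℝ) ^ (-(β / (2 * k)))) (by positivity)
    hQ0 k hN'pos hdm hdL hdQ hmL hmQ hS
  have hsub : (#{x : ZMod m | IsUnit x ∧ x ∉ boxProducts m N} : ℝ) ≤
      #{x : ZMod m | IsUnit x ∧ ∀ p ∈ Fintype.piFinset (fun i => Icc 1 (N' i)) ×ˢ Icc 1 Q,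
        (((∏ i, p.1 i) * p.2 : ℕ) : ZMod m) ≠ x} := by
    norm_cast
    refine card_le_card fun x hx => ?_
    obtain ⟨-, hxu, hx⟩ := mem_filter.1 hx
    refine mem_filter.2 ⟨mem_univ _, hxu, fun p hp => ?_⟩
    obtain ⟨hp1, hp2⟩ := mem_product.1 hp
    rw [Fintype.mem_piFinset] at hp1
    have e1 : ∏ i, Function.update p.1 i₀ (p.1 i₀ * p.2) i = (∏ i, p.1 i) * p.2 := by
      rw [prod_update_of_mem (mem_univ i₀), ← mul_prod_erase univ p.1 (mem_univ i₀),
        sdiff_singleton_eq_erase]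
      ring
    rintro rfl
    refine hx (mem_image.2 ⟨_, Fintype.mem_piFinset.2 fun i => ?_, congrArg _ e1⟩)
    have h5 := mem_Icc.1 (hp1 i)
    rcases eq_or_ne i i₀ with rfl | h
    · rw [Function.update_self]
      rw [hN', Function.update_self] at h5
      have h6 := mem_Icc.1 hp2
      exact mem_Icc.2 ⟨Nat.mul_pos h5.1 h6.1, (Nat.mul_le_mul h5.2 h6.2).trans hYQ⟩
    · rw [Function.update_of_ne h]
      rw [hN', Function.update_of_ne h] at h5
      exact mem_Icc.2 h5
  refine hsub.trans (hcore.trans ?_)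
  rw [Fintype.card_fin]
  have hg2 : ((m : ℝ) ^ (-(β / (2 * k)))) ^ 2 = (m : ℝ) ^ (-(β / k)) := by
    rw [← Real.rpow_natCast, ← Real.rpow_mul hm0.le]; congr 1; push_cast; field_simp
  have hgk : ((m : ℝ) ^ (-β)) ^ 2 / ((m : ℝ) ^ (-(β / (2 * k)))) ^ (2 * k) = (m : ℝ) ^ (-β) := by
    rw [← Real.rpow_natCast _ (2 * k), ← Real.rpow_mul hm0.le, ← Real.rpow_natCast _ 2,
      ← Real.rpow_mul hm0.le, ← Real.rpow_sub hm0]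
    congr 1; push_cast; field_simp; ring
  have hβk : (m : ℝ) ^ (-β) ≤ (m : ℝ) ^ (-(β / k)) :=
    hmono (neg_le_neg (div_le_self hβ.le hk1))
  have ht4 : t ^ 4 ≤ t ^ (4 + k) := pow_le_pow_right₀ ht1 (by omega)
  have htk : t ^ k ≤ t ^ (4 + k) := pow_le_pow_right₀ ht1 (by omega)
  rw [mul_div_assoc, hg2, hgk]
  calc m * ((2 * t ^ 2) ^ (4 + 1)) ^ 2 *
        (2 * t ^ 4 * (m : ℝ) ^ (-(β / k)) + 2 * t ^ k * (m : ℝ) ^ (-β)) ≤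
        m * ((2 * t ^ 2) ^ (4 + 1)) ^ 2 *
        (2 * t ^ (4 + k) * (m : ℝ) ^ (-(β / k)) + 2 * t ^ (4 + k) * (m : ℝ) ^ (-(β / k))) := by
          gcongr
    _ = 2 ^ 12 * t ^ (24 + k) * (m ^ (1 : ℝ) * (m : ℝ) ^ (-(β / k))) := by
          rw [Real.rpow_one]; ring
    _ = 2 ^ 12 * C ^ (24 + k) * (((m : ℝ) ^ κ) ^ (24 + k) * (m : ℝ) ^ (1 - β / k)) := by
          rw [← Real.rpow_add hm0, ht, mul_pow]; ring_nf
    _ = 2 ^ 12 * C ^ (24 + k) * (m : ℝ) ^ (1 - β / (2 * k)) := by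
          rw [← Real.rpow_natCast ((m : ℝ) ^ κ) (24 + k), ← Real.rpow_mul hm0.le,
            ← Real.rpow_add hm0]
          congr 2; rw [hκ]; push_cast; field_simp; ring
    _ ≤ (m : ℝ) ^ (β / (4 * k)) * (m : ℝ) ^ (1 - β / (2 * k)) := by gcongr
    _ = _ := by
          rw [← Real.rpow_add hm0]; congr 1; field_simp; ring

end CoprimeClasses

section AllClasses

open Finset

theorem mem_boxProducts {m : ℕ} {ι : Type*} [Fintype ι] [DecidableEq ι] {N : ι → ℕ} {x : ZMod m} :
    x ∈ boxProducts m N ↔ ∃ p : ι → ℕ, (∀ i, 1 ≤ p i ∧ p i ≤ N i) ∧ ((∏ i, p i : ℕ) : ZMod m) = x := by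
  simp only [boxProducts, mem_image, Fintype.mem_piFinset, mem_Icc]

theorem prod_update_mul_self {ι : Type*} [Fintype ι] [DecidableEq ι] (p : ι → ℕ) (i₀ : ι) (d : ℕ) :
    ∏ i, Function.update p i₀ (p i₀ * d) i = d * ∏ i, p i := by
  rw [prod_update_of_mem (mem_univ i₀), ← mul_prod_erase univ p (mem_univ i₀),
    sdiff_singleton_eq_erase]
  ring

theorem boxProducts_eq_univ {m : ℕ} [NeZero m] {ι : Type*} [Fintype ι] [DecidableEq ι] {N : ι → ℕ}
    (hN : ∀ i, 0 < N i) {i₀ : ι} (h : m ≤ N i₀) : boxProducts m N = univ := by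
  refine eq_univ_iff_forall.2 fun x => mem_boxProducts.2 ?_
  obtain ⟨a, ha1, ham, hax⟩ : ∃ a : ℕ, 1 ≤ a ∧ a ≤ m ∧ (a : ZMod m) = x := by
    by_cases hx : x = 0
    · exact ⟨m, NeZero.pos m, le_rfl, by simp [hx]⟩
    · exact ⟨x.val, Nat.pos_of_ne_zero ((ZMod.val_ne_zero x).2 hx), x.val_lt.le, by simp⟩
  refine ⟨Function.update (fun _ => 1) i₀ (1 * a), fun i => ?_, ?_⟩
  · rcases eq_or_ne i i₀ with rfl | hi
    · simpa using ⟨ha1, ham.trans h⟩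
    · simpa [hi] using Nat.succ_le_of_lt (hN i)
  · have := prod_update_mul_self (fun _ : ι => 1) i₀ a
    rw [this]; simpa using hax

theorem ZMod.card_filter_gcd_val_eq_le {m d : ℕ} [NeZero m] (hd : d ∣ m) :
    #{x : ZMod m | x.val.gcd m = d} ≤ m / d := by
  have hd0 : 0 < d := Nat.pos_of_dvd_of_pos hd (NeZero.pos m)
  rw [← card_range (m / d)]
  refine card_le_card_of_injOn (fun x => x.val / d) (fun x hx => ?_) fun x hx y hy h => ?_
  · exact mem_coe.2 (mem_range.2 (Nat.div_lt_div_of_lt_of_dvd hd x.val_lt))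
  · have hx' : d ∣ x.val := (mem_filter.1 hx).2 ▸ Nat.gcd_dvd_left _ _
    have hy' : d ∣ y.val := (mem_filter.1 hy).2 ▸ Nat.gcd_dvd_left _ _
    exact ZMod.val_injective m ((Nat.div_left_inj hx' hy').1 h)

theorem card_gcd_eq_not_mem_boxProducts_le {m d : ℕ} [NeZero m] (hd : d ∣ m) [NeZero (m / d)]
    {ι : Type*} [Fintype ι] [DecidableEq ι] (N : ι → ℕ) (i₀ : ι) :
    #{x : ZMod m | x ∉ boxProducts m N ∧ x.val.gcd m = d} ≤
      #{y : ZMod (m / d) | IsUnit y ∧ y ∉ boxProducts (m / d) (Function.update N i₀ (N i₀ / d))} := by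
  have hd0 : 0 < d := Nat.pos_of_dvd_of_pos hd (NeZero.pos m)
  have hmd : d * (m / d) = m := Nat.mul_div_cancel' hd
  have hdv : ∀ x : ZMod m, x.val.gcd m = d → d ∣ x.val := fun x h => h ▸ Nat.gcd_dvd_left _ _
  have hlt : ∀ x : ZMod m, x.val / d < m / d := fun x => Nat.div_lt_div_of_lt_of_dvd hd x.val_lt
  refine card_le_card_of_injOn (fun x => ((x.val / d : ℕ) : ZMod (m / d))) (fun x hx => ?_)
    fun x hx y hy h => ?_
  · obtain ⟨-, hxN, hxd⟩ := mem_filter.1 hx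
    refine mem_coe.2 (mem_filter.2 ⟨mem_univ _, ?_, fun hmem => hxN ?_⟩)
    · rw [ZMod.isUnit_iff_coprime]
      have h1 := Nat.coprime_div_gcd_div_gcd (m := x.val) (n := m) (by rw [hxd]; exact hd0)
      rwa [hxd] at h1
    · obtain ⟨p, hp, hpx⟩ := mem_boxProducts.1 hmem
      refine mem_boxProducts.2 ⟨Function.update p i₀ (p i₀ * d), fun i => ?_, ?_⟩
      · have h5 := hp i
        rcases eq_or_ne i i₀ with rfl | hi
        · rw [Function.update_self] at h5 ⊢
          exact ⟨Nat.mul_pos h5.1 hd0, (Nat.mul_le_mul_right d h5.2).trans (Nat.div_mul_le_self _ _)⟩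
        · rw [Function.update_of_ne hi] at h5 ⊢
          exact h5
      · rw [prod_update_mul_self]
        have h6 := (ZMod.natCast_eq_natCast_iff _ _ _).1 hpx
        have h7 := h6.mul_left' d
        rw [hmd, Nat.mul_div_cancel' (hdv x hxd)] at h7
        rw [(ZMod.natCast_eq_natCast_iff _ _ _).2 h7]
        simp
  · have hx' := hdv x (mem_filter.1 hx).2.2
    have hy' := hdv y (mem_filter.1 hy).2.2
    have h1 := (ZMod.natCast_eq_natCast_iff _ _ _).1 h
    have h2 := Nat.ModEq.eq_of_lt_of_lt h1 (hlt x) (hlt y)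
    exact ZMod.val_injective m ((Nat.div_left_inj hx' hy').1 h2)

theorem card_not_mem_boxProducts_le {m : ℕ} [NeZero m] {ι : Type*} [Fintype ι] [DecidableEq ι]
    (N : ι → ℕ) :
    #{x : ZMod m | x ∉ boxProducts m N} ≤
      ∑ d ∈ m.divisors, #{x : ZMod m | x ∉ boxProducts m N ∧ x.val.gcd m = d} := by
  rw [card_eq_sum_card_fiberwise (f := fun x : ZMod m => x.val.gcd m) (t := m.divisors)
    fun x _ => mem_coe.2 (Nat.mem_divisors.2 ⟨Nat.gcd_dvd_right _ _, NeZero.ne m⟩)]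
  simp only [filter_filter, le_refl]

theorem exists_card_not_mem_boxProducts_le_rpow {ε : ℝ} (hε : 0 < ε) : ∃ δ : ℝ, 0 < δ ∧ ∃ M : ℕ,
    ∀ m : ℕ, M ≤ m → ∀ [NeZero m], (∀ p : ℕ, p.Prime → ¬ p ^ 3 ∣ m) → ∀ N : Fin 4 → ℕ,
      (m : ℝ) ^ (1 + ε) ≤ ((∏ i, N i : ℕ) : ℝ) →
      (#{x : ZMod m | x ∉ boxProducts m N} : ℝ) ≤ (m : ℝ) ^ (1 - δ) := by
  obtain ⟨δ₁, hδ₁, M₁, hM₁⟩ := card_units_not_mem_boxProducts_le_rpow (show 0 < ε / 16 by positivity)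
  set κ : ℝ := min (ε / 16) (1 / 2) with hκ
  have hκ0 : 0 < κ := by positivity
  have hκ1 : κ ≤ ε / 16 := min_le_left _ _
  have hκ2 : κ ≤ 1 / 2 := min_le_right _ _
  set δ : ℝ := min δ₁ κ with hδ
  have hδ0 : 0 < δ := by positivity
  have hδ1 : δ ≤ δ₁ := min_le_left _ _
  have hδ2 : δ ≤ κ := min_le_right _ _
  obtain ⟨M₂, hM₂⟩ := exists_nat_forall_le_rpow 2 (show 0 < ε / 16 by positivity)
  obtain ⟨M₃, hM₃⟩ := exists_nat_forall_le_rpow M₁ (show (0 : ℝ) < 1 / 2 by norm_num)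
  obtain ⟨M₄, hM₄1, hM₄⟩ := Nat.exists_forall_card_divisors_le_rpow 1 (half_pos hδ0)
  refine ⟨δ / 2, by positivity, max (max M₂ M₃) M₄, ?_⟩
  intro m hm _ hcube N hprod
  simp only [max_le_iff] at hm
  obtain ⟨⟨hm2, hm3⟩, hm4⟩ := hm
  have h2 := hM₂ m hm2
  have h3 := hM₃ m hm3
  have h4 := hM₄ m hm4
  have hmr : (1 : ℝ) ≤ m := by exact_mod_cast hM₄1.trans hm4
  have hm0 : (0 : ℝ) < m := by linarith
  have hmono : ∀ {x y : ℝ}, x ≤ y → (m : ℝ) ^ x ≤ (m : ℝ) ^ y := fun h =>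
    Real.rpow_le_rpow_of_exponent_le hmr h
  have hprod0 : 0 < ∏ i, N i := by
    have : (0 : ℝ) < ((∏ i, N i : ℕ) : ℝ) := lt_of_lt_of_le (by positivity) hprod
    exact_mod_cast this
  have hNpos : ∀ i, 0 < N i := fun i =>
    Nat.pos_of_ne_zero (prod_ne_zero_iff.1 hprod0.ne' i (mem_univ i))
  by_cases hbig : ∃ i, m ≤ N i
  · obtain ⟨i, hi⟩ := hbig
    simp only [boxProducts_eq_univ hNpos hi, mem_univ, not_true, filter_false, card_empty,
      Nat.cast_zero]
    positivity
  push Not at hbig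
  obtain ⟨i₀, -, hi₀⟩ := exists_max_image univ N univ_nonempty
  have hN₀ : (m : ℝ) ^ (1 / 4 + ε / 4) ≤ N i₀ := by
    have e1 : ((m : ℝ) ^ (1 / 4 + ε / 4)) ^ 4 ≤ (N i₀ : ℝ) ^ 4 := by
      rw [← Real.rpow_natCast, ← Real.rpow_mul hm0.le]
      calc (m : ℝ) ^ ((1 / 4 + ε / 4) * (4 : ℕ)) = (m : ℝ) ^ (1 + ε) := by
            congr 1; push_cast; ring
        _ ≤ _ := hprod
        _ ≤ ((∏ _i : Fin 4, N i₀ : ℕ) : ℝ) := by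
            exact_mod_cast prod_le_prod' fun i hi => hi₀ i hi
        _ = _ := by simp
    exact le_of_pow_le_pow_left₀ (by norm_num) (by positivity) e1
  have key : ∀ d ∈ m.divisors, (#{x : ZMod m | x ∉ boxProducts m N ∧ x.val.gcd m = d} : ℝ) ≤
      (m : ℝ) ^ (1 - δ) := by
    intro d hd
    have hdm := Nat.dvd_of_mem_divisors hd
    have hd0 : 0 < d := Nat.pos_of_mem_divisors hd
    have hd0' : (0 : ℝ) < d := by exact_mod_cast hd0
    have hm'0 : 0 < m / d := Nat.div_pos (Nat.le_of_dvd (NeZero.pos m) hdm) hd0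
    have hm'1 : (1 : ℝ) ≤ ((m / d : ℕ) : ℝ) := by exact_mod_cast hm'0
    have hcast : ((m / d : ℕ) : ℝ) = (m : ℝ) / d := Nat.cast_div hdm hd0'.ne'
    have hm'm : ((m / d : ℕ) : ℝ) ≤ m := by exact_mod_cast Nat.div_le_self _ _
    rcases lt_or_ge ((m : ℝ) ^ κ) d with hdκ | hdκ
    · calc (#{x : ZMod m | x ∉ boxProducts m N ∧ x.val.gcd m = d} : ℝ) ≤ ((m / d : ℕ) : ℝ) := by
            norm_cast
            exact (card_le_card fun x hx => mem_filter.2 ⟨mem_univ _, (mem_filter.1 hx).2.2⟩).trans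
              (ZMod.card_filter_gcd_val_eq_le hdm)
        _ = (m : ℝ) / d := hcast
        _ ≤ (m : ℝ) / (m : ℝ) ^ κ := by gcongr
        _ = (m : ℝ) ^ (1 - κ) := by rw [Real.rpow_sub hm0, Real.rpow_one]
        _ ≤ _ := hmono (by linarith)
    · have : NeZero (m / d) := ⟨hm'0.ne'⟩
      have hm'ge : (m : ℝ) ^ (1 / 2 : ℝ) ≤ ((m / d : ℕ) : ℝ) := by
        calc _ ≤ (m : ℝ) ^ (1 - κ) := hmono (by linarith)
          _ = (m : ℝ) / (m : ℝ) ^ κ := by rw [Real.rpow_sub hm0, Real.rpow_one]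
          _ ≤ (m : ℝ) / d := by gcongr
          _ = _ := hcast.symm
      have hdN : d ≤ N i₀ := by
        have : (d : ℝ) ≤ N i₀ := (hdκ.trans (hmono (by linarith))).trans hN₀
        exact_mod_cast this
      set Y := N i₀ / d with hY
      have hNY : (N i₀ : ℝ) ≤ 2 * d * Y := by
        have e1 : N i₀ < d * Y + d := by
          have := Nat.lt_div_mul_add (a := N i₀) hd0
          rw [mul_comm]; exact this
        have e2 : d ≤ d * Y := Nat.le_mul_of_pos_right _ (Nat.div_pos hdN hd0)
        have e3 : N i₀ ≤ 2 * d * Y := by rw [mul_assoc]; omega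
        exact_mod_cast e3
      have hcan : ∀ {a z : ℝ}, 0 ≤ a → (m : ℝ) ^ (a + ε / 16 + κ) ≤ 2 * d * z →
          0 ≤ z → ((m / d : ℕ) : ℝ) ^ a ≤ z := by
        intro a z ha haz hz
        have e1 : (m : ℝ) ^ a * ((m : ℝ) ^ (ε / 16) * (m : ℝ) ^ κ) ≤
            z * ((m : ℝ) ^ (ε / 16) * (m : ℝ) ^ κ) := by
          calc _ = (m : ℝ) ^ (a + ε / 16 + κ) := by
                rw [Real.rpow_add hm0, Real.rpow_add hm0]; ring
            _ ≤ _ := haz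
            _ = z * (2 * d) := by ring
            _ ≤ _ := by gcongr
        refine le_trans ?_ (le_of_mul_le_mul_right e1 (by positivity))
        gcongr
      set N' := Function.update N i₀ Y with hN'
      have hprod' : ∏ i, N i ≤ 2 * d * ∏ i, N' i := by
        rw [hN', prod_update_of_mem (mem_univ i₀), ← mul_prod_erase univ N (mem_univ i₀),
          sdiff_singleton_eq_erase, ← mul_assoc]
        refine Nat.mul_le_mul_right _ ?_
        exact_mod_cast hNY
      have happ := hM₁ (m / d) (by exact_mod_cast h3.trans hm'ge)
        (fun p hp h => hcube p hp (h.trans (Nat.div_dvd_of_dvd hdm))) N' i₀ ?_ ?_ ?_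
      · calc (#{x : ZMod m | x ∉ boxProducts m N ∧ x.val.gcd m = d} : ℝ) ≤ _ := by
              exact_mod_cast card_gcd_eq_not_mem_boxProducts_le hdm N i₀
          _ ≤ ((m / d : ℕ) : ℝ) ^ (1 - δ₁) := happ
          _ ≤ ((m / d : ℕ) : ℝ) ^ (1 - δ) := Real.rpow_le_rpow_of_exponent_le hm'1 (by linarith)
          _ ≤ _ := Real.rpow_le_rpow (by positivity) hm'm (by linarith)
      · intro i
        have e1 : N' i ≤ N i := by
          rcases eq_or_ne i i₀ with rfl | hi
          · simpa [hN'] using Nat.div_le_self _ _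
          · simp [hN', hi]
        have e2 : (m : ℝ) ≤ ((m / d : ℕ) : ℝ) ^ 2 := by
          calc (m : ℝ) = ((m : ℝ) ^ (1 / 2 : ℝ)) ^ 2 := by
                rw [← Real.rpow_natCast, ← Real.rpow_mul hm0.le]; norm_num
            _ ≤ _ := by gcongr
        have e3 : m ≤ (m / d) ^ 2 := by exact_mod_cast e2
        exact (e1.trans (hbig i).le).trans e3
      · rw [hN', Function.update_self]
        exact hcan (by positivity) (((hmono (by linarith)).trans hN₀).trans hNY) (by positivity)
      · refine hcan (by positivity) ((hmono (by linarith)).trans (hprod.trans ?_)) (by positivity)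
        exact_mod_cast hprod'
  calc (#{x : ZMod m | x ∉ boxProducts m N} : ℝ) ≤
        ∑ d ∈ m.divisors, (#{x : ZMod m | x ∉ boxProducts m N ∧ x.val.gcd m = d} : ℝ) := by
          exact_mod_cast card_not_mem_boxProducts_le N
    _ ≤ ∑ d ∈ m.divisors, (m : ℝ) ^ (1 - δ) := sum_le_sum key
    _ = (1 * (m.divisors.card : ℝ)) * (m : ℝ) ^ (1 - δ) := by rw [sum_const, nsmul_eq_mul, one_mul]
    _ ≤ (m : ℝ) ^ (δ / 2) * (m : ℝ) ^ (1 - δ) := by gcongr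
    _ = _ := by rw [← Real.rpow_add hm0]; congr 1; ring

end AllClasses

/-- For every fixed ε > 0 there is δ > 0 and a constant C such that for all sufficiently
large cubefree m and all positive N₁, N₂, N₃, N₄ with N₁N₂N₃N₄ > m^(1+ε), the number of
residue classes x₁x₂x₃x₄ mod m with xⱼ ∈ [1,Nⱼ] equals m + O(m^(1-δ)). -/
theorem stmt1 :
    ∀ ε : ℝ, 0 < ε → ∃ δ : ℝ, 0 < δ ∧ ∃ C : ℝ, 0 < C ∧ ∃ M : ℕ, ∀ m : ℕ, M ≤ m →
      (∀ p : ℕ, p.Prime → ¬ p ^ 3 ∣ m) →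
      ∀ N₁ N₂ N₃ N₄ : ℕ, 0 < N₁ → 0 < N₂ → 0 < N₃ → 0 < N₄ →
      (m : ℝ) ^ ((1 : ℝ) + ε) < ((N₁ * N₂ * N₃ * N₄ : ℕ) : ℝ) →
      |(((Finset.Icc 1 N₁ ×ˢ Finset.Icc 1 N₂ ×ˢ Finset.Icc 1 N₃ ×ˢ Finset.Icc 1 N₄).image
          (fun t => ((t.1 * t.2.1 * t.2.2.1 * t.2.2.2 : ℕ) : ZMod m))).card : ℝ) - (m : ℝ)|
        ≤ C * (m : ℝ) ^ ((1 : ℝ) - δ) := by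
  intro ε hε
  obtain ⟨δ, hδ, M, hM⟩ := exists_card_not_mem_boxProducts_le_rpow hε
  refine ⟨δ, hδ, 1, one_pos, max M 1, fun m hm hcube N₁ N₂ N₃ N₄ _ _ _ _ hprod => ?_⟩
  have : NeZero m := ⟨(lt_of_lt_of_le one_pos ((le_max_right _ _).trans hm)).ne'⟩
  have hprod' : ∏ i, ![N₁, N₂, N₃, N₄] i = N₁ * N₂ * N₃ * N₄ := by
    simp [Fin.prod_univ_four]
  have hmiss := hM m ((le_max_left _ _).trans hm) hcube ![N₁, N₂, N₃, N₄]
    (by rw [hprod']; exact hprod.le)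
  have himage : (Finset.Icc 1 N₁ ×ˢ Finset.Icc 1 N₂ ×ˢ Finset.Icc 1 N₃ ×ˢ Finset.Icc 1 N₄).image
      (fun t => ((t.1 * t.2.1 * t.2.2.1 * t.2.2.2 : ℕ) : ZMod m)) =
      boxProducts m ![N₁, N₂, N₃, N₄] := by
    ext x
    simp only [mem_boxProducts, Finset.mem_image, Finset.mem_product, Finset.mem_Icc, Prod.exists,
      Fin.forall_fin_succ, Fin.prod_univ_four]
    constructor
    · rintro ⟨a, b, c, d, ⟨ha, hb, hc, hd⟩, h⟩
      exact ⟨![a, b, c, d], by simpa using ⟨ha, hb, hc, hd⟩, by simpa using h⟩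
    · rintro ⟨p, hp, h⟩
      exact ⟨p 0, p 1, p 2, p 3, by simpa using hp, h⟩
  have hcard : (boxProducts m ![N₁, N₂, N₃, N₄]).card +
      (Finset.univ.filter fun x : ZMod m => x ∉ boxProducts m ![N₁, N₂, N₃, N₄]).card = m := by
    have h := Finset.card_filter_add_card_filter_not (s := (Finset.univ : Finset (ZMod m)))
      (fun x => x ∈ boxProducts m ![N₁, N₂, N₃, N₄])
    rwa [Finset.card_univ, ZMod.card, Finset.filter_univ_mem] at h
  have hcard' : ((boxProducts m ![N₁, N₂, N₃, N₄]).card : ℝ) +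
      (Finset.univ.filter fun x : ZMod m => x ∉ boxProducts m ![N₁, N₂, N₃, N₄]).card = m := by
    exact_mod_cast hcard
  rw [himage, one_mul, abs_sub_comm, abs_of_nonneg]
  · linarith
  · linarith [Nat.cast_nonneg (α := ℝ)
      (Finset.univ.filter fun x : ZMod m => x ∉ boxProducts m ![N₁, N₂, N₃, N₄]).card]
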